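/- Suppose (A1)-(A3) hold and let q ∈ S_+^d have exactly one zero coordinate, i.e. Λ(q) = {i} for some 1 ≤ i ≤ d. Then: (i) the function h_q(x) = x^i exp(a(q)·x) − E_x(S^i(τ) exp(a(q)·S(τ)); τ < ∞) is strictly positive and harmonic for (Z(t)); (ii) every sequence x_n ∈ ℤ_+^d with |x_n| → ∞ and x_n/|x_n| → q is fundamental for (Z(t)), and for every x ∈ ℤ_+^d, lim_n G(x,x_n)/G(x_0,x_n) = h_q(x)/h_q(x_0). -/

import Mathlib

open Filter Topology

attribute [local instance] Classical.propDecidable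

noncomputable section

variable {V : Type*} [AddCommGroup V]

/-- `n`-step transition kernel of the random walk with step distribution `μ`,
killed upon leaving the set `A` : `kern μ A n x y = P_x(S n = y, τ_A > n)`,
where `τ_A` is the first exit time from `A`. -/
def kern (μ : V → ℝ) (A : Set V) : ℕ → V → V → ℝ
  | 0 => fun x y => if x = y ∧ x ∈ A then 1 else 0
  | n + 1 => fun x y => ∑' z : V, (if x ∈ A then μ (z - x) else 0) * kern μ A n z y

/-- Green function of the walk killed outside `A`. -/
def green (μ : V → ℝ) (A : Set V) (x y : V) : ℝ :=
  ∑' n : ℕ, kern μ A n x y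

/-- `E_x [ g(S τ) ; S τ ∈ B, τ < ∞ ]`, where `τ` is the first exit time from `A`. -/
def exitExp (μ : V → ℝ) (A B : Set V) (g : V → ℝ) (x : V) : ℝ :=
  ∑' n : ℕ, ∑' z : V, kern μ A n x z *
    ∑' y : V, (if y ∉ A ∧ y ∈ B then μ (y - z) else 0) * g y

/-- `ℝ≥0∞`-valued version of `exitExp`. -/
def exitExpE (μ : V → ℝ) (A B : Set V) (g : V → ℝ) (x : V) : ENNReal :=
  ∑' n : ℕ, ∑' z : V, ENNReal.ofReal (kern μ A n x z) *
    ∑' y : V, ENNReal.ofReal ((if y ∉ A ∧ y ∈ B then μ (y - z) else 0) * g y)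

/-- `P_x(S t = y for some t ≥ 0)` for the walk killed outside `A`
(first passage decomposition). -/
def hitProb (μ : V → ℝ) (A : Set V) (x y : V) : ℝ :=
  (if x = y ∧ x ∈ A then 1 else 0) +
    ∑' n : ℕ, ∑' z : V, kern μ (A \ {y}) n x z * (if y ∈ A then μ (y - z) else 0)

/-- `h` is (strictly speaking, satisfies the mean value property of a) harmonic
function on `A` for the walk with step distribution `μ` killed outside `A`. -/
def HarmOn (μ : V → ℝ) (A : Set V) (h : V → ℝ) : Prop :=
  ∀ x ∈ A, h x = ∑' y : V, if y ∈ A then μ (y - x) * h y else 0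

/-- Irreducibility of the walk killed outside `A`. -/
def Irred (μ : V → ℝ) (A : Set V) : Prop :=
  ∀ x ∈ A, ∀ x' ∈ A, ∃ (k : ℕ) (c : ℕ → V), c 0 = x ∧ c k = x' ∧
    (∀ j ≤ k, c j ∈ A) ∧ ∀ j < k, 0 < μ (c (j + 1) - c j)

/-- A sequence `xs` is fundamental for the walk killed outside `A` :
the Martin kernels `G(x, xs n)/G(x₀, xs n)` converge for every `x ∈ A`. -/
def Fundamental (μ : V → ℝ) (A : Set V) (x₀ : V) (xs : ℕ → V) : Prop :=
  ∀ x ∈ A, ∃ L : ℝ,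
    Tendsto (fun n => green μ A x (xs n) / green μ A x₀ (xs n)) atTop (𝓝 L)

/-- ℓ¹-norm of an integer vector. -/
def znorm {ι : Type*} [Fintype ι] (x : ι → ℤ) : ℝ := ∑ i, |(x i : ℝ)|

/-- ℓ¹-norm of a real vector. -/
def rnorm {ι : Type*} [Fintype ι] (q : ι → ℝ) : ℝ := ∑ i, |q i|

variable {d : ℕ}

/-- `ℤ^{Λ,d}_+ = {x ∈ ℤ^d : xⁱ > 0 for all i ∈ Λ}`. -/
def posDom (Λ : Set (Fin d)) : Set (Fin d → ℤ) := {x | ∀ i ∈ Λ, 0 < x i}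

/-- `ℤ^d_+ = {x ∈ ℤ^d : xⁱ > 0 for all i}`. -/
def posAll : Set (Fin d → ℤ) := {x | ∀ i, 0 < x i}

/-- `a · z` for `a ∈ ℝ^d`, `z ∈ ℤ^d`. -/
def dotZ (a : Fin d → ℝ) (z : Fin d → ℤ) : ℝ := ∑ i, a i * (z i : ℝ)

/-- `a · q` for `a, q ∈ ℝ^d`. -/
def dotR (a q : Fin d → ℝ) : ℝ := ∑ i, a i * q i

/-- jump generating function `φ(a) = Σ_z μ(z) exp(a·z)` (valued in `ℝ≥0∞`). -/
def phiE (μ : (Fin d → ℤ) → ℝ) (a : Fin d → ℝ) : ENNReal :=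
  ∑' z : Fin d → ℤ, ENNReal.ofReal (μ z * Real.exp (dotZ a z))

/-- `D = {a ∈ ℝ^d : φ(a) ≤ 1}`. -/
def Dset (μ : (Fin d → ℤ) → ℝ) : Set (Fin d → ℝ) := {a | phiE μ a ≤ 1}

/-- mean vector `M = Σ_z μ(z) z`. -/
def Mvec (μ : (Fin d → ℤ) → ℝ) : Fin d → ℝ := fun i => ∑' z : Fin d → ℤ, μ z * (z i : ℝ)

/-- `Λ(M) = {i : Mⁱ = 0}`. -/
def LambdaM (μ : (Fin d → ℤ) → ℝ) : Set (Fin d) := {i | Mvec μ i = 0}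

/-- Assumption (A1) : irreducibility on every `ℤ^{Λ,d}_+`. -/
def A1 (μ : (Fin d → ℤ) → ℝ) : Prop := ∀ Λ : Set (Fin d), Irred μ (posDom Λ)

/-- Assumption (A2) : `φ` is finite on a neighborhood of the set `D`. -/
def A2 (μ : (Fin d → ℤ) → ℝ) : Prop :=
  ∃ U : Set (Fin d → ℝ), IsOpen U ∧ Dset μ ⊆ U ∧ ∀ a ∈ U, phiE μ a ≠ ⊤

/-- Assumption (A3) : `M ≠ 0`. -/
def A3 (μ : (Fin d → ℤ) → ℝ) : Prop := Mvec μ ≠ 0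

/-- projection `x ↦ x^Λ`. -/
def projL (Λ : Set (Fin d)) (x : Fin d → ℤ) : ↥Λ → ℤ := fun i => x (i : Fin d)

/-- jump distribution `μ_Λ(v) = Σ_{x : x^Λ = v} μ(x)` of the projected walk. -/
def muL (μ : (Fin d → ℤ) → ℝ) (Λ : Set (Fin d)) (v : ↥Λ → ℤ) : ℝ :=
  ∑' x : Fin d → ℤ, if projL Λ x = v then μ x else 0

/-- `ℤ^Λ_+`. -/
def posL (Λ : Set (Fin d)) : Set (↥Λ → ℤ) := {u | ∀ i, 0 < u i}

end

/-- `h_q(x) = xⁱ exp(a(q)·x) − E_x(Sⁱ(τ) exp(a(q)·S(τ)); τ < ∞)`. -/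
noncomputable def hq5 {d : ℕ} (μ : (Fin d → ℤ) → ℝ) (aq : Fin d → ℝ) (i₀ : Fin d)
    (x : Fin d → ℤ) : ℝ :=
  (x i₀ : ℝ) * Real.exp (dotZ aq x) -
    exitExp μ posAll Set.univ (fun y => (y i₀ : ℝ) * Real.exp (dotZ aq y)) x

open scoped ENNReal


section Operators

variable {V : Type*}

/-- The operator `F ↦ (x ↦ ∑ z, k x z * F z)` attached to a nonnegative kernel. -/
noncomputable def kop (k : V → V → ℝ≥0∞) : Module.End ℝ≥0∞ (V → ℝ≥0∞) where
  toFun F x := ∑' z, k x z * F z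
  map_add' F G := by
    funext x
    simp only [Pi.add_apply, mul_add]
    exact ENNReal.tsum_add
  map_smul' c F := by
    funext x
    simp only [Pi.smul_apply, smul_eq_mul, RingHom.id_apply]
    rw [← ENNReal.tsum_mul_left]
    exact tsum_congr fun z => by ring

theorem kop_apply (k : V → V → ℝ≥0∞) (F : V → ℝ≥0∞) (x : V) :
    kop k F x = ∑' z, k x z * F z := rfl

/-- Operators given by a nonnegative kernel. -/
def IsKop (T : Module.End ℝ≥0∞ (V → ℝ≥0∞)) : Prop := ∃ k, T = kop k

theorem isKop_kop (k : V → V → ℝ≥0∞) : IsKop (kop k) := ⟨k, rfl⟩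

theorem IsKop.mul {S T : Module.End ℝ≥0∞ (V → ℝ≥0∞)} (hS : IsKop S) (hT : IsKop T) :
    IsKop (S * T) := by
  obtain ⟨k, rfl⟩ := hS
  obtain ⟨l, rfl⟩ := hT
  refine ⟨fun x z => ∑' y, k x y * l y z, ?_⟩
  refine LinearMap.ext fun F => funext fun x => ?_
  simp only [Module.End.mul_apply, kop_apply, ← ENNReal.tsum_mul_left, ← ENNReal.tsum_mul_right]
  rw [ENNReal.tsum_comm]
  exact tsum_congr fun _ => tsum_congr fun _ => by ring

theorem IsKop.one : IsKop (1 : Module.End ℝ≥0∞ (V → ℝ≥0∞)) := by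
  refine ⟨fun x z => if z = x then 1 else 0, ?_⟩
  refine LinearMap.ext fun F => funext fun x => ?_
  simp [kop_apply]

theorem IsKop.pow {T : Module.End ℝ≥0∞ (V → ℝ≥0∞)} (hT : IsKop T) (n : ℕ) : IsKop (T ^ n) := by
  induction n with
  | zero => simpa using IsKop.one
  | succ n ih => rw [pow_succ]; exact ih.mul hT

theorem IsKop.add {S T : Module.End ℝ≥0∞ (V → ℝ≥0∞)} (hS : IsKop S) (hT : IsKop T) :
    IsKop (S + T) := by
  obtain ⟨k, rfl⟩ := hS
  obtain ⟨l, rfl⟩ := hT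
  refine ⟨fun x z => k x z + l x z, ?_⟩
  refine LinearMap.ext fun F => funext fun x => ?_
  simp only [LinearMap.add_apply, Pi.add_apply, kop_apply, add_mul]
  exact ENNReal.tsum_add.symm

theorem IsKop.smul {T : Module.End ℝ≥0∞ (V → ℝ≥0∞)} (hT : IsKop T) (c : ℝ≥0∞) :
    IsKop (c • T) := by
  obtain ⟨k, rfl⟩ := hT
  refine ⟨fun x z => c * k x z, ?_⟩
  refine LinearMap.ext fun F => funext fun x => ?_
  simp only [LinearMap.smul_apply, Pi.smul_apply, kop_apply, smul_eq_mul, ← ENNReal.tsum_mul_left]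
  exact tsum_congr fun _ => by ring

theorem IsKop.mono {T : Module.End ℝ≥0∞ (V → ℝ≥0∞)} (hT : IsKop T) {F G : V → ℝ≥0∞}
    (h : F ≤ G) : T F ≤ T G := by
  obtain ⟨k, rfl⟩ := hT
  intro x
  exact ENNReal.tsum_le_tsum fun z => by gcongr; exact h z

theorem IsKop.tsum {ι : Type*} {T : Module.End ℝ≥0∞ (V → ℝ≥0∞)} (hT : IsKop T)
    (F : ι → V → ℝ≥0∞) (x : V) : T (fun z => ∑' i, F i z) x = ∑' i, T (F i) x := by
  obtain ⟨k, rfl⟩ := hT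
  simp only [kop_apply, ← ENNReal.tsum_mul_left]
  exact ENNReal.tsum_comm

/-- The potential `∑ n, T ^ n f`. -/
noncomputable def pot (T : Module.End ℝ≥0∞ (V → ℝ≥0∞)) (f : V → ℝ≥0∞) (x : V) : ℝ≥0∞ :=
  ∑' n, (T ^ n) f x

theorem pow_succ_apply' (T : Module.End ℝ≥0∞ (V → ℝ≥0∞)) (n : ℕ) (f : V → ℝ≥0∞) :
    (T ^ (n + 1)) f = T ((T ^ n) f) := by
  rw [pow_succ', Module.End.mul_apply]

theorem pow_succ_apply (T : Module.End ℝ≥0∞ (V → ℝ≥0∞)) (n : ℕ) (f : V → ℝ≥0∞) :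
    (T ^ (n + 1)) f = (T ^ n) (T f) := by
  rw [pow_succ, Module.End.mul_apply]

theorem IsKop.pot_eq {T : Module.End ℝ≥0∞ (V → ℝ≥0∞)} (hT : IsKop T) (f : V → ℝ≥0∞) :
    pot T f = f + T (pot T f) := by
  funext x
  have h : T (pot T f) x = ∑' n, T ((T ^ n) f) x := hT.tsum (fun n => (T ^ n) f) x
  rw [Pi.add_apply, h]
  unfold pot
  rw [tsum_eq_zero_add' ENNReal.summable]
  simp [pow_succ_apply']

theorem IsKop.pot_mono {T : Module.End ℝ≥0∞ (V → ℝ≥0∞)} (hT : IsKop T) {f g : V → ℝ≥0∞}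
    (h : f ≤ g) : pot T f ≤ pot T g := fun x =>
  ENNReal.tsum_le_tsum fun n => (hT.pow n).mono h x

theorem pot_smul (T : Module.End ℝ≥0∞ (V → ℝ≥0∞)) (c : ℝ≥0∞) (f : V → ℝ≥0∞) :
    pot T (c • f) = c • pot T f := by
  funext x
  simp [pot, ENNReal.tsum_mul_left]

theorem pot_add (T : Module.End ℝ≥0∞ (V → ℝ≥0∞)) (f g : V → ℝ≥0∞) :
    pot T (f + g) = pot T f + pot T g := by
  funext x
  simp [pot, ENNReal.tsum_add]

theorem IsKop.sum_pow_le {T : Module.End ℝ≥0∞ (V → ℝ≥0∞)} (hT : IsKop T) {f E : V → ℝ≥0∞}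
    (h : T E + f ≤ E) (n : ℕ) : ∑ i ∈ Finset.range n, (T ^ i) f ≤ E := by
  induction n with
  | zero => simp
  | succ n ih =>
    rw [Finset.sum_range_succ']
    have : ∑ i ∈ Finset.range n, (T ^ (i + 1)) f = T (∑ i ∈ Finset.range n, (T ^ i) f) := by
      rw [map_sum]
      exact Finset.sum_congr rfl fun i _ => pow_succ_apply' T i f
    rw [this]
    refine le_trans ?_ h
    exact add_le_add (hT.mono ih) (by simp)

theorem IsKop.pot_le {T : Module.End ℝ≥0∞ (V → ℝ≥0∞)} (hT : IsKop T) {f E : V → ℝ≥0∞}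
    (h : T E + f ≤ E) : pot T f ≤ E := by
  intro x
  unfold pot
  rw [ENNReal.tsum_eq_iSup_nat]
  refine iSup_le fun n => ?_
  have := hT.sum_pow_le h n x
  simpa using this

end Operators

section Expectation

variable {V : Type*}

/-- Expectation of `F` under the step distribution. -/
noncomputable def Ex (μ : V → ℝ) (F : V → ℝ≥0∞) : ℝ≥0∞ := ∑' u, ENNReal.ofReal (μ u) * F u

theorem Ex_mono {μ : V → ℝ} {F G : V → ℝ≥0∞} (h : ∀ u, F u ≤ G u) : Ex μ F ≤ Ex μ G :=
  ENNReal.tsum_le_tsum fun u => by gcongr; exact h u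

theorem Ex_add (μ : V → ℝ) (F G : V → ℝ≥0∞) :
    Ex μ (fun u => F u + G u) = Ex μ F + Ex μ G := by
  simp only [Ex, mul_add, ENNReal.tsum_add]

theorem Ex_const_mul (μ : V → ℝ) (c : ℝ≥0∞) (F : V → ℝ≥0∞) :
    Ex μ (fun u => c * F u) = c * Ex μ F := by
  simp only [Ex, ← ENNReal.tsum_mul_left]
  exact tsum_congr fun _ => by ring

theorem Ex_sum {ι : Type*} (μ : V → ℝ) (s : Finset ι) (F : ι → V → ℝ≥0∞) :
    Ex μ (fun u => ∑ i ∈ s, F i u) = ∑ i ∈ s, Ex μ (F i) := by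
  induction s using Finset.induction_on with
  | empty => simp [Ex]
  | insert a s ha ih => simp only [Finset.sum_insert ha, Ex_add, ih]

theorem Ex_one {μ : V → ℝ} (hnn : ∀ z, 0 ≤ μ z) (hsum : HasSum μ 1) : Ex μ (fun _ => 1) = 1 := by
  simp only [Ex, mul_one]
  rw [← ENNReal.ofReal_tsum_of_nonneg hnn hsum.summable, hsum.tsum_eq, ENNReal.ofReal_one]

theorem Ex_ofReal {μ : V → ℝ} (hnn : ∀ z, 0 ≤ μ z) {f : V → ℝ} (hf : ∀ z, 0 ≤ f z)
    (hs : Summable fun z => μ z * f z) :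
    Ex μ (fun u => ENNReal.ofReal (f u)) = ENNReal.ofReal (∑' z, μ z * f z) := by
  rw [ENNReal.ofReal_tsum_of_nonneg (fun z => mul_nonneg (hnn z) (hf z)) hs]
  exact tsum_congr fun z => (ENNReal.ofReal_mul (hnn z)).symm

/-- The indicator of a point. -/
noncomputable def dl (y : V) : V → ℝ≥0∞ := fun x => if x = y then 1 else 0

theorem dl_le_one (y : V) : dl y ≤ fun _ => 1 := fun x => by
  unfold dl; split_ifs <;> simp

/-- A kernel operator evaluated through its values on indicators of points. -/
theorem IsKop.apply_eq {T : Module.End ℝ≥0∞ (V → ℝ≥0∞)} (hT : IsKop T) (F : V → ℝ≥0∞) (x : V) :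
    T F x = ∑' y, T (dl y) x * F y := by
  obtain ⟨k, rfl⟩ := hT
  have h : ∀ y, kop k (dl y) x = k x y := by
    intro y
    simp [kop_apply, dl]
  simp only [h]
  rfl

theorem IsKop.pot_apply_eq {T : Module.End ℝ≥0∞ (V → ℝ≥0∞)} (hT : IsKop T) (F : V → ℝ≥0∞) (x : V) :
    pot T F x = ∑' y, pot T (dl y) x * F y := by
  simp only [pot, ← ENNReal.tsum_mul_right]
  rw [ENNReal.tsum_comm]
  exact tsum_congr fun n => (hT.pow n).apply_eq F x

end Expectation

section Killed

variable {V : Type*} [AddCommGroup V]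

/-- One step of the walk with step distribution `μ` killed outside `A`, as an operator. -/
noncomputable def PA (μ : V → ℝ) (A : Set V) : Module.End ℝ≥0∞ (V → ℝ≥0∞) :=
  kop fun x z => if x ∈ A ∧ z ∈ A then ENNReal.ofReal (μ (z - x)) else 0

theorem isKop_PA (μ : V → ℝ) (A : Set V) : IsKop (PA μ A) := isKop_kop _

theorem PA_apply_of_notMem {μ : V → ℝ} {A : Set V} {x : V} (hx : x ∉ A) (F : V → ℝ≥0∞) :
    PA μ A F x = 0 := by
  simp [PA, kop_apply, hx]

theorem PA_apply {μ : V → ℝ} {A : Set V} {x : V} (hx : x ∈ A) (F : V → ℝ≥0∞) :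
    PA μ A F x = Ex μ (fun u => if x + u ∈ A then F (x + u) else 0) := by
  rw [PA, kop_apply, Ex, ← (Equiv.addLeft x).tsum_eq]
  refine tsum_congr fun u => ?_
  by_cases h : x + u ∈ A <;> simp [h, hx]

theorem PA_le_Ex {μ : V → ℝ} {A : Set V} (x : V) (F : V → ℝ≥0∞) :
    PA μ A F x ≤ Ex μ (fun u => F (x + u)) := by
  by_cases hx : x ∈ A
  · rw [PA_apply hx]
    exact Ex_mono fun u => by split_ifs <;> simp
  · simp [PA_apply_of_notMem hx]

theorem PA_congr {μ : V → ℝ} {A : Set V} {F G : V → ℝ≥0∞} (h : ∀ x ∈ A, F x = G x) :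
    PA μ A F = PA μ A G := by
  funext x
  simp only [PA, kop_apply]
  refine tsum_congr fun z => ?_
  by_cases hz : z ∈ A
  · rw [h z hz]
  · simp [hz]

theorem PA_mono {μ : V → ℝ} {A : Set V} {F G : V → ℝ≥0∞} (h : ∀ x ∈ A, F x ≤ G x) :
    PA μ A F ≤ PA μ A G := by
  intro x
  simp only [PA, kop_apply]
  refine ENNReal.tsum_le_tsum fun z => ?_
  by_cases hz : z ∈ A
  · gcongr; exact h z hz
  · simp [hz]

theorem PA_pow_mono {μ : V → ℝ} {A : Set V} {F G : V → ℝ≥0∞} (h : ∀ x ∈ A, F x ≤ G x) (n : ℕ) :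
    ∀ x ∈ A, (PA μ A ^ n) F x ≤ (PA μ A ^ n) G x := by
  cases n with
  | zero => simpa using h
  | succ n =>
    intro x _
    rw [pow_succ_apply, pow_succ_apply]
    exact ((isKop_PA μ A).pow n).mono (PA_mono h) x

theorem PA_pow_congr {μ : V → ℝ} {A : Set V} {F G : V → ℝ≥0∞} (h : ∀ x ∈ A, F x = G x) (n : ℕ) :
    ∀ x ∈ A, (PA μ A ^ n) F x = (PA μ A ^ n) G x := fun x hx =>
  le_antisymm (PA_pow_mono (fun y hy => (h y hy).le) n x hx)
    (PA_pow_mono (fun y hy => (h y hy).ge) n x hx)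

theorem pot_PA_mono {μ : V → ℝ} {A : Set V} {f g : V → ℝ≥0∞} (h : ∀ x ∈ A, f x ≤ g x) :
    ∀ x ∈ A, pot (PA μ A) f x ≤ pot (PA μ A) g x := fun x hx =>
  ENNReal.tsum_le_tsum fun n => PA_pow_mono h n x hx

theorem PA_pow_mono_set {μ : V → ℝ} {A B : Set V} (hAB : A ⊆ B) (F : V → ℝ≥0∞) (n : ℕ) (x : V) :
    (PA μ A ^ n) F x ≤ (PA μ B ^ n) F x := by
  induction n generalizing x with
  | zero => simp
  | succ n ih =>
    rw [pow_succ_apply', pow_succ_apply']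
    refine le_trans ((isKop_PA μ A).mono ih x) ?_
    simp only [PA, kop_apply]
    refine ENNReal.tsum_le_tsum fun z => ?_
    gcongr
    split_ifs with h1 h2
    · exact le_rfl
    · exact absurd ⟨hAB h1.1, hAB h1.2⟩ h2
    · simp
    · exact le_rfl

/-- Domination principle for potentials of the killed walk. -/
theorem pot_PA_le {μ : V → ℝ} {A : Set V} {f E : V → ℝ≥0∞}
    (h : ∀ x ∈ A, PA μ A E x + f x ≤ E x) : ∀ x ∈ A, pot (PA μ A) f x ≤ E x := by
  intro x hx
  have key : pot (PA μ A) f ≤ fun y => if y ∈ A then E y else ⊤ := by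
    refine (isKop_PA μ A).pot_le fun y => ?_
    by_cases hy : y ∈ A
    · have : PA μ A (fun y => if y ∈ A then E y else ⊤) = PA μ A E :=
        PA_congr fun z hz => by simp [hz]
      simpa [this, hy] using h y hy
    · simp [hy]
  simpa [hx] using key x

/-- Unrolling `F = P F + f` on the domain `A`. -/
theorem eq_PA_pow_add_sum {μ : V → ℝ} {A : Set V} {f F : V → ℝ≥0∞}
    (h : ∀ x ∈ A, F x = PA μ A F x + f x) (n : ℕ) :
    ∀ x ∈ A, F x = (PA μ A ^ n) F x + ∑ i ∈ Finset.range n, (PA μ A ^ i) f x := by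
  induction n with
  | zero => simp
  | succ n ih =>
    intro x hx
    have h1 : (PA μ A ^ n) F x = (PA μ A ^ n) (PA μ A F + f) x :=
      PA_pow_congr (fun y hy => by simpa using h y hy) n x hx
    conv_lhs => rw [ih x hx, h1]
    rw [map_add, ← pow_succ_apply, Finset.sum_range_succ, Pi.add_apply]
    ring

theorem PA_pow_le_of_le {μ : V → ℝ} {A : Set V} {F : V → ℝ≥0∞}
    (h : ∀ x ∈ A, PA μ A F x ≤ F x) (n : ℕ) : ∀ x ∈ A, (PA μ A ^ n) F x ≤ F x := by
  induction n with
  | zero => simp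
  | succ n ih =>
    intro x hx
    rw [pow_succ_apply]
    exact (PA_pow_mono h n x hx).trans (ih x hx)

theorem pot_PA_le_self {μ : V → ℝ} {A : Set V} (f : V → ℝ≥0∞) (x : V) :
    PA μ A (pot (PA μ A) f) x ≤ pot (PA μ A) f x := by
  conv_rhs => rw [(isKop_PA μ A).pot_eq]
  simp

theorem PA_pow_one_le {μ : V → ℝ} {A : Set V} (hnn : ∀ z, 0 ≤ μ z) (hsum : HasSum μ 1) (n : ℕ)
    (x : V) : (PA μ A ^ n) (fun _ => 1) x ≤ 1 := by
  induction n generalizing x with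
  | zero => simp
  | succ n ih =>
    rw [pow_succ_apply']
    refine ((isKop_PA μ A).mono (G := fun _ => 1) ih x).trans ((PA_le_Ex x _).trans ?_)
    rw [Ex_one hnn hsum]

theorem PA_pow_dl_le_one {μ : V → ℝ} {A : Set V} (hnn : ∀ z, 0 ≤ μ z) (hsum : HasSum μ 1) (n : ℕ)
    (x y : V) : (PA μ A ^ n) (dl y) x ≤ 1 :=
  (((isKop_PA μ A).pow n).mono (dl_le_one y) x).trans (PA_pow_one_le hnn hsum n x)

theorem PA_pow_dl_zero_of_notMem {μ : V → ℝ} {A : Set V} {n : ℕ} {x y : V} (hx : x ∈ A)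
    (hy : y ∉ A) : (PA μ A ^ n) (dl y) x = 0 := by
  have h : ∀ z ∈ A, dl y z = (0 : V → ℝ≥0∞) z := fun z hz => by
    have : z ≠ y := fun h => hy (h ▸ hz)
    simp [dl, this]
  rw [PA_pow_congr h n x hx]
  simp

theorem kern_eq {μ : V → ℝ} {A : Set V} (hnn : ∀ z, 0 ≤ μ z) (hsum : HasSum μ 1) (n : ℕ)
    {x : V} (hx : x ∈ A) (y : V) : kern μ A n x y = ((PA μ A ^ n) (dl y) x).toReal := by
  have h0 : ∀ n, ∀ x ∉ A, kern μ A n x y = 0 := by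
    intro n x hx
    cases n with
    | zero => simp [kern, hx]
    | succ n => simp [kern, hx]
  induction n generalizing x with
  | zero =>
    by_cases h : x = y
    · subst h; simp [kern, dl, hx]
    · simp [kern, dl, h]
  | succ n ih =>
    rw [pow_succ_apply', PA, kop_apply, ENNReal.tsum_toReal_eq]
    · rw [kern]
      refine tsum_congr fun z => ?_
      by_cases hz : z ∈ A
      · rw [ih hz]
        simp [hx, hz, ENNReal.toReal_ofReal (hnn _), PA]
      · simp [h0 n z hz, hz]
    · intro z
      refine ENNReal.mul_ne_top (by split_ifs <;> simp) ?_
      exact ne_top_of_le_ne_top ENNReal.one_ne_top (PA_pow_dl_le_one hnn hsum n z y)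

theorem green_eq {μ : V → ℝ} {A : Set V} (hnn : ∀ z, 0 ≤ μ z) (hsum : HasSum μ 1)
    {x : V} (hx : x ∈ A) (y : V) : green μ A x y = (pot (PA μ A) (dl y) x).toReal := by
  unfold green pot
  rw [ENNReal.tsum_toReal_eq]
  · exact tsum_congr fun n => kern_eq hnn hsum n hx y
  · intro n
    exact ne_top_of_le_ne_top ENNReal.one_ne_top (PA_pow_dl_le_one hnn hsum n x y)

end Killed

section Moments

variable {d : ℕ}

theorem znorm_nonneg {ι : Type*} [Fintype ι] (x : ι → ℤ) : 0 ≤ znorm x :=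
  Finset.sum_nonneg fun _ _ => abs_nonneg _

theorem abs_apply_le_znorm {ι : Type*} [Fintype ι] (x : ι → ℤ) (i : ι) : |(x i : ℝ)| ≤ znorm x :=
  Finset.single_le_sum (f := fun i => |(x i : ℝ)|) (fun _ _ => abs_nonneg _) (Finset.mem_univ i)

theorem znorm_add_le {ι : Type*} [Fintype ι] (x y : ι → ℤ) : znorm (x + y) ≤ znorm x + znorm y := by
  unfold znorm
  rw [← Finset.sum_add_distrib]
  refine Finset.sum_le_sum fun i _ => ?_
  simpa using abs_add_le (x i : ℝ) (y i)

theorem znorm_neg {ι : Type*} [Fintype ι] (x : ι → ℤ) : znorm (-x) = znorm x := by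
  simp [znorm]

theorem znorm_sub_comm {ι : Type*} [Fintype ι] (x y : ι → ℤ) : znorm (x - y) = znorm (y - x) := by
  rw [← znorm_neg, neg_sub]

theorem znorm_sub_le {ι : Type*} [Fintype ι] (x y : ι → ℤ) : znorm (x - y) ≤ znorm x + znorm y := by
  rw [sub_eq_add_neg, ← znorm_neg y]; exact znorm_add_le x (-y)

theorem znorm_le_add_sub {ι : Type*} [Fintype ι] (x y : ι → ℤ) :
    znorm x ≤ znorm y + znorm (x - y) := by
  simpa using znorm_add_le y (x - y)

/-- Standing assumptions on a step distribution with one centered coordinate `i₀` and positive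
drift in all the others. -/
structure Hyp (μ : (Fin d → ℤ) → ℝ) (θ : ℝ) (m : Fin d → ℝ) (i₀ : Fin d) : Prop where
  nn : ∀ z, 0 ≤ μ z
  sum : HasSum μ 1
  θpos : 0 < θ
  mom : Summable fun z => μ z * Real.exp (θ * znorm z)
  mean : ∀ j, HasSum (fun z : Fin d → ℤ => μ z * (z j : ℝ)) (m j)
  m0 : m i₀ = 0
  mpos : ∀ j, j ≠ i₀ → 0 < m j
  ex : ∃ j, j ≠ i₀
  irrH : Irred μ (posDom {i₀})
  irrA : Irred μ posAll

/-- The moment bounding all error terms. -/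
noncomputable def momK (μ : (Fin d → ℤ) → ℝ) (θ : ℝ) : ℝ :=
  (8 / θ ^ 2 + 2 / θ) * ∑' z, μ z * Real.exp (θ * znorm z)

variable {μ : (Fin d → ℤ) → ℝ} {θ : ℝ} {m : Fin d → ℝ} {i₀ : Fin d}

theorem Hyp.one_le_mom (h : Hyp μ θ m i₀) : 1 ≤ ∑' z, μ z * Real.exp (θ * znorm z) := by
  rw [← h.sum.tsum_eq]
  refine h.sum.summable.tsum_le_tsum (fun z => ?_) h.mom
  have := Real.one_le_exp (mul_nonneg h.θpos.le (znorm_nonneg z))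
  exact le_mul_of_one_le_right (h.nn z) this

theorem Hyp.momK_pos (h : Hyp μ θ m i₀) : 0 < momK μ θ := by
  have := h.one_le_mom
  have := h.θpos
  unfold momK
  positivity

theorem Hyp.summable_of_le (h : Hyp μ θ m i₀) {f : (Fin d → ℤ) → ℝ} (C : ℝ)
    (hf : ∀ z, |f z| ≤ C * Real.exp (θ * znorm z)) : Summable fun z => μ z * f z := by
  refine Summable.of_norm_bounded (h.mom.mul_left C) fun z => ?_
  rw [Real.norm_eq_abs, abs_mul, abs_of_nonneg (h.nn z)]
  calc μ z * |f z| ≤ μ z * (C * Real.exp (θ * znorm z)) := by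
        gcongr
        · exact h.nn z
        · exact hf z
    _ = _ := by ring

theorem exp_le_quad (t : ℝ) : Real.exp t ≤ 1 + t + t ^ 2 * Real.exp |t| := by
  have h1 : Real.exp t ≤ 1 + t * Real.exp t := by
    have := Real.add_one_le_exp (-t)
    rw [Real.exp_neg] at this
    have h3 := mul_le_mul_of_nonneg_left this (Real.exp_pos t).le
    rw [mul_inv_cancel₀ (Real.exp_pos t).ne'] at h3
    linarith
  have h2 := Real.add_one_le_exp t
  rcases le_total 0 t with h | h
  · rw [abs_of_nonneg h]
    nlinarith
  · have h3 : 1 ≤ Real.exp |t| := Real.one_le_exp (abs_nonneg t)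
    nlinarith [mul_le_mul_of_nonneg_left h3 (sq_nonneg t)]

theorem exp_tilt_le {θ u t s δ ξ : ℝ} (hθ : 0 < θ) (hu : 0 ≤ u) (hξ : |ξ| ≤ u) (ht : t = s * ξ)
    (hs : |s| ≤ θ / 4) (hδ : 0 ≤ δ) (hδ' : δ ≤ θ / 4) :
    Real.exp (t + δ * u) ≤
      1 + t + (8 / θ ^ 2 + 2 / θ) * (s ^ 2 + δ) * Real.exp (θ * u) := by
  have htu : |t| ≤ θ / 4 * u := by
    rw [ht, abs_mul]
    gcongr
  have h1 := exp_le_quad t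
  have h2 : Real.exp (δ * u) ≤ 1 + δ * u * Real.exp (δ * u) := by
    have := Real.add_one_le_exp (-(δ * u))
    rw [Real.exp_neg] at this
    have hp := Real.exp_pos (δ * u)
    have h3 := mul_le_mul_of_nonneg_left this hp.le
    rw [mul_inv_cancel₀ hp.ne'] at h3
    linarith
  have h3 : Real.exp t ≤ Real.exp (θ / 4 * u) := Real.exp_le_exp.2 ((le_abs_self t).trans htu)
  have h4 : Real.exp (δ * u) ≤ Real.exp (θ / 4 * u) := Real.exp_le_exp.2 (by gcongr)
  have e2 : Real.exp (θ / 4 * u) * Real.exp (θ / 4 * u) = Real.exp (θ / 2 * u) := by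
    rw [← Real.exp_add]; ring_nf
  have e1 : Real.exp (θ / 2 * u) * Real.exp (θ / 2 * u) = Real.exp (θ * u) := by
    rw [← Real.exp_add]; ring_nf
  have hv : 0 ≤ θ / 2 * u := by positivity
  have q1 : θ / 2 * u ≤ Real.exp (θ / 2 * u) := by
    have := Real.add_one_le_exp (θ / 2 * u); linarith
  have q2 : (θ / 2 * u) ^ 2 / 2 ≤ Real.exp (θ / 2 * u) := by
    have := Real.quadratic_le_exp_of_nonneg hv; linarith
  -- first error term
  have a1 : δ * u * Real.exp (δ * u) * Real.exp t ≤ 2 / θ * δ * Real.exp (θ * u) := by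
    calc δ * u * Real.exp (δ * u) * Real.exp t
        ≤ δ * u * Real.exp (θ / 4 * u) * Real.exp (θ / 4 * u) := by gcongr
      _ = 2 / θ * δ * ((θ / 2 * u) * Real.exp (θ / 2 * u)) := by
          rw [mul_assoc, e2]; field_simp
      _ ≤ 2 / θ * δ * (Real.exp (θ / 2 * u) * Real.exp (θ / 2 * u)) := by gcongr
      _ = _ := by rw [e1]
  have a2 : t ^ 2 * Real.exp |t| ≤ 8 / θ ^ 2 * s ^ 2 * Real.exp (θ * u) := by
    have ht2 : t ^ 2 ≤ s ^ 2 * u ^ 2 := by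
      rw [ht, mul_pow]
      exact mul_le_mul_of_nonneg_left
        (sq_le_sq' (by linarith [neg_abs_le ξ]) ((le_abs_self ξ).trans hξ)) (sq_nonneg s)
    have : Real.exp |t| ≤ Real.exp (θ / 2 * u) :=
      Real.exp_le_exp.2 (htu.trans (by gcongr; linarith))
    calc t ^ 2 * Real.exp |t| ≤ (s ^ 2 * u ^ 2) * Real.exp (θ / 2 * u) := by gcongr
      _ = 8 / θ ^ 2 * s ^ 2 * (((θ / 2 * u) ^ 2 / 2) * Real.exp (θ / 2 * u)) := by
          field_simp; ring
      _ ≤ 8 / θ ^ 2 * s ^ 2 * (Real.exp (θ / 2 * u) * Real.exp (θ / 2 * u)) := by gcongr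
      _ = _ := by rw [e1]
  have h5 : Real.exp (t + δ * u) ≤ Real.exp t + δ * u * Real.exp (δ * u) * Real.exp t := by
    rw [Real.exp_add]
    have := mul_le_mul_of_nonneg_left h2 (Real.exp_pos t).le
    linarith
  have b1 : 0 ≤ 8 / θ ^ 2 * δ * Real.exp (θ * u) := by positivity
  have b2 : 0 ≤ 2 / θ * s ^ 2 * Real.exp (θ * u) := by positivity
  nlinarith

theorem Hyp.summable_tilt (h : Hyp μ θ m i₀) {ξ : (Fin d → ℤ) → ℝ} (hξ : ∀ z, |ξ z| ≤ znorm z)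
    {s δ : ℝ} (hs : |s| ≤ θ / 4) (hδ' : δ ≤ θ / 4) :
    Summable fun z => μ z * Real.exp (s * ξ z + δ * znorm z) := by
  refine h.summable_of_le 1 fun z => ?_
  rw [abs_of_pos (Real.exp_pos _), one_mul, Real.exp_le_exp]
  have hz := znorm_nonneg z
  have : s * ξ z ≤ θ / 4 * znorm z := by
    refine (le_abs_self _).trans ?_
    rw [abs_mul]
    exact mul_le_mul hs (hξ z) (abs_nonneg _) (by linarith [h.θpos])
  have : δ * znorm z ≤ θ / 4 * znorm z := by gcongr
  nlinarith [h.θpos]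

theorem Hyp.tsum_tilt_le (h : Hyp μ θ m i₀) {ξ : (Fin d → ℤ) → ℝ} {mξ : ℝ}
    (hξ : ∀ z, |ξ z| ≤ znorm z) (hm : HasSum (fun z => μ z * ξ z) mξ)
    {s δ : ℝ} (hs : |s| ≤ θ / 4) (hδ : 0 ≤ δ) (hδ' : δ ≤ θ / 4) :
    ∑' z, μ z * Real.exp (s * ξ z + δ * znorm z) ≤ 1 + s * mξ + momK μ θ * (s ^ 2 + δ) := by
  have h1 : HasSum (fun z => μ z + s * (μ z * ξ z) +
      ((8 / θ ^ 2 + 2 / θ) * (s ^ 2 + δ)) * (μ z * Real.exp (θ * znorm z)))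
      (1 + s * mξ + ((8 / θ ^ 2 + 2 / θ) * (s ^ 2 + δ)) * ∑' z, μ z * Real.exp (θ * znorm z)) :=
    (h.sum.add (hm.mul_left s)).add (h.mom.hasSum.mul_left _)
  have h2 : (1 + s * mξ + ((8 / θ ^ 2 + 2 / θ) * (s ^ 2 + δ)) *
      ∑' z, μ z * Real.exp (θ * znorm z)) = 1 + s * mξ + momK μ θ * (s ^ 2 + δ) := by
    unfold momK; ring
  rw [← h2, ← h1.tsum_eq]
  refine (h.summable_tilt hξ hs hδ').tsum_le_tsum (fun z => ?_) h1.summable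
  have := exp_tilt_le (s := s) h.θpos (znorm_nonneg z) (hξ z) rfl hs hδ hδ'
  have := mul_le_mul_of_nonneg_left this (h.nn z)
  linarith

theorem Hyp.Ex_tilt_le (h : Hyp μ θ m i₀) {ξ : (Fin d → ℤ) → ℝ} {mξ : ℝ}
    (hξ : ∀ z, |ξ z| ≤ znorm z) (hm : HasSum (fun z => μ z * ξ z) mξ)
    {s δ : ℝ} (hs : |s| ≤ θ / 4) (hδ : 0 ≤ δ) (hδ' : δ ≤ θ / 4) :
    Ex μ (fun z => ENNReal.ofReal (Real.exp (s * ξ z + δ * znorm z))) ≤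
      ENNReal.ofReal (1 + s * mξ + momK μ θ * (s ^ 2 + δ)) := by
  rw [Ex_ofReal h.nn (fun z => (Real.exp_pos _).le) (h.summable_tilt hξ hs hδ')]
  exact ENNReal.ofReal_le_ofReal (h.tsum_tilt_le hξ hm hs hδ hδ')

theorem Hyp.Ex_znorm_le (h : Hyp μ θ m i₀) {δ : ℝ} (hδ : 0 ≤ δ) (hδ' : δ ≤ θ / 4) :
    Ex μ (fun z => ENNReal.ofReal (Real.exp (δ * znorm z))) ≤
      ENNReal.ofReal (1 + momK μ θ * δ) := by
  have := h.Ex_tilt_le (ξ := fun _ => 0) (mξ := 0) (s := 0) (δ := δ)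
    (fun z => by simpa using znorm_nonneg z) (by simp)
    (by simpa using (by linarith [h.θpos] : 0 ≤ θ / 4)) hδ hδ'
  simpa using this

end Moments

section Harnack

variable {d : ℕ} {μ : (Fin d → ℤ) → ℝ} {θ : ℝ} {m : Fin d → ℝ} {i₀ : Fin d}

theorem mem_posDom_singleton {x : Fin d → ℤ} : x ∈ posDom {i₀} ↔ 0 < x i₀ := by
  simp [posDom]

theorem posAll_subset : (posAll : Set (Fin d → ℤ)) ⊆ posDom {i₀} := fun _ hx =>
  mem_posDom_singleton.2 (hx i₀)

theorem PA_single_le {V : Type*} [AddCommGroup V] {μ : V → ℝ} {A : Set V} {F : V → ℝ≥0∞} {x z : V}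
    (hx : x ∈ A) (hz : z ∈ A) : ENNReal.ofReal (μ (z - x)) * F z ≤ PA μ A F x := by
  rw [PA, kop_apply]
  refine le_trans ?_ (ENNReal.le_tsum z)
  simp [hx, hz]

/-- Comparison of a superharmonic function at two points joined by a path, uniformly over all
shifts that keep the path inside the domain. -/
theorem path_le {V : Type*} [AddCommGroup V] {μ : V → ℝ} {A : Set V} {c : ℕ → V} {k : ℕ}
    (hc : ∀ j < k, 0 < μ (c (j + 1) - c j)) :
    ∃ ε : ℝ, 0 < ε ∧ ∀ F : V → ℝ≥0∞, (∀ x ∈ A, PA μ A F x ≤ F x) → ∀ w : V,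
      (∀ j ≤ k, c j + w ∈ A) → ENNReal.ofReal ε * F (c k + w) ≤ F (c 0 + w) := by
  induction k with
  | zero => exact ⟨1, one_pos, fun F _ w _ => by simp⟩
  | succ k ih =>
    obtain ⟨ε, hε, h⟩ := ih fun j hj => hc j (by omega)
    refine ⟨ε * μ (c (k + 1) - c k), mul_pos hε (hc k (by omega)), fun F hF w hw => ?_⟩
    refine le_trans ?_ (h F hF w fun j hj => hw j (by omega))
    rw [ENNReal.ofReal_mul hε.le, mul_assoc]
    gcongr
    refine le_trans ?_ (hF _ (hw k (by omega)))
    have := PA_single_le (μ := μ) (F := F) (hw k (by omega)) (hw (k + 1) le_rfl)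
    simpa using this

theorem Hyp.local_harnack (h : Hyp μ θ m i₀) (e : Fin d → ℤ) : ∃ ε : ℝ, 0 < ε ∧
    ∀ F : (Fin d → ℤ) → ℝ≥0∞, (∀ x ∈ posDom {i₀}, PA μ (posDom {i₀}) F x ≤ F x) →
      ∀ x ∈ posDom {i₀}, x + e ∈ posDom {i₀} → ENNReal.ofReal ε * F (x + e) ≤ F x := by
  set b : Fin d → ℤ := fun _ => max 1 (1 - e i₀) with hb
  have hbH : b ∈ posDom {i₀} := by
    rw [mem_posDom_singleton]; simp [hb]
  have hbeH : b + e ∈ posDom {i₀} := by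
    rw [mem_posDom_singleton]; simp only [hb, Pi.add_apply]
    have := le_max_right 1 (1 - e i₀); omega
  obtain ⟨k, c, h0, hk, hcA, hcp⟩ := h.irrH b hbH (b + e) hbeH
  obtain ⟨ε, hε, H⟩ := path_le (A := posDom {i₀}) hcp
  refine ⟨ε, hε, fun F hF x hx hxe => ?_⟩
  rw [mem_posDom_singleton] at hx hxe
  have hw : 0 ≤ (x - b) i₀ := by
    simp only [hb, Pi.sub_apply, Pi.add_apply] at hxe ⊢
    have := max_le (show 1 ≤ x i₀ by omega) (show 1 - e i₀ ≤ x i₀ by omega)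
    omega
  have := H F hF (x - b) fun j hj => by
    have := hcA j hj
    rw [mem_posDom_singleton] at this ⊢
    simp only [Pi.add_apply]
    omega
  rw [h0, hk] at this
  have e1 : b + e + (x - b) = x + e := by abel
  have e2 : b + (x - b) = x := by abel
  rwa [e1, e2] at this

theorem Hyp.harnack (h : Hyp μ θ m i₀) : ∃ c : ℝ, 0 < c ∧
    ∀ F : (Fin d → ℤ) → ℝ≥0∞, (∀ x ∈ posDom {i₀}, PA μ (posDom {i₀}) F x ≤ F x) →
      ∀ x ∈ posDom {i₀}, ∀ z ∈ posDom {i₀},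
        ENNReal.ofReal (Real.exp (-c * znorm (x - z))) * F z ≤ F x := by
  choose ε hε H using h.local_harnack
  -- a common constant for all unit moves
  obtain ⟨η, hη, hη1, hηε⟩ : ∃ η : ℝ, 0 < η ∧ η < 1 ∧
      ∀ (j : Fin d) (b : Bool), η ≤ ε (Pi.single j (if b then 1 else -1)) := by
    have : Nonempty (Fin d) := ⟨i₀⟩
    obtain ⟨p, -, hp⟩ := Finset.exists_min_image (Finset.univ : Finset (Fin d × Bool))
      (fun p => ε (Pi.single p.1 (if p.2 then 1 else -1))) Finset.univ_nonempty
    refine ⟨min (1 / 2) (ε (Pi.single p.1 (if p.2 then 1 else -1))), lt_min (by norm_num) (hε _),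
      (min_le_left _ _).trans_lt (by norm_num), fun j b => ?_⟩
    exact (min_le_right _ _).trans (hp (j, b) (Finset.mem_univ _))
  refine ⟨-Real.log η, by have := Real.log_neg hη hη1; linarith, fun F hF => ?_⟩
  have key : ∀ (n : ℕ) (x z : Fin d → ℤ), x ∈ posDom {i₀} → z ∈ posDom {i₀} →
      ∑ j, (z j - x j).natAbs = n → ENNReal.ofReal (η ^ n) * F z ≤ F x := by
    intro n
    induction n with
    | zero =>
      intro x z _ _ hn
      have : x = z := by
        funext j
        have := (Finset.sum_eq_zero_iff.1 hn) j (Finset.mem_univ j)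
        omega
      simp [this]
    | succ n ih =>
      intro x z hx hz hn
      obtain ⟨j, hj⟩ : ∃ j, z j ≠ x j := by
        by_contra hcon
        push Not at hcon
        simp [hcon] at hn
      obtain ⟨b, hb⟩ : ∃ b : Bool, (z j - (x j + if b then 1 else -1)).natAbs + 1 =
          (z j - x j).natAbs ∧ (0 < x j → 0 < z j → 0 < x j + if b then 1 else -1) := by
        rcases lt_or_gt_of_ne hj with hlt | hlt
        · exact ⟨false, by simp; omega⟩
        · exact ⟨true, by simp; omega⟩
      set e : Fin d → ℤ := Pi.single j (if b then 1 else -1) with he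
      have hej : e j = if b then 1 else -1 := by simp [he]
      have hxe : x + e ∈ posDom {i₀} := by
        rw [mem_posDom_singleton] at hx hz ⊢
        by_cases hji : i₀ = j
        · subst hji
          rw [Pi.add_apply, hej]; exact hb.2 hx hz
        · rw [Pi.add_apply, he, Pi.single_eq_of_ne hji]; simpa using hx
      have hn' : ∑ k, (z k - (x + e) k).natAbs = n := by
        rw [← Finset.add_sum_erase _ _ (Finset.mem_univ j)] at hn ⊢
        have : ∑ k ∈ Finset.univ.erase j, (z k - (x + e) k).natAbs =
            ∑ k ∈ Finset.univ.erase j, (z k - x k).natAbs := by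
          refine Finset.sum_congr rfl fun k hk => ?_
          rw [Pi.add_apply, he, Pi.single_eq_of_ne (Finset.ne_of_mem_erase hk), add_zero]
        rw [this, Pi.add_apply, hej]
        omega
      have h1 := ih (x + e) z hxe hz hn'
      have h2 := H e F hF x hx hxe
      calc ENNReal.ofReal (η ^ (n + 1)) * F z
          = ENNReal.ofReal η * (ENNReal.ofReal (η ^ n) * F z) := by
            rw [pow_succ', ENNReal.ofReal_mul hη.le, mul_assoc]
        _ ≤ ENNReal.ofReal (ε e) * F (x + e) := by
            gcongr
            exact hηε j b
        _ ≤ F x := h2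
  intro x hx z hz
  have := key _ x z hx hz rfl
  refine le_trans (le_of_eq ?_) this
  congr 2
  have hcast : znorm (x - z) = ((∑ j, (z j - x j).natAbs : ℕ) : ℝ) := by
    rw [znorm_sub_comm, znorm]
    push_cast
    refine Finset.sum_congr rfl fun j _ => ?_
    rw [Nat.cast_natAbs]
    simp
  rw [hcast, neg_neg, mul_comm, Real.exp_nat_mul, Real.exp_log hη]

/-- Exponential moment in a coordinate of positive drift. -/
theorem Hyp.Ex_drift (h : Hyp μ θ m i₀) {j : Fin d} {s δ : ℝ} (hs : 0 ≤ s) (hs' : s ≤ θ / 4)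
    (hδ : 0 ≤ δ) (hδ' : δ ≤ θ / 4) :
    Ex μ (fun u => ENNReal.ofReal (Real.exp (-s * (u j : ℝ) + δ * znorm u))) ≤
      ENNReal.ofReal (1 - s * m j + momK μ θ * (s ^ 2 + δ)) := by
  have := h.Ex_tilt_le (ξ := fun u => (u j : ℝ)) (mξ := m j) (s := -s) (δ := δ)
    (fun z => abs_apply_le_znorm z j) (h.mean j) (by rwa [abs_neg, abs_of_nonneg hs]) hδ hδ'
  refine this.trans (ENNReal.ofReal_le_ofReal (le_of_eq (by ring)))

theorem Hyp.green_le (h : Hyp μ θ m i₀) {s : ℝ} (hs : 0 < s) : ∃ C : ℝ, 0 < C ∧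
    ∀ x ∈ posDom {i₀}, ∀ y, pot (PA μ (posDom {i₀})) (dl y) x ≤
      ENNReal.ofReal (C * Real.exp (s * znorm (x - y))) := by
  obtain ⟨j, hj⟩ := h.ex
  have hm := h.mpos j hj
  have hK := h.momK_pos
  have hθ := h.θpos
  set r : ℝ := min (min s (1 / m j)) (min (θ / 4) (m j / (2 * momK μ θ))) with hr
  have hr0 : 0 < r := by rw [hr]; positivity
  have hrs : r ≤ s := (min_le_left _ _).trans (min_le_left _ _)
  have hr1 : r ≤ 1 / m j := (min_le_left _ _).trans (min_le_right _ _)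
  have hrθ : r ≤ θ / 4 := (min_le_right _ _).trans (min_le_left _ _)
  have hrm : r ≤ m j / (2 * momK μ θ) := (min_le_right _ _).trans (min_le_right _ _)
  have hrK : momK μ θ * r ≤ m j / 2 := by
    rw [le_div_iff₀ (by positivity)] at hrm
    linarith
  refine ⟨2 / (r * m j), by positivity, fun x hx y => ?_⟩
  set C := 2 / (r * m j) with hC
  have hC0 : 0 < C := by positivity
  have hCr : C * (r * m j) = 2 := by rw [hC]; field_simp
  have key := pot_PA_le (μ := μ) (A := posDom {i₀}) (f := dl y)
    (E := fun x => ENNReal.ofReal (C * Real.exp (-r * ((x j : ℝ) - y j)))) (fun x hx => ?_) x hx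
  · refine key.trans (ENNReal.ofReal_le_ofReal ?_)
    refine mul_le_mul_of_nonneg_left (Real.exp_le_exp.2 ?_) hC0.le
    have h1 := abs_apply_le_znorm (x - y) j
    have h2 := neg_abs_le ((x - y) j : ℝ)
    simp only [Pi.sub_apply, Int.cast_sub] at h1 h2
    have h3 := znorm_nonneg (x - y)
    calc -r * ((x j : ℝ) - y j) ≤ r * znorm (x - y) := by nlinarith
      _ ≤ s * znorm (x - y) := by gcongr
  · have h1 := PA_le_Ex (μ := μ) (A := posDom {i₀}) x
      (fun x => ENNReal.ofReal (C * Real.exp (-r * ((x j : ℝ) - y j))))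
    have h2 : Ex μ (fun u => ENNReal.ofReal (C * Real.exp (-r * (((x + u) j : ℤ) - y j : ℝ)))) =
        ENNReal.ofReal (C * Real.exp (-r * ((x j : ℝ) - y j))) *
          Ex μ (fun u => ENNReal.ofReal (Real.exp (-r * (u j : ℝ) + 0 * znorm u))) := by
      rw [← Ex_const_mul]
      congr 1
      funext u
      rw [← ENNReal.ofReal_mul (by positivity), mul_assoc, ← Real.exp_add]
      congr 3
      simp only [Pi.add_apply]; push_cast; ring
    have h3 := h.Ex_drift (j := j) hr0.le hrθ le_rfl (by positivity : (0 : ℝ) ≤ θ / 4)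
    have h4 : 1 - r * m j + momK μ θ * (r ^ 2 + 0) ≤ 1 - r * m j / 2 := by nlinarith
    have h5 : PA μ (posDom {i₀}) (fun x => ENNReal.ofReal (C * Real.exp (-r * ((x j : ℝ) - y j)))) x
        ≤ ENNReal.ofReal (C * Real.exp (-r * ((x j : ℝ) - y j)) * max 0 (1 - r * m j / 2)) := by
      rw [ENNReal.ofReal_mul (by positivity)]
      refine h1.trans (h2.le.trans ?_)
      gcongr
      refine h3.trans (ENNReal.ofReal_le_ofReal (h4.trans (le_max_right _ _)))
    by_cases hxy : x = y
    · subst hxy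
      have hd : dl x x = ENNReal.ofReal 1 := by simp [dl]
      rw [hd]
      refine (add_le_add_left h5 _).trans ?_
      rw [← ENNReal.ofReal_add (by positivity) zero_le_one]
      refine ENNReal.ofReal_le_ofReal ?_
      simp only [sub_self, mul_zero, Real.exp_zero, mul_one]
      have h6 : r * m j ≤ 1 := by rwa [le_div_iff₀ hm] at hr1
      rw [max_eq_right (by linarith)]
      linarith
    · simp only [dl, hxy, if_false, add_zero]
      refine h5.trans (ENNReal.ofReal_le_ofReal ?_)
      refine mul_le_of_le_one_right (by positivity) (max_le zero_le_one ?_)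
      have : 0 < r * m j := by positivity
      linarith

end Harnack

section LowerBound

variable {d : ℕ} {μ : (Fin d → ℤ) → ℝ} {θ : ℝ} {m : Fin d → ℝ} {i₀ : Fin d}

/-- A sequence going to infinity in the direction of the drift. -/
structure Dir (m : Fin d → ℝ) (i₀ : Fin d) (t : ℕ → ℝ) (y : ℕ → Fin d → ℤ) : Prop where
  mem : ∀ n, y n ∈ posDom {i₀}
  t_top : Tendsto t atTop atTop
  dir : ∀ ε > 0, ∀ᶠ n in atTop, ∀ j, |(y n j : ℝ) - t n * m j| ≤ ε * t n

/-- Exponential martingale bound for the probability of leaving a tube around the drift. -/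
noncomputable def tubeB (m : Fin d → ℝ) (K s δ : ℝ) (N : ℕ) (x' : Fin d → ℤ) (n : ℕ)
    (x : Fin d → ℤ) : ℝ≥0∞ :=
  ∑ p : Fin d × Bool, ENNReal.ofReal (Real.exp (-(s * δ * N) + K * s ^ 2 * n +
    (if p.2 then s else -s) * ((x p.1 : ℝ) - x' p.1 - ((N : ℝ) - n) * m p.1)))

theorem one_le_tubeB {m : Fin d → ℝ} {K s δ : ℝ} {N : ℕ} {x' : Fin d → ℤ} {n : ℕ}
    {x : Fin d → ℤ} (hK : 0 ≤ K) (j : Fin d) (hs : 0 ≤ s)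
    (h : δ * N ≤ |(x j : ℝ) - x' j - ((N : ℝ) - n) * m j|) : 1 ≤ tubeB m K s δ N x' n x := by
  set v := (x j : ℝ) - x' j - ((N : ℝ) - n) * m j with hv
  obtain ⟨b, hb⟩ : ∃ b : Bool, (if b then s else -s) * v = s * |v| := by
    rcases le_total 0 v with h0 | h0
    · exact ⟨true, by simp [abs_of_nonneg h0]⟩
    · exact ⟨false, by simp [abs_of_nonpos h0]⟩
  refine le_trans ?_ (Finset.single_le_sum (fun _ _ => zero_le) (Finset.mem_univ (j, b)))
  rw [← ENNReal.ofReal_one]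
  refine ENNReal.ofReal_le_ofReal (Real.one_le_exp ?_)
  simp only [← hv, hb]
  have := mul_le_mul_of_nonneg_left h hs
  have : 0 ≤ K * s ^ 2 * n := by positivity
  linarith

theorem Hyp.Ex_tubeB_le (h : Hyp μ θ m i₀) {s δ : ℝ} (hs : 0 ≤ s) (hs' : s ≤ θ / 4) (N : ℕ)
    (x' : Fin d → ℤ) (n : ℕ) (x : Fin d → ℤ) :
    Ex μ (fun u => tubeB m (momK μ θ) s δ N x' n (x + u)) ≤
      tubeB m (momK μ θ) s δ N x' (n + 1) x := by
  unfold tubeB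
  rw [Ex_sum]
  refine Finset.sum_le_sum fun p _ => ?_
  set σ : ℝ := if p.2 then s else -s with hσ
  have hσs : |σ| = s := by
    rw [hσ]; split_ifs <;> simp [abs_of_nonneg hs]
  have hσ2 : σ ^ 2 = s ^ 2 := by rw [← sq_abs, hσs]
  set c : ℝ := -(s * δ * N) + momK μ θ * s ^ 2 * n + σ * ((x p.1 : ℝ) - x' p.1 -
    ((N : ℝ) - n) * m p.1) with hc
  have h1 : Ex μ (fun u => ENNReal.ofReal (Real.exp (-(s * δ * N) + momK μ θ * s ^ 2 * n +
      σ * ((((x + u) p.1 : ℤ) : ℝ) - x' p.1 - ((N : ℝ) - n) * m p.1)))) =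
      ENNReal.ofReal (Real.exp c) *
        Ex μ (fun u => ENNReal.ofReal (Real.exp (σ * (u p.1 : ℝ) + 0 * znorm u))) := by
    rw [← Ex_const_mul]
    congr 1
    funext u
    rw [← ENNReal.ofReal_mul (by positivity), ← Real.exp_add]
    congr 2
    simp only [Pi.add_apply, hc]; push_cast; ring
  rw [h1]
  have h2 := h.Ex_tilt_le (ξ := fun u => (u p.1 : ℝ)) (mξ := m p.1) (s := σ) (δ := 0)
    (fun z => abs_apply_le_znorm z p.1) (h.mean p.1) (by rwa [hσs]) le_rfl (by linarith [h.θpos])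
  refine (mul_le_mul_right h2 _).trans ?_
  rw [← ENNReal.ofReal_mul (by positivity)]
  refine ENNReal.ofReal_le_ofReal ?_
  have h3 := Real.add_one_le_exp (σ * m p.1 + momK μ θ * s ^ 2)
  calc Real.exp c * (1 + σ * m p.1 + momK μ θ * (σ ^ 2 + 0))
      ≤ Real.exp c * Real.exp (σ * m p.1 + momK μ θ * s ^ 2) := by
        rw [hσ2]; gcongr; linarith
    _ = _ := by
        rw [← Real.exp_add]; congr 1; rw [hc]; push_cast; ring

/-- Indicator of the tube at time `N`. -/
noncomputable def tubeI (m : Fin d → ℝ) (δ : ℝ) (N : ℕ) (x' : Fin d → ℤ) : (Fin d → ℤ) → ℝ≥0∞ :=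
  fun x => if ∀ j, |(x j : ℝ) - x' j - N * m j| < δ * N then 1 else 0

theorem Hyp.tube_le (h : Hyp μ θ m i₀) {s δ : ℝ} (hs : 0 ≤ s) (hs' : s ≤ θ / 4) (N : ℕ)
    (x' : Fin d → ℤ) (hx' : δ * N ≤ x' i₀) (n : ℕ) (x : Fin d → ℤ) :
    1 ≤ (PA μ (posDom {i₀}) ^ n) (tubeI m δ N x') x + tubeB m (momK μ θ) s δ N x' n x := by
  have hoff : ∀ n, ∀ x ∉ posDom {i₀}, 1 ≤ tubeB m (momK μ θ) s δ N x' n x := by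
    intro n x hx
    rw [mem_posDom_singleton, not_lt] at hx
    refine one_le_tubeB h.momK_pos.le i₀ hs ?_
    rw [h.m0, mul_zero, sub_zero, abs_sub_comm]
    refine le_trans ?_ (le_abs_self _)
    have : (x i₀ : ℝ) ≤ 0 := by exact_mod_cast hx
    linarith
  induction n generalizing x with
  | zero =>
    by_cases hx : ∀ j, |(x j : ℝ) - x' j - N * m j| < δ * N
    · simp [tubeI, hx]
    · push Not at hx
      obtain ⟨j, hj⟩ := hx
      refine le_trans (one_le_tubeB h.momK_pos.le j hs ?_) le_add_self
      simpa using hj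
  | succ n ih =>
    by_cases hx : x ∈ posDom {i₀}
    · rw [pow_succ_apply', PA_apply hx]
      refine le_trans ?_ (add_le_add_right (h.Ex_tubeB_le hs hs' N x' n x) _)
      rw [← Ex_add, ← Ex_one h.nn h.sum]
      refine Ex_mono fun u => ?_
      split_ifs with hu
      · exact ih _
      · simpa using hoff n _ hu
    · exact le_trans (hoff _ x hx) le_add_self

theorem Hyp.half_le_tube (h : Hyp μ θ m i₀) {δ : ℝ} (hδ : 0 < δ) : ∃ N₀ : ℕ, ∀ N ≥ N₀,
    ∀ x' : Fin d → ℤ, δ * N ≤ x' i₀ →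
      2⁻¹ ≤ (PA μ (posDom {i₀}) ^ N) (tubeI m δ N x') x' := by
  have hθ := h.θpos
  have hK := h.momK_pos
  set s : ℝ := min (θ / 4) (δ / (2 * momK μ θ)) with hs
  have hs0 : 0 < s := by rw [hs]; positivity
  have hsK : momK μ θ * s ≤ δ / 2 := by
    have : s ≤ δ / (2 * momK μ θ) := min_le_right _ _
    rw [le_div_iff₀ (by positivity)] at this
    linarith
  have hlim : Tendsto (fun N : ℕ => (Fintype.card (Fin d × Bool) : ℝ) *
      Real.exp (-(s * δ / 2) * N)) atTop (𝓝 (Fintype.card (Fin d × Bool) * 0)) := by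
    refine Tendsto.const_mul _ (Real.tendsto_exp_atBot.comp ?_)
    exact tendsto_natCast_atTop_atTop.const_mul_atTop_of_neg (by have := mul_pos hs0 hδ; linarith)
  rw [mul_zero] at hlim
  obtain ⟨N₀, hN₀⟩ := (hlim.eventually (gt_mem_nhds (by norm_num : (0 : ℝ) < 2⁻¹))).exists_forall_of_atTop
  refine ⟨N₀, fun N hN x' hx' => ?_⟩
  have h1 := h.tube_le hs0.le (min_le_left _ _) N x' hx' N x'
  have h2 : tubeB m (momK μ θ) s δ N x' N x' ≤ 2⁻¹ := by
    have e : (2⁻¹ : ℝ≥0∞) = ENNReal.ofReal 2⁻¹ := by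
      rw [ENNReal.ofReal_inv_of_pos two_pos]; simp
    rw [e]
    refine le_trans ?_ (ENNReal.ofReal_le_ofReal (hN₀ N hN).le)
    rw [ENNReal.ofReal_mul (by positivity), ENNReal.ofReal_natCast]
    unfold tubeB
    refine (Finset.sum_le_card_nsmul _ _ (ENNReal.ofReal (Real.exp (-(s * δ / 2) * N)))
      fun p _ => ?_).trans (by simp)
    refine ENNReal.ofReal_le_ofReal (Real.exp_le_exp.2 ?_)
    simp only [sub_self, zero_mul, mul_zero, add_zero]
    have := mul_le_mul_of_nonneg_right (mul_le_mul_of_nonneg_left hsK hs0.le)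
      (Nat.cast_nonneg (α := ℝ) N)
    nlinarith
  have h3 := h1.trans (add_le_add_right h2 _)
  have h4 : (1 : ℝ≥0∞) = 2⁻¹ + 2⁻¹ := by rw [ENNReal.inv_two_add_inv_two]
  rw [h4] at h3
  exact (ENNReal.add_le_add_iff_right (by simp)).1 h3

theorem one_le_pot_dl {V : Type*} (T : Module.End ℝ≥0∞ (V → ℝ≥0∞)) (y : V) : 1 ≤ pot T (dl y) y :=
  le_trans (by simp [dl]) (ENNReal.le_tsum (f := fun n => (T ^ n) (dl y) y) 0)

theorem Hyp.green_lower (h : Hyp μ θ m i₀) {t : ℕ → ℝ} {y : ℕ → Fin d → ℤ} (hy : Dir m i₀ t y)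
    {ε : ℝ} (hε : 0 < ε) : ∀ᶠ n in atTop, ENNReal.ofReal (Real.exp (-ε * t n)) ≤
      pot (PA μ (posDom {i₀})) (dl (y n)) (fun _ => 1) := by
  obtain ⟨c, hc, hH⟩ := h.harnack
  set D : ℝ := (d : ℝ) with hD
  set M : ℝ := ∑ j, |m j| with hM
  have hM0 : 0 ≤ M := Finset.sum_nonneg fun _ _ => abs_nonneg _
  have hD0 : 0 ≤ D := Nat.cast_nonneg _
  set δ : ℝ := ε / (2 * (c * (1 + 3 * D))) with hδ
  have hδ0 : 0 < δ := by rw [hδ]; positivity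
  have hδε : c * (1 + 3 * D) * δ = ε / 2 := by rw [hδ]; field_simp
  obtain ⟨N₀, hN₀⟩ := h.half_le_tube hδ0
  set B : ℝ := c * (1 + 2 * D + M) + Real.log 2 with hB
  filter_upwards [hy.dir δ hδ0, hy.t_top.eventually_ge_atTop 1,
    hy.t_top.eventually_ge_atTop (N₀ + 1 : ℝ), hy.t_top.eventually_ge_atTop (2 * B / ε)]
    with n hn ht1 htN htB
  set τ := t n with hτ
  set N := ⌊τ⌋₊ with hN
  have hNle : (N : ℝ) ≤ τ := Nat.floor_le (by linarith)
  have hNlt : τ < N + 1 := Nat.lt_floor_add_one τ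
  have hNN : N₀ ≤ N := by
    have : (N₀ : ℝ) < N + 1 := by linarith
    exact Nat.lt_succ_iff.1 (by exact_mod_cast this)
  set w : Fin d → ℤ := Pi.single i₀ (⌈δ * N⌉₊ : ℤ) with hw
  set x' : Fin d → ℤ := (fun _ => 1) + w with hx'
  have hceil : δ * N ≤ ⌈δ * N⌉₊ := Nat.le_ceil _
  have hceil' : (⌈δ * N⌉₊ : ℝ) < δ * N + 1 := Nat.ceil_lt_add_one (by positivity)
  have hwj : ∀ j, 0 ≤ (w j : ℝ) ∧ (w j : ℝ) ≤ δ * N + 1 := by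
    intro j
    by_cases hj : j = i₀
    · subst hj; simp only [hw, Pi.single_eq_same]; push_cast
      exact ⟨by positivity, hceil'.le⟩
    · simp only [hw, Pi.single_eq_of_ne hj]; push_cast
      exact ⟨le_rfl, by positivity⟩
  have hx'i : δ * N ≤ (x' i₀ : ℝ) := by
    simp only [hx', hw, Pi.add_apply, Pi.single_eq_same]; push_cast; linarith
  have hx'H : x' ∈ posDom {i₀} := by
    rw [mem_posDom_singleton]
    simp only [hx', hw, Pi.add_apply, Pi.single_eq_same]; positivity
  set F := pot (PA μ (posDom {i₀})) (dl (y n)) with hF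
  have hFs : ∀ x ∈ posDom {i₀}, PA μ (posDom {i₀}) F x ≤ F x := fun x _ => pot_PA_le_self _ x
  set R : ℝ := D * (3 * δ * τ + 2) + M with hR
  have htube : ∀ z ∈ posDom {i₀},
      ENNReal.ofReal (Real.exp (-c * R)) * tubeI m δ N x' z ≤ F z := by
    intro z hz
    unfold tubeI
    split_ifs with hzt
    · rw [mul_one]
      refine le_trans ?_ (hH F hFs z hz (y n) (hy.mem n))
      refine le_trans ?_ (mul_le_mul_right (one_le_pot_dl _ (y n)) _)
      rw [mul_one]
      refine ENNReal.ofReal_le_ofReal (Real.exp_le_exp.2 ?_)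
      have : znorm (z - y n) ≤ R := by
        have : ∀ j, |((z - y n) j : ℝ)| ≤ (3 * δ * τ + 2) + |m j| := by
          intro j
          have a1 := abs_le.1 (hzt j).le
          have a2 := abs_le.1 (hn j)
          have a3 := hwj j
          have a4 : |(τ - N) * m j| ≤ |m j| := by
            rw [abs_mul, abs_of_nonneg (by linarith)]
            exact mul_le_of_le_one_left (abs_nonneg _) (by linarith)
          have a5 := abs_le.1 a4
          have a6 : (x' j : ℝ) = 1 + w j := by simp [hx']
          have a7 : δ * N ≤ δ * τ := by gcongr
          simp only [Pi.sub_apply]; push_cast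
          rw [abs_le]
          constructor <;> nlinarith
        calc znorm (z - y n) ≤ ∑ j, ((3 * δ * τ + 2) + |m j|) := Finset.sum_le_sum fun j _ => this j
          _ = R := by
              rw [Finset.sum_add_distrib, Finset.sum_const, Finset.card_univ, Fintype.card_fin,
                nsmul_eq_mul]
      nlinarith
    · simp
  have hpow := PA_pow_mono (μ := μ) htube N x' hx'H
  have e1 : (PA μ (posDom {i₀}) ^ N) (fun z => ENNReal.ofReal (Real.exp (-c * R)) *
      tubeI m δ N x' z) x' = ENNReal.ofReal (Real.exp (-c * R)) *
      (PA μ (posDom {i₀}) ^ N) (tubeI m δ N x') x' := by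
    have := map_smul (PA μ (posDom {i₀}) ^ N) (ENNReal.ofReal (Real.exp (-c * R)))
      (tubeI m δ N x')
    exact congrFun this x'
  rw [e1] at hpow
  have hFx' : ENNReal.ofReal (Real.exp (-c * R)) * 2⁻¹ ≤ F x' :=
    (mul_le_mul_right (hN₀ N hNN x' hx'i) _).trans (hpow.trans (PA_pow_le_of_le hFs N x' hx'H))
  have h1H : (fun _ => 1 : Fin d → ℤ) ∈ posDom {i₀} := by rw [mem_posDom_singleton]; norm_num
  refine le_trans ?_ (hH F hFs _ h1H x' hx'H)
  refine le_trans ?_ (mul_le_mul_right hFx' _)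
  have e2 : (2⁻¹ : ℝ≥0∞) = ENNReal.ofReal (Real.exp (-Real.log 2)) := by
    rw [Real.exp_neg, Real.exp_log two_pos, ENNReal.ofReal_inv_of_pos two_pos]; simp
  rw [e2, ← ENNReal.ofReal_mul (by positivity), ← ENNReal.ofReal_mul (by positivity),
    ← Real.exp_add, ← Real.exp_add]
  refine ENNReal.ofReal_le_ofReal (Real.exp_le_exp.2 ?_)
  have hzn : znorm ((fun _ => 1) - x') ≤ δ * τ + 1 := by
    have : (fun _ => 1) - x' = -w := by rw [hx']; abel
    rw [this, znorm_neg]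
    have : znorm w = ⌈δ * N⌉₊ := by
      unfold znorm
      rw [Finset.sum_eq_single i₀]
      · simp [hw]
      · intro j _ hj; simp [hw, hj]
      · simp
    rw [this]
    have : δ * N ≤ δ * τ := by gcongr
    linarith
  rw [div_le_iff₀ hε] at htB
  have := mul_le_mul_of_nonneg_left hzn hc.le
  have e3 : c * (1 + 3 * D) * δ * τ = ε / 2 * τ := by rw [hδε]
  simp only [hR, hB] at *
  nlinarith

end LowerBound

section Binomial

theorem Commute.sum_mul_choose {S : Type*} [Semiring S] {x y : S} (h : Commute x y) (M : ℕ) :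
    ((M + 1 : ℕ) : S) * (x * (x + y) ^ M) =
      ∑ j ∈ Finset.range (M + 2), (j : S) * (x ^ j * y ^ (M + 1 - j) * ((M + 1).choose j : S)) := by
  rw [Finset.sum_range_succ', Nat.cast_zero, zero_mul, add_zero, h.add_pow, Finset.mul_sum,
    Finset.mul_sum]
  refine Finset.sum_congr rfl fun j _ => ?_
  have h1 : ((M + 1 : ℕ) : S) * (M.choose j : S) = ((M + 1).choose (j + 1) : S) * ((j + 1 : ℕ) : S) := by
    exact_mod_cast congrArg (Nat.cast : ℕ → S) (Nat.add_one_mul_choose_eq M j)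
  have h2 : M + 1 - (j + 1) = M - j := by omega
  rw [h2, pow_succ']
  calc ((M + 1 : ℕ) : S) * (x * (x ^ j * y ^ (M - j) * (M.choose j : S)))
      = x * x ^ j * y ^ (M - j) * (((M + 1 : ℕ) : S) * (M.choose j : S)) := by
        rw [(Nat.cast_commute (M + 1) _).eq]
        simp only [mul_assoc]
        rw [(Nat.cast_commute (M + 1) _).eq]
    _ = ((j + 1 : ℕ) : S) * (x * x ^ j * y ^ (M - j) * ((M + 1).choose (j + 1) : S)) := by
        rw [h1, (Nat.cast_commute (j + 1) _).eq]
        simp only [mul_assoc]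

variable {V : Type*}

theorem natCast_mul_apply (n : ℕ) (T : Module.End ℝ≥0∞ (V → ℝ≥0∞)) (F : V → ℝ≥0∞) (x : V) :
    ((n : Module.End ℝ≥0∞ (V → ℝ≥0∞)) * T) F x = n * T F x := by
  rw [← nsmul_eq_mul]
  simp

theorem mul_natCast_apply (n : ℕ) (T : Module.End ℝ≥0∞ (V → ℝ≥0∞)) (F : V → ℝ≥0∞) (x : V) :
    (T * (n : Module.End ℝ≥0∞ (V → ℝ≥0∞))) F x = n * T F x := by
  rw [← (Nat.cast_commute n T).eq, natCast_mul_apply]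

/-- Splitting the binomial expansion of `(X + R) ^ (M + 1)` at a level `K`. -/
theorem mul_pow_le_of_commute {X R : Module.End ℝ≥0∞ (V → ℝ≥0∞)} (h : Commute X R) (M : ℕ)
    {K τ : ℝ} (hK : 0 ≤ K) (hτ : 0 < τ) (G : V → ℝ≥0∞) (x : V) :
    ((M + 1 : ℕ) : ℝ≥0∞) * X (((X + R) ^ M) G) x ≤
      ENNReal.ofReal K * ((X + R) ^ (M + 1)) G x + ENNReal.ofReal (Real.exp (-τ * K) / τ) *
        ((ENNReal.ofReal (Real.exp τ) • X + R) ^ (M + 1)) G x := by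
  set lam := ENNReal.ofReal (Real.exp τ) with hlam
  have hc : Commute (lam • X) R := h.smul_left lam
  set a : ℕ → ℝ≥0∞ := fun j => ((M + 1).choose j : ℝ≥0∞) * (X ^ j * R ^ (M + 1 - j)) G x with ha
  have e1 : ((M + 1 : ℕ) : ℝ≥0∞) * X (((X + R) ^ M) G) x =
      ∑ j ∈ Finset.range (M + 2), (j : ℝ≥0∞) * a j := by
    have := congrFun (LinearMap.congr_fun (h.sum_mul_choose M) G) x
    rw [natCast_mul_apply, Module.End.mul_apply] at this
    rw [this, LinearMap.sum_apply, Finset.sum_apply]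
    refine Finset.sum_congr rfl fun j _ => ?_
    rw [natCast_mul_apply, mul_natCast_apply]
  have e2 : ((X + R) ^ (M + 1)) G x = ∑ j ∈ Finset.range (M + 2), a j := by
    rw [h.add_pow, LinearMap.sum_apply, Finset.sum_apply]
    exact Finset.sum_congr rfl fun j _ => mul_natCast_apply _ _ _ _
  have e3 : ((lam • X + R) ^ (M + 1)) G x = ∑ j ∈ Finset.range (M + 2), lam ^ j * a j := by
    rw [hc.add_pow, LinearMap.sum_apply, Finset.sum_apply]
    refine Finset.sum_congr rfl fun j _ => ?_
    rw [mul_natCast_apply, smul_pow, smul_mul_assoc, LinearMap.smul_apply, Pi.smul_apply,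
      smul_eq_mul, ha]
    ring
  rw [e1, e2, e3, Finset.mul_sum, Finset.mul_sum, ← Finset.sum_add_distrib]
  refine Finset.sum_le_sum fun j _ => ?_
  generalize a j = b
  rw [← mul_assoc, ← add_mul]
  refine mul_le_mul_left ?_ _
  rw [hlam, ← ENNReal.ofReal_pow (by positivity), ← ENNReal.ofReal_mul (by positivity),
    ← ENNReal.ofReal_add hK (by positivity), ← ENNReal.ofReal_natCast]
  refine ENNReal.ofReal_le_ofReal ?_
  rw [← Real.exp_nat_mul, div_mul_eq_mul_div, ← Real.exp_add]
  have := Real.add_one_le_exp (-τ * K + j * τ)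
  rw [← sub_le_iff_le_add', le_div_iff₀ hτ]
  nlinarith

end Binomial

section Ratio

variable {d : ℕ} {μ : (Fin d → ℤ) → ℝ} {θ : ℝ} {m : Fin d → ℝ} {i₀ : Fin d}

theorem path_pow_le {V : Type*} [AddCommGroup V] {μ : V → ℝ} {A : Set V} {c : ℕ → V} {k : ℕ}
    (hc : ∀ j < k, 0 < μ (c (j + 1) - c j)) :
    ∃ ε : ℝ, 0 < ε ∧ ∀ F : V → ℝ≥0∞, ∀ w : V,
      (∀ j ≤ k, c j + w ∈ A) → ENNReal.ofReal ε * F (c k + w) ≤ (PA μ A ^ k) F (c 0 + w) := by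
  induction k with
  | zero => exact ⟨1, one_pos, fun F w _ => by simp⟩
  | succ k ih =>
    obtain ⟨ε, hε, h⟩ := ih fun j hj => hc j (by omega)
    refine ⟨ε * μ (c (k + 1) - c k), mul_pos hε (hc k (by omega)), fun F w hw => ?_⟩
    rw [pow_succ_apply]
    refine le_trans ?_ (h _ w fun j hj => hw j (by omega))
    rw [ENNReal.ofReal_mul hε.le, mul_assoc]
    gcongr
    have := PA_single_le (μ := μ) (F := F) (hw k (by omega)) (hw (k + 1) le_rfl)
    simpa using this

theorem Hyp.exists_pow_ge (h : Hyp μ θ m i₀) {w : Fin d → ℤ} (hw : w i₀ = 0) (hw0 : w ≠ 0) :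
    ∃ k : ℕ, ∃ ε : ℝ, 0 < ε ∧ ∀ F : (Fin d → ℤ) → ℝ≥0∞, ∀ x ∈ posDom {i₀},
      ENNReal.ofReal ε * F (x + w) ≤ (PA μ (posDom {i₀}) ^ (k + 1)) F x := by
  set b : Fin d → ℤ := fun _ => 1 with hb
  have hbH : b ∈ posDom {i₀} := by rw [mem_posDom_singleton]; simp [hb]
  have hbwH : b + w ∈ posDom {i₀} := by rw [mem_posDom_singleton]; simp [hb, hw]
  obtain ⟨k, c, h0, hk, hcA, hcp⟩ := h.irrH b hbH (b + w) hbwH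
  obtain ⟨k, rfl⟩ : ∃ l, k = l + 1 := by
    refine Nat.exists_eq_succ_of_ne_zero fun hk0 => hw0 ?_
    subst hk0
    simpa using h0.symm.trans hk
  obtain ⟨ε, hε, H⟩ := path_pow_le (A := posDom {i₀}) hcp
  refine ⟨k, ε, hε, fun F x hx => ?_⟩
  have := H F (x - b) fun j hj => by
    have := hcA j hj
    rw [mem_posDom_singleton] at this hx ⊢
    simp only [hb, Pi.add_apply, Pi.sub_apply]
    omega
  rw [h0, hk] at this
  have e1 : b + w + (x - b) = x + w := by abel
  have e2 : b + (x - b) = x := by abel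
  rwa [e1, e2] at this

/-- The shift by `w` restricted to the half-space. -/
noncomputable def shiftOp (i₀ : Fin d) (w : Fin d → ℤ) :
    Module.End ℝ≥0∞ ((Fin d → ℤ) → ℝ≥0∞) :=
  kop fun x z => if x ∈ posDom {i₀} ∧ z = x + w then 1 else 0

theorem shiftOp_apply (w : Fin d → ℤ) (F : (Fin d → ℤ) → ℝ≥0∞) (x : Fin d → ℤ) :
    shiftOp i₀ w F x = if x ∈ posDom {i₀} then F (x + w) else 0 := by
  rw [shiftOp, kop_apply, tsum_eq_single (x + w)]
  · split_ifs <;> simp_all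
  · intro z hz; simp [hz]

theorem PA_pow_shift {w : Fin d → ℤ} (hw : w i₀ = 0) (n : ℕ) (x z : Fin d → ℤ) :
    (PA μ (posDom {i₀}) ^ n) (dl (z + w)) (x + w) = (PA μ (posDom {i₀}) ^ n) (dl z) x := by
  induction n generalizing x with
  | zero => simp [dl]
  | succ n ih =>
    rw [pow_succ_apply', pow_succ_apply', PA, kop_apply, kop_apply, ← (Equiv.addRight w).tsum_eq]
    refine tsum_congr fun u => ?_
    rw [← PA, Equiv.coe_addRight, ih u]
    congr 1
    simp [mem_posDom_singleton, hw]

theorem commute_shiftOp {w : Fin d → ℤ} (r : (Fin d → ℤ) → (Fin d → ℤ) → ℝ≥0∞)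
    (hr : ∀ x z, r (x + w) (z + w) = r x z)
    (hr0 : ∀ x z, r x z ≠ 0 → x ∈ posDom {i₀} ∧ z ∈ posDom {i₀}) :
    Commute (shiftOp i₀ w) (kop r) := by
  refine LinearMap.ext fun F => funext fun x => ?_
  rw [Module.End.mul_apply, Module.End.mul_apply, shiftOp_apply, kop_apply, kop_apply]
  have h1 : ∑' z, r x z * shiftOp i₀ w F z = ∑' z, r x z * F (z + w) := by
    refine tsum_congr fun z => ?_
    rw [shiftOp_apply]
    by_cases h0 : r x z = 0
    · simp [h0]
    · rw [if_pos (hr0 x z h0).2]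
  rw [h1]
  split_ifs with hx
  · rw [← (Equiv.addRight w).tsum_eq]
    exact tsum_congr fun z => by rw [Equiv.coe_addRight, hr]
  · symm
    rw [ENNReal.tsum_eq_zero]
    intro z
    have : r x z = 0 := by
      by_contra h0
      exact hx (hr0 x z h0).1
    simp [this]

theorem Hyp.PA_expNorm_le (h : Hyp μ θ m i₀) {A : Set (Fin d → ℤ)} {s : ℝ} (hs : 0 ≤ s)
    (hs' : s ≤ θ / 4) (y : Fin d → ℤ) (n : ℕ) (x : Fin d → ℤ) :
    (PA μ A ^ n) (fun z => ENNReal.ofReal (Real.exp (-s * znorm (z - y)))) x ≤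
      ENNReal.ofReal ((1 + momK μ θ * s) ^ n) * ENNReal.ofReal (Real.exp (-s * znorm (x - y))) := by
  have hK := h.momK_pos
  induction n generalizing x with
  | zero => simp
  | succ n ih =>
    rw [pow_succ_apply']
    refine ((isKop_PA μ A).mono ih x).trans ?_
    refine (PA_le_Ex x _).trans ?_
    have h1 : ∀ u : Fin d → ℤ, ENNReal.ofReal ((1 + momK μ θ * s) ^ n) *
        ENNReal.ofReal (Real.exp (-s * znorm (x + u - y))) ≤
        (ENNReal.ofReal ((1 + momK μ θ * s) ^ n) * ENNReal.ofReal (Real.exp (-s * znorm (x - y)))) *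
          ENNReal.ofReal (Real.exp (s * znorm u)) := by
      intro u
      rw [mul_assoc]
      gcongr
      rw [← ENNReal.ofReal_mul (by positivity), ← Real.exp_add]
      refine ENNReal.ofReal_le_ofReal (Real.exp_le_exp.2 ?_)
      have h2 := znorm_sub_le (x + u - y) u
      have h3 : x + u - y - u = x - y := by abel
      rw [h3] at h2
      nlinarith
    refine (Ex_mono h1).trans ?_
    rw [Ex_const_mul]
    refine (mul_le_mul_right (h.Ex_znorm_le hs hs') _).trans (le_of_eq ?_)
    rw [pow_succ, ENNReal.ofReal_mul (by positivity)]
    ring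

theorem pot_eq_pot_pow {V : Type*} (T : Module.End ℝ≥0∞ (V → ℝ≥0∞)) (k : ℕ)
    (f : V → ℝ≥0∞) :
    pot T f = pot (T ^ (k + 1)) (∑ i ∈ Finset.range (k + 1), (T ^ i) f) := by
  funext x
  unfold pot
  rw [← (Nat.divModEquiv (k + 1)).symm.tsum_eq, ENNReal.tsum_prod (f := fun a b => (T ^ (k + 1).divModEquiv.symm (a, b)) f x)]
  refine tsum_congr fun n => ?_
  rw [map_sum, Finset.sum_apply, tsum_fintype, Finset.sum_range]
  refine Finset.sum_congr rfl fun i _ => ?_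
  rw [← pow_mul, ← Module.End.mul_apply, ← pow_add]
  have : (Nat.divModEquiv (k + 1)).symm (n, i) = (k + 1) * n + i := by
    simp [Nat.divModEquiv, mul_comm]
  rw [this]

/-- Shifting the starting point parallel to the boundary hardly changes the Green function, up to
an error which is exponentially small in the distance to the pole. -/
theorem Hyp.green_shift_le (h : Hyp μ θ m i₀) {w : Fin d → ℤ} (hw : w i₀ = 0) {δ : ℝ} (hδ : 0 < δ) :
    ∃ C s : ℝ, 0 < C ∧ 0 < s ∧ ∀ y, ∀ x ∈ posDom {i₀},
      pot (PA μ (posDom {i₀})) (dl y) (x + w) ≤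
        ENNReal.ofReal (1 + δ) * pot (PA μ (posDom {i₀})) (dl y) x +
          ENNReal.ofReal (C * Real.exp (-s * znorm (x - y))) := by
  by_cases hw0 : w = 0
  · refine ⟨1, 1, one_pos, one_pos, fun y x _ => ?_⟩
    rw [hw0, add_zero]
    refine le_trans ?_ le_self_add
    refine le_mul_of_one_le_left zero_le ?_
    rw [← ENNReal.ofReal_one]
    exact ENNReal.ofReal_le_ofReal (by linarith)
  obtain ⟨k, ε, hε, hk⟩ := h.exists_pow_ge hw hw0
  have hθ := h.θpos
  have hK := h.momK_pos
  -- choice of the tilting parameters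
  set τ : ℝ := min 1 (δ / 2) with hτ
  have hτ0 : 0 < τ := by rw [hτ]; positivity
  have hτ1 : τ ≤ 1 := min_le_left _ _
  have hτδ : τ ≤ δ / 2 := min_le_right _ _
  set ρ : ℝ → ℝ := fun s => Real.exp (-τ * (1 + δ) * ε) *
    ((Real.exp τ - 1) * ε * Real.exp (s * znorm w) + (1 + momK μ θ * s) ^ (k + 1)) with hρ
  have hρ0 : ρ 0 < 1 := by
    have h1 : Real.exp τ - 1 ≤ τ + τ ^ 2 := by
      have := abs_le.1 (Real.abs_exp_sub_one_sub_id_le (x := τ) (by rwa [abs_of_pos hτ0]))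
      linarith [this.2]
    have h2 : Real.exp τ - 1 < τ * (1 + δ) := by nlinarith
    have h3 : (Real.exp τ - 1) * ε + 1 ≤ Real.exp ((Real.exp τ - 1) * ε) := Real.add_one_le_exp _
    calc ρ 0 = Real.exp (-τ * (1 + δ) * ε) * ((Real.exp τ - 1) * ε + 1) := by simp [hρ]
      _ ≤ Real.exp (-τ * (1 + δ) * ε) * Real.exp ((Real.exp τ - 1) * ε) := by gcongr
      _ < 1 := by
        rw [← Real.exp_add, Real.exp_lt_one_iff]
        nlinarith
  have hρc : Continuous ρ := by rw [hρ]; fun_prop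
  obtain ⟨s, hs0, hsθ, hρs⟩ : ∃ s, 0 < s ∧ s ≤ θ / 4 ∧ ρ s < 1 := by
    have h1 : ∀ᶠ s in 𝓝[>] (0 : ℝ), ρ s < 1 :=
      (hρc.tendsto 0).mono_left nhdsWithin_le_nhds |>.eventually (gt_mem_nhds hρ0)
    have h2 : ∀ᶠ s in 𝓝[>] (0 : ℝ), s ∈ Set.Ioo 0 (θ / 4) := Ioo_mem_nhdsGT (by positivity)
    obtain ⟨s, hs1, hs2⟩ := (h1.and h2).exists
    exact ⟨s, hs2.1, hs2.2.le, hs1⟩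
  have hρpos : 0 ≤ ρ s := by
    have : 0 ≤ Real.exp τ - 1 := by have := Real.add_one_le_exp τ; linarith
    simp only [hρ]; positivity
  -- the operators
  set P := PA μ (posDom {i₀}) with hP
  set Q := P ^ (k + 1) with hQ
  set q : (Fin d → ℤ) → (Fin d → ℤ) → ℝ≥0∞ := fun x z => Q (dl z) x with hq
  set b : (Fin d → ℤ) → (Fin d → ℤ) → ℝ≥0∞ := fun x z =>
    if x ∈ posDom {i₀} ∧ z = x + w then ENNReal.ofReal ε else 0 with hb
  have hQq : Q = kop q := LinearMap.ext fun F => funext fun x =>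
    ((isKop_PA μ _).pow (k + 1)).apply_eq F x
  have hbq : ∀ x z, b x z ≤ q x z := by
    intro x z
    simp only [hb, hq]
    split_ifs with hxz
    · have := hk (dl z) x hxz.1
      rw [← hxz.2] at this
      simpa [dl] using this
    · exact zero_le
  set r : (Fin d → ℤ) → (Fin d → ℤ) → ℝ≥0∞ := fun x z => q x z - b x z with hr
  set X := ENNReal.ofReal ε • shiftOp i₀ w with hX
  have hXb : X = kop b := by
    refine LinearMap.ext fun F => funext fun x => ?_
    rw [hX, LinearMap.smul_apply, Pi.smul_apply, smul_eq_mul, shiftOp, kop_apply, kop_apply,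
      ← ENNReal.tsum_mul_left]
    refine tsum_congr fun z => ?_
    simp only [hb]
    split_ifs <;> simp
  have hXR : X + kop r = Q := by
    rw [hXb, hQq]
    refine LinearMap.ext fun F => funext fun x => ?_
    rw [LinearMap.add_apply, Pi.add_apply, kop_apply, kop_apply, kop_apply, ← ENNReal.tsum_add]
    refine tsum_congr fun z => ?_
    rw [← add_mul, hr, add_tsub_cancel_of_le (hbq x z)]
  have hcomm : Commute X (kop r) := by
    refine Commute.smul_left ?_ _
    refine commute_shiftOp r (fun x z => ?_) fun x z hxz => ?_
    · simp only [hr, hq, hb, hQ, hP]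
      rw [PA_pow_shift hw]
      congr 1
      simp [mem_posDom_singleton, hw]
    · have hq0 : q x z ≠ 0 := fun h0 => hxz (by simp [hr, h0])
      simp only [hq, hQ] at hq0
      have hx : x ∈ posDom {i₀} := by
        by_contra hx
        rw [pow_succ_apply', hP, PA_apply_of_notMem hx] at hq0
        exact hq0 rfl
      refine ⟨hx, ?_⟩
      by_contra hz
      exact hq0 (PA_pow_dl_zero_of_notMem hx hz)
  have hXk : IsKop X := hXb ▸ isKop_kop b
  have hrk : IsKop (kop r) := isKop_kop r
  set lam := ENNReal.ofReal (Real.exp τ) with hlam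
  set Q' := ENNReal.ofReal (Real.exp (-τ * ((1 + δ) * ε))) • (lam • X + kop r) with hQ'
  have hQ'k : IsKop Q' := ((hXk.smul _).add hrk).smul _
  set C₀ : ℝ := 1 / (τ * ε) with hC₀
  have hC₀0 : 0 < C₀ := by rw [hC₀]; positivity
  -- one block of steps
  have hstep : ∀ (M : ℕ) (G : (Fin d → ℤ) → ℝ≥0∞) (x : Fin d → ℤ), x ∈ posDom {i₀} →
      (Q ^ M) G (x + w) ≤ ENNReal.ofReal (1 + δ) * (Q ^ (M + 1)) G x +
        ENNReal.ofReal C₀ * (Q' ^ (M + 1)) G x := by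
    intro M G x hx
    have h1 := mul_pow_le_of_commute hcomm M (K := (1 + δ) * ε * (M + 1)) (τ := τ)
      (by positivity) hτ0 G x
    rw [hXR] at h1
    have h2 : X ((Q ^ M) G) x = ENNReal.ofReal ε * (Q ^ M) G (x + w) := by
      rw [hX, LinearMap.smul_apply, Pi.smul_apply, smul_eq_mul, shiftOp_apply, if_pos hx]
    have h3 : (Q' ^ (M + 1)) G x =
        ENNReal.ofReal (Real.exp (-τ * ((1 + δ) * ε * (M + 1)))) *
          ((lam • X + kop r) ^ (M + 1)) G x := by
      rw [hQ', smul_pow, LinearMap.smul_apply, Pi.smul_apply, smul_eq_mul,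
        ← ENNReal.ofReal_pow (by positivity), ← Real.exp_nat_mul]
      congr 3
      push_cast; ring
    have h4 : ENNReal.ofReal (Real.exp (-τ * ((1 + δ) * ε * (M + 1))) / τ) *
        ((lam • X + kop r) ^ (M + 1)) G x = ENNReal.ofReal (1 / τ) * (Q' ^ (M + 1)) G x := by
      rw [h3, ← mul_assoc (ENNReal.ofReal (1 / τ)), ← ENNReal.ofReal_mul (by positivity)]
      congr 2; ring_nf
    rw [h2, h4, ← mul_assoc] at h1
    have h5 : ((M + 1 : ℕ) : ℝ≥0∞) * ENNReal.ofReal ε = ENNReal.ofReal ((M + 1) * ε) := by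
      rw [ENNReal.ofReal_mul (by positivity), ← ENNReal.ofReal_natCast]
      push_cast; rfl
    rw [h5] at h1
    have h6 := mul_le_mul_right h1 (ENNReal.ofReal (1 / ((M + 1) * ε)))
    rw [← mul_assoc, ← ENNReal.ofReal_mul (by positivity), one_div_mul_cancel (by positivity),
      ENNReal.ofReal_one, one_mul, mul_add, ← mul_assoc, ← mul_assoc,
      ← ENNReal.ofReal_mul (by positivity), ← ENNReal.ofReal_mul (by positivity)] at h6
    refine h6.trans (add_le_add (le_of_eq ?_) ?_)
    · congr 2; field_simp
    · gcongr
      rw [hC₀, div_mul_div_comm, one_mul]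
      refine one_div_le_one_div_of_le (by positivity) ?_
      have : (0 : ℝ) ≤ M * (ε * τ) := by positivity
      nlinarith
  -- the test function
  set E : (Fin d → ℤ) → (Fin d → ℤ) → ℝ≥0∞ := fun y z =>
    ENNReal.ofReal (Real.exp (-s * znorm (z - y))) with hE
  have hQ'E : ∀ y x, Q' (E y) x ≤ ENNReal.ofReal (ρ s) * E y x := by
    intro y x
    have h1 : X (E y) x ≤ ENNReal.ofReal (ε * Real.exp (s * znorm w)) * E y x := by
      rw [hX, LinearMap.smul_apply, Pi.smul_apply, smul_eq_mul, shiftOp_apply,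
        ENNReal.ofReal_mul hε.le, mul_assoc]
      refine mul_le_mul_right ?_ _
      split_ifs
      · simp only [hE]
        rw [← ENNReal.ofReal_mul (by positivity), ← Real.exp_add]
        refine ENNReal.ofReal_le_ofReal (Real.exp_le_exp.2 ?_)
        have h2 := znorm_sub_le (x + w - y) w
        have h3 : x + w - y - w = x - y := by abel
        rw [h3] at h2
        nlinarith
      · exact zero_le
    have h2 : Q (E y) x ≤ ENNReal.ofReal ((1 + momK μ θ * s) ^ (k + 1)) * E y x :=
      h.PA_expNorm_le hs0.le hsθ y (k + 1) x
    have h3 : lam • X + kop r = ENNReal.ofReal (Real.exp τ - 1) • X + Q := by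
      rw [← hXR, ← add_assoc]
      congr 1
      have : lam = ENNReal.ofReal (Real.exp τ - 1) + 1 := by
        rw [hlam, ← ENNReal.ofReal_one, ← ENNReal.ofReal_add _ zero_le_one]
        · congr 1; ring
        · have := Real.add_one_le_exp τ; linarith
      rw [this, add_smul, one_smul]
    have h4 : 0 ≤ Real.exp τ - 1 := by have := Real.add_one_le_exp τ; linarith
    rw [hQ', h3, LinearMap.smul_apply, LinearMap.add_apply, LinearMap.smul_apply, Pi.smul_apply,
      Pi.add_apply, Pi.smul_apply, smul_eq_mul, smul_eq_mul]
    calc _ ≤ ENNReal.ofReal (Real.exp (-τ * ((1 + δ) * ε))) * (ENNReal.ofReal (Real.exp τ - 1) *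
          (ENNReal.ofReal (ε * Real.exp (s * znorm w)) * E y x) +
            ENNReal.ofReal ((1 + momK μ θ * s) ^ (k + 1)) * E y x) := by gcongr
      _ = ENNReal.ofReal (ρ s) * E y x := by
          rw [← mul_assoc (ENNReal.ofReal (Real.exp τ - 1)), ← add_mul, ← mul_assoc,
            ← ENNReal.ofReal_mul h4, ← ENNReal.ofReal_add (by positivity) (by positivity),
            ← ENNReal.ofReal_mul (by positivity)]
          congr 2
          simp only [hρ]
          ring_nf
  have hG : ∀ y x, (∑ i ∈ Finset.range (k + 1), (P ^ i) (dl y)) x ≤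
      ENNReal.ofReal ((k + 1) * (1 + momK μ θ * s) ^ (k + 1)) * E y x := by
    intro y x
    rw [Finset.sum_apply, ENNReal.ofReal_mul (by positivity), mul_assoc]
    have h1 : ∀ i ∈ Finset.range (k + 1), (P ^ i) (dl y) x ≤
        ENNReal.ofReal ((1 + momK μ θ * s) ^ (k + 1)) * E y x := by
      intro i hi
      have h2 : dl y ≤ E y := by
        intro z
        simp only [dl, hE]
        split_ifs with hz
        · subst hz; simp [znorm]
        · exact zero_le
      refine (((isKop_PA μ _).pow i).mono h2 x).trans
        ((h.PA_expNorm_le hs0.le hsθ y i x).trans ?_)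
      refine mul_le_mul_left (ENNReal.ofReal_le_ofReal ?_) _
      refine pow_le_pow_right₀ ?_ (Finset.mem_range.1 hi).le
      have : 0 < momK μ θ * s := by positivity
      linarith
    refine (Finset.sum_le_card_nsmul _ _ _ h1).trans (le_of_eq ?_)
    rw [Finset.card_range, nsmul_eq_mul]
    congr 1
    rw [← ENNReal.ofReal_natCast]
    push_cast; rfl
  set C₁ : ℝ := (k + 1) * (1 + momK μ θ * s) ^ (k + 1) / (1 - ρ s) with hC₁
  have h1ρ : 0 < 1 - ρ s := by linarith
  have hC₁0 : 0 < C₁ := by rw [hC₁]; positivity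
  have hpot : ∀ y x, pot Q' (∑ i ∈ Finset.range (k + 1), (P ^ i) (dl y)) x ≤
      ENNReal.ofReal C₁ * E y x := by
    intro y
    refine hQ'k.pot_le (E := fun x => ENNReal.ofReal C₁ * E y x) fun x => ?_
    have h1 : Q' (fun x => ENNReal.ofReal C₁ * E y x) x = ENNReal.ofReal C₁ * Q' (E y) x :=
      congrFun (map_smul Q' (ENNReal.ofReal C₁) (E y)) x
    rw [Pi.add_apply, h1]
    refine (add_le_add (mul_le_mul_right (hQ'E y x) _) (hG y x)).trans (le_of_eq ?_)
    rw [← mul_assoc, ← add_mul, ← ENNReal.ofReal_mul hC₁0.le,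
      ← ENNReal.ofReal_add (by positivity) (by positivity)]
    congr 2
    rw [hC₁]; field_simp; ring
  refine ⟨C₀ * C₁, s, by positivity, hs0, fun y x hx => ?_⟩
  rw [pot_eq_pot_pow P k (dl y)]
  set G := ∑ i ∈ Finset.range (k + 1), (P ^ i) (dl y) with hGdef
  have hle : ∀ (T : Module.End ℝ≥0∞ ((Fin d → ℤ) → ℝ≥0∞)),
      ∑' M : ℕ, (T ^ (M + 1)) G x ≤ pot T G x := by
    intro T
    unfold pot
    rw [tsum_eq_zero_add' (f := fun M => (T ^ M) G x) ENNReal.summable]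
    exact le_add_self
  calc pot Q G (x + w) ≤ ∑' M : ℕ, (ENNReal.ofReal (1 + δ) * (Q ^ (M + 1)) G x +
        ENNReal.ofReal C₀ * (Q' ^ (M + 1)) G x) :=
        ENNReal.tsum_le_tsum fun M => hstep M G x hx
    _ = ENNReal.ofReal (1 + δ) * ∑' M : ℕ, (Q ^ (M + 1)) G x +
        ENNReal.ofReal C₀ * ∑' M : ℕ, (Q' ^ (M + 1)) G x := by
        rw [ENNReal.tsum_add, ENNReal.tsum_mul_left, ENNReal.tsum_mul_left]
    _ ≤ ENNReal.ofReal (1 + δ) * pot Q G x + ENNReal.ofReal C₀ * (ENNReal.ofReal C₁ * E y x) := by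
        gcongr
        · exact hle Q
        · exact (hle Q').trans (hpot y x)
    _ = _ := by
        congr 1
        simp only [hE]
        rw [← ENNReal.ofReal_mul hC₁0.le, ← ENNReal.ofReal_mul hC₀0.le, mul_assoc]

end Ratio
section Ratio

variable {d : ℕ} {μ : (Fin d → ℤ) → ℝ} {θ : ℝ} {m : Fin d → ℝ} {i₀ : Fin d}

theorem Dir.znorm_le {t : ℕ → ℝ} {y : ℕ → Fin d → ℤ} (hy : Dir m i₀ t y) :
    ∃ M : ℝ, 0 < M ∧ ∀ᶠ n in atTop, znorm (y n) ≤ M * t n := by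
  refine ⟨∑ j : Fin d, (|m j| + 1), ?_, ?_⟩
  · exact Finset.sum_pos (fun j _ => by positivity) ⟨i₀, Finset.mem_univ _⟩
  filter_upwards [hy.dir 1 one_pos, hy.t_top.eventually_ge_atTop 0] with n hn ht
  unfold znorm
  rw [Finset.sum_mul]
  refine Finset.sum_le_sum fun j _ => ?_
  have h1 := abs_sub_abs_le_abs_sub (y n j : ℝ) (t n * m j)
  rw [abs_mul, abs_of_nonneg ht] at h1
  have := hn j
  linarith

theorem Hyp.le_znorm_dir (h : Hyp μ θ m i₀) {t : ℕ → ℝ} {y : ℕ → Fin d → ℤ} (hy : Dir m i₀ t y) :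
    ∃ κ : ℝ, 0 < κ ∧ ∀ᶠ n in atTop, κ * t n ≤ znorm (y n) := by
  obtain ⟨j, hj⟩ := h.ex
  have hm := h.mpos j hj
  refine ⟨m j / 2, by positivity, ?_⟩
  filter_upwards [hy.dir (m j / 2) (by positivity)] with n hn
  have h1 := (abs_le.1 (hn j)).1
  have h2 := (le_abs_self (y n j : ℝ)).trans (abs_apply_le_znorm (y n) j)
  linarith

/-- The base point. -/
def base (d : ℕ) : Fin d → ℤ := fun _ => 1

theorem base_mem : base d ∈ posDom {i₀} := by
  rw [mem_posDom_singleton]; simp [base]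

theorem znorm_base : znorm (base d) = d := by simp [znorm, base]

theorem superharm_green (μ : (Fin d → ℤ) → ℝ) (A : Set (Fin d → ℤ)) (y : Fin d → ℤ) :
    ∀ x ∈ A, PA μ A (pot (PA μ A) (dl y)) x ≤ pot (PA μ A) (dl y) x :=
  fun x _ => pot_PA_le_self _ x

theorem Hyp.green_shift_eventually (h : Hyp μ θ m i₀) {t : ℕ → ℝ} {y : ℕ → Fin d → ℤ}
    (hy : Dir m i₀ t y) {w : Fin d → ℤ} (hw : w i₀ = 0) {δ : ℝ} (hδ : 0 < δ) :
    ∃ η > 0, ∀ᶠ n in atTop, ∀ x ∈ posDom {i₀}, znorm x ≤ η * t n →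
      pot (PA μ (posDom {i₀})) (dl (y n)) (x + w) ≤
        ENNReal.ofReal (Real.exp δ) * pot (PA μ (posDom {i₀})) (dl (y n)) x := by
  obtain ⟨C, s, hC, hs, H⟩ := h.green_shift_le hw (show 0 < δ / 2 by positivity)
  obtain ⟨c, hc, hH⟩ := h.harnack
  obtain ⟨κ, hκ, hyκ⟩ := h.le_znorm_dir hy
  set ε := s * κ / 4 with hε
  have hε0 : 0 < ε := by positivity
  set η := s * κ / (4 * (c + s)) with hη
  have hη0 : 0 < η := by positivity
  have hη1 : (c + s) * η = s * κ / 4 := by rw [hη]; field_simp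
  refine ⟨η, hη0, ?_⟩
  have hbig : ∀ᶠ n in atTop, Real.log (2 * C / δ) + c * d ≤ s * κ / 2 * t n :=
    (hy.t_top.const_mul_atTop (by positivity)).eventually_ge_atTop _
  filter_upwards [hyκ, hbig, h.green_lower hy hε0] with n hn hb hlow x hx hxt
  refine (H (y n) x hx).trans ?_
  set G := pot (PA μ (posDom {i₀})) (dl (y n)) with hG
  have h1 := hH G (superharm_green μ _ _) x hx (base d) base_mem
  have h2 : ENNReal.ofReal (Real.exp (-c * znorm (x - base d)) * Real.exp (-ε * t n)) ≤ G x := by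
    rw [ENNReal.ofReal_mul (by positivity)]
    exact le_trans (mul_le_mul_right hlow _) h1
  have h3 : C * Real.exp (-s * znorm (x - y n)) ≤
      δ / 2 * (Real.exp (-c * znorm (x - base d)) * Real.exp (-ε * t n)) := by
    have h4 : znorm (x - base d) ≤ η * t n + d := (znorm_sub_le _ _).trans (by rw [znorm_base]; linarith)
    have h5 : κ * t n - η * t n ≤ znorm (x - y n) := by
      have := znorm_le_add_sub (y n) x
      rw [znorm_sub_comm] at this
      linarith
    have h6 : C = δ / 2 * Real.exp (Real.log (2 * C / δ)) := by
      rw [Real.exp_log (by positivity)]; field_simp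
    rw [h6, mul_assoc, ← Real.exp_add, ← Real.exp_add]
    refine mul_le_mul_of_nonneg_left (Real.exp_le_exp.2 ?_) (by positivity)
    have h7 : c * znorm (x - base d) ≤ c * (η * t n + d) := by gcongr
    have h8 : s * (κ * t n - η * t n) ≤ s * znorm (x - y n) := by gcongr
    have h9 : (c * η + s * η) * t n = s * κ / 4 * t n := by rw [← hη1]; ring
    simp only [hε]
    nlinarith
  calc _ ≤ ENNReal.ofReal (1 + δ / 2) * G x + ENNReal.ofReal (δ / 2) * G x := by
        refine add_le_add le_rfl ((ENNReal.ofReal_le_ofReal h3).trans ?_)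
        rw [ENNReal.ofReal_mul (by positivity)]
        gcongr
    _ = ENNReal.ofReal (1 + δ) * G x := by
        rw [← add_mul, ← ENNReal.ofReal_add (by positivity) (by positivity)]
        congr 2; ring
    _ ≤ _ := by
        gcongr
        have := Real.add_one_le_exp δ
        linarith

theorem le_of_unit_steps {F : (Fin d → ℤ) → ℝ≥0∞} {δ R : ℝ}
    (hF : ∀ j, j ≠ i₀ → ∀ b : Bool, ∀ x ∈ posDom {i₀}, znorm x ≤ R →
      F (x + Pi.single j (if b then 1 else -1)) ≤ ENNReal.ofReal (Real.exp δ) * F x)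
    {x x' : Fin d → ℤ} (hx' : x' ∈ posDom {i₀}) (hxx' : x i₀ = x' i₀)
    (hR : znorm x' + znorm (x - x') ≤ R) :
    F x ≤ ENNReal.ofReal (Real.exp (δ * znorm (x - x'))) * F x' := by
  obtain ⟨n, hn⟩ : ∃ n : ℕ, ∑ j, (x j - x' j).natAbs = n := ⟨_, rfl⟩
  have hcast : ∀ x' : Fin d → ℤ, znorm (x - x') = ((∑ j, (x j - x' j).natAbs : ℕ) : ℝ) := by
    intro x'
    rw [znorm]
    push_cast
    refine Finset.sum_congr rfl fun j _ => ?_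
    rw [Nat.cast_natAbs]
    simp
  induction n generalizing x' with
  | zero =>
    have : x = x' := by
      funext j
      have := (Finset.sum_eq_zero_iff.1 hn) j (Finset.mem_univ j)
      omega
    subst this
    simp [znorm]
  | succ n ih =>
    obtain ⟨j, hj⟩ : ∃ j, x j ≠ x' j := by
      by_contra hcon
      push Not at hcon
      simp [hcon] at hn
    have hji : j ≠ i₀ := fun h => hj (h ▸ hxx')
    obtain ⟨b, hb⟩ : ∃ b : Bool, (x j - (x' j + if b then 1 else -1)).natAbs + 1 =
        (x j - x' j).natAbs := by
      rcases lt_or_gt_of_ne hj with hlt | hlt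
      · exact ⟨false, by simp; omega⟩
      · exact ⟨true, by simp; omega⟩
    set e : Fin d → ℤ := Pi.single j (if b then 1 else -1) with he
    have hej : e j = if b then 1 else -1 := by simp [he]
    have hei : e i₀ = 0 := by rw [he, Pi.single_eq_of_ne hji.symm]
    have hne : znorm e ≤ 1 := by
      rw [znorm, Finset.sum_eq_single j]
      · rw [hej]; split_ifs <;> simp
      · intro k _ hk
        rw [he, Pi.single_eq_of_ne hk]; simp
      · simp
    have hxe : x' + e ∈ posDom {i₀} := by
      rw [mem_posDom_singleton] at hx' ⊢
      rw [Pi.add_apply, hei, add_zero]; exact hx'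
    have hn' : ∑ k, (x k - (x' + e) k).natAbs = n := by
      rw [← Finset.add_sum_erase _ _ (Finset.mem_univ j)] at hn ⊢
      have : ∑ k ∈ Finset.univ.erase j, (x k - (x' + e) k).natAbs =
          ∑ k ∈ Finset.univ.erase j, (x k - x' k).natAbs := by
        refine Finset.sum_congr rfl fun k hk => ?_
        rw [Pi.add_apply, he, Pi.single_eq_of_ne (Finset.ne_of_mem_erase hk), add_zero]
      rw [this, Pi.add_apply, hej]
      omega
    have hz : znorm (x - x') = znorm (x - (x' + e)) + 1 := by
      rw [hcast, hcast, hn, hn']; push_cast; ring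
    have hzn := znorm_nonneg (x - (x' + e))
    have h1 := ih hxe (by rw [Pi.add_apply, hei, add_zero]; exact hxx')
      (by have := znorm_add_le x' e; linarith) hn'
    have h2 := hF j hji b x' hx' (by linarith)
    calc F x ≤ _ := h1
      _ ≤ ENNReal.ofReal (Real.exp (δ * znorm (x - (x' + e)))) *
          (ENNReal.ofReal (Real.exp δ) * F x') := by gcongr
      _ = _ := by
        rw [← mul_assoc, ← ENNReal.ofReal_mul (by positivity), ← Real.exp_add, hz]
        congr 3; ring

/-- The Green function varies subexponentially along the boundary. -/
theorem Hyp.green_lateral (h : Hyp μ θ m i₀) {t : ℕ → ℝ} {y : ℕ → Fin d → ℤ}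
    (hy : Dir m i₀ t y) {δ : ℝ} (hδ : 0 < δ) :
    ∃ η > 0, ∀ᶠ n in atTop, ∀ x' ∈ posDom {i₀}, ∀ x, x i₀ = x' i₀ →
      znorm x' + znorm (x - x') ≤ η * t n →
      pot (PA μ (posDom {i₀})) (dl (y n)) x ≤
        ENNReal.ofReal (Real.exp (δ * znorm (x - x'))) *
          pot (PA μ (posDom {i₀})) (dl (y n)) x' := by
  have H : ∀ p : {j : Fin d // j ≠ i₀} × Bool, ∃ η > 0, ∀ᶠ n in atTop, ∀ x ∈ posDom {i₀},
      znorm x ≤ η * t n →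
      pot (PA μ (posDom {i₀})) (dl (y n)) (x + Pi.single p.1.1 (if p.2 then 1 else -1)) ≤
        ENNReal.ofReal (Real.exp δ) * pot (PA μ (posDom {i₀})) (dl (y n)) x := fun p =>
    h.green_shift_eventually hy (by rw [Pi.single_eq_of_ne p.1.2.symm]) hδ
  choose η hη0 hη using H
  obtain ⟨j, hj⟩ := h.ex
  have : Nonempty ({j : Fin d // j ≠ i₀} × Bool) := ⟨⟨⟨j, hj⟩, true⟩⟩
  obtain ⟨p, -, hp⟩ := Finset.exists_min_image Finset.univ η Finset.univ_nonempty
  refine ⟨η p, hη0 p, ?_⟩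
  filter_upwards [eventually_all.2 hη, hy.t_top.eventually_ge_atTop 0] with n hn ht x' hx' x hxx' hR
  refine le_of_unit_steps (fun j hj b x hx hxR => ?_) hx' hxx' hR
  exact hn ⟨⟨j, hj⟩, b⟩ x hx (hxR.trans (by gcongr; exact hp _ (Finset.mem_univ _)))

theorem Hyp.exists_step (h : Hyp μ θ m i₀) : ∃ z, 0 < μ z ∧ z i₀ ≠ 0 := by
  by_contra hcon
  push Not at hcon
  have hb : base d + Pi.single i₀ 1 ∈ posDom {i₀} := by
    rw [mem_posDom_singleton]; simp [base]
  obtain ⟨k, c, h0, hk, -, hcp⟩ := h.irrH _ base_mem _ hb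
  have key : ∀ j ≤ k, c j i₀ = 1 := by
    intro j
    induction j with
    | zero => intro _; rw [h0]; rfl
    | succ j ih =>
      intro hj
      have := hcon _ (hcp j (by omega))
      have h2 := ih (by omega)
      simp only [Pi.sub_apply] at this
      omega
  have := key k le_rfl
  rw [hk] at this
  simp [base] at this

theorem Hyp.summable_exp (h : Hyp μ θ m i₀) {s : ℝ} (hs : |s| ≤ θ) :
    Summable fun z : Fin d → ℤ => μ z * Real.exp (s * z i₀) := by
  refine h.summable_of_le 1 fun z => ?_
  rw [abs_of_pos (Real.exp_pos _), one_mul]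
  refine Real.exp_le_exp.2 ((le_abs_self _).trans ?_)
  rw [abs_mul]
  exact mul_le_mul hs (abs_apply_le_znorm z i₀) (abs_nonneg _) h.θpos.le

theorem Hyp.one_lt_mgf (h : Hyp μ θ m i₀) {s : ℝ} (hs0 : s ≠ 0) (hs : |s| ≤ θ) :
    1 < ∑' z : Fin d → ℤ, μ z * Real.exp (s * z i₀) := by
  obtain ⟨z, hz, hz0⟩ := h.exists_step
  have h1 : HasSum (fun z : Fin d → ℤ => μ z + s * (μ z * z i₀)) 1 := by
    have := h.sum.add ((h.mean i₀).mul_left s)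
    rwa [h.m0, mul_zero, add_zero] at this
  rw [← h1.tsum_eq]
  refine h1.summable.tsum_lt_tsum (i := z) (fun z => ?_) ?_ (h.summable_exp hs)
  · have := Real.add_one_le_exp (s * z i₀)
    have := mul_le_mul_of_nonneg_left this (h.nn z)
    linarith
  · have : s * (z i₀ : ℝ) ≠ 0 := mul_ne_zero hs0 (by exact_mod_cast hz0)
    have := Real.add_one_lt_exp this
    have := mul_lt_mul_of_pos_left this hz
    linarith

/-- Minimum principle on an interval for a finite range kernel with an exponential
subharmonic function. -/
theorem growth_of_finite_range {ι : Type*} {B : Finset ι} {w : ι → ℝ} {ξ : ι → ℤ} {s : ℝ} {L U : ℤ}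
    (hs : 0 < s) (hw : ∀ z ∈ B, 0 ≤ w z) (hw1 : ∑ z ∈ B, w z ≤ 1)
    (hws : 1 < ∑ z ∈ B, w z * Real.exp (s * ξ z)) (hL : ∀ z ∈ B, ξ z ≤ L) (hL0 : 0 ≤ L)
    {f : ℤ → ℝ} (hf : ∀ u, 1 ≤ u → u ≤ U →
      ∑ z ∈ B with 0 < u + ξ z, w z * f (u + ξ z) ≤ f u)
    {κ : ℝ} (hκ : 0 < κ) (hU : ∀ u, U ≤ u → u ≤ U + L → κ * (Real.exp (s * u) - 1) ≤ f u)
    (h1U : 1 ≤ U) : κ * (Real.exp s - 1) ≤ f 1 := by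
  set g : ℤ → ℝ := fun u => f u - κ * (Real.exp (s * u) - 1) with hg
  suffices 0 ≤ g 1 by
    simp only [hg, Int.cast_one, mul_one] at this
    linarith
  obtain ⟨u, hu, hmin⟩ := Finset.exists_min_image (Finset.Icc 1 (U + L)) g
    ⟨1, Finset.mem_Icc.2 ⟨le_rfl, by omega⟩⟩
  rw [Finset.mem_Icc] at hu
  by_contra hneg
  push Not at hneg
  have hgu : g u < 0 := (hmin 1 (Finset.mem_Icc.2 ⟨le_rfl, by omega⟩)).trans_lt hneg
  have huU : u < U := by
    by_contra hc
    have := hU u (by omega) hu.2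
    simp only [hg] at hgu
    linarith
  have h1 := hf u hu.1 huU.le
  have h2 : ∑ z ∈ B with 0 < u + ξ z, w z * g u ≤ ∑ z ∈ B with 0 < u + ξ z, w z * g (u + ξ z) := by
    refine Finset.sum_le_sum fun z hz => ?_
    rw [Finset.mem_filter] at hz
    refine mul_le_mul_of_nonneg_left (hmin _ ?_) (hw z hz.1)
    have := hL z hz.1
    exact Finset.mem_Icc.2 ⟨by omega, by omega⟩
  have h3 : g u ≤ ∑ z ∈ B with 0 < u + ξ z, w z * g u := by
    rw [← Finset.sum_mul]
    have : ∑ z ∈ B with 0 < u + ξ z, w z ≤ 1 :=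
      (Finset.sum_le_sum_of_subset_of_nonneg (Finset.filter_subset _ _)
        fun z hz _ => hw z hz).trans hw1
    nlinarith
  have h4 : ∑ z ∈ B, w z * (Real.exp (s * ((u + ξ z : ℤ) : ℝ)) - 1) ≤
      ∑ z ∈ B with 0 < u + ξ z, w z * (Real.exp (s * ((u + ξ z : ℤ) : ℝ)) - 1) := by
    rw [← Finset.sum_filter_add_sum_filter_not B (fun z => 0 < u + ξ z)]
    refine add_le_of_nonpos_right (Finset.sum_nonpos fun z hz => ?_)
    rw [Finset.mem_filter] at hz
    refine mul_nonpos_of_nonneg_of_nonpos (hw z hz.1) ?_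
    rw [sub_nonpos, Real.exp_le_one_iff]
    have : ((u + ξ z : ℤ) : ℝ) ≤ 0 := by exact_mod_cast not_lt.1 hz.2
    nlinarith
  have h5 : Real.exp (s * u) - 1 < ∑ z ∈ B, w z * (Real.exp (s * ((u + ξ z : ℤ) : ℝ)) - 1) := by
    have : ∑ z ∈ B, w z * (Real.exp (s * ((u + ξ z : ℤ) : ℝ)) - 1) =
        Real.exp (s * u) * ∑ z ∈ B, w z * Real.exp (s * ξ z) - ∑ z ∈ B, w z := by
      rw [Finset.mul_sum, ← Finset.sum_sub_distrib]
      refine Finset.sum_congr rfl fun z _ => ?_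
      push_cast
      rw [mul_add, Real.exp_add]; ring
    rw [this]
    have := Real.exp_pos (s * u)
    nlinarith
  have h6 : ∑ z ∈ B with 0 < u + ξ z, w z * g (u + ξ z) =
      ∑ z ∈ B with 0 < u + ξ z, w z * f (u + ξ z) -
      κ * ∑ z ∈ B with 0 < u + ξ z, w z * (Real.exp (s * ((u + ξ z : ℤ) : ℝ)) - 1) := by
    rw [Finset.mul_sum, ← Finset.sum_sub_distrib]
    refine Finset.sum_congr rfl fun z _ => ?_
    simp only [hg]
    ring
  have h7 : g u = f u - κ * (Real.exp (s * u) - 1) := rfl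
  have h8 := mul_lt_mul_of_pos_left (h5.trans_le h4) hκ
  linarith

end Ratio
section Domination

variable {d : ℕ} {μ : (Fin d → ℤ) → ℝ} {θ : ℝ} {m : Fin d → ℝ} {i₀ : Fin d}

/-- The point of height `u` above the base point. -/
noncomputable def lift1 (i₀ : Fin d) (u : ℤ) : Fin d → ℤ := Function.update (base d) i₀ u

theorem lift1_apply (u : ℤ) : lift1 i₀ u i₀ = u := by simp [lift1]

theorem lift1_one : lift1 i₀ 1 = base d := by
  simp [lift1, base]

theorem lift1_mem {u : ℤ} (hu : 0 < u) : lift1 i₀ u ∈ posDom {i₀} := by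
  rw [mem_posDom_singleton, lift1_apply]; exact hu

theorem znorm_lift1_le (u : ℤ) : znorm (lift1 i₀ u) ≤ |(u : ℝ)| + d := by
  unfold znorm
  rw [← Finset.add_sum_erase _ _ (Finset.mem_univ i₀), lift1_apply]
  gcongr
  calc _ ≤ ∑ j ∈ Finset.univ.erase i₀, (1 : ℝ) := by
        refine Finset.sum_le_sum fun j hj => ?_
        simp [lift1, base, Finset.ne_of_mem_erase hj]
    _ ≤ ∑ j : Fin d, (1 : ℝ) :=
        Finset.sum_le_sum_of_subset_of_nonneg (Finset.erase_subset _ _) fun _ _ _ => zero_le_one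
    _ = d := by simp

theorem znorm_lift1_sub (u v : ℤ) : znorm (lift1 i₀ u - lift1 i₀ v) = |(u : ℝ) - v| := by
  unfold znorm
  rw [Finset.sum_eq_single i₀]
  · simp [lift1_apply]
  · intro j _ hj
    simp [lift1, hj]
  · simp

theorem znorm_sub_lift1_le (x : Fin d → ℤ) : znorm (x - lift1 i₀ (x i₀)) ≤ znorm x + d := by
  have hd : (d : ℝ) = ∑ _j : Fin d, (1 : ℝ) := by simp
  unfold znorm
  rw [hd, ← Finset.sum_add_distrib]
  refine Finset.sum_le_sum fun j _ => ?_
  by_cases hj : j = i₀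
  · subst hj; simp [lift1_apply]; positivity
  · simp only [Pi.sub_apply, lift1, base, Function.update_of_ne hj]
    have := abs_sub (x j : ℝ) 1
    simpa using this

/-- A finite part of the step distribution which still has a supercritical exponential moment. -/
theorem Hyp.exists_finite_part (h : Hyp μ θ m i₀) {s : ℝ} (hs : 0 < s) (hsθ : s ≤ θ) :
    ∃ (B : Finset (Fin d → ℤ)) (δ : ℝ), 0 < δ ∧
      1 < ∑ z ∈ B, μ z * Real.exp (-δ * znorm z) * Real.exp (s * z i₀) := by
  have h1 := h.one_lt_mgf hs.ne' (by rwa [abs_of_pos hs])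
  have h2 := (h.summable_exp (s := s) (by rwa [abs_of_pos hs])).hasSum
  obtain ⟨B, hB⟩ := (h2.eventually (lt_mem_nhds h1)).exists
  have hc : Continuous fun δ : ℝ =>
      ∑ z ∈ B, μ z * Real.exp (-δ * znorm z) * Real.exp (s * z i₀) := by fun_prop
  have h3 : ∀ᶠ δ in 𝓝[>] (0 : ℝ),
      1 < ∑ z ∈ B, μ z * Real.exp (-δ * znorm z) * Real.exp (s * z i₀) := by
    refine ((hc.tendsto 0).mono_left nhdsWithin_le_nhds).eventually (lt_mem_nhds ?_)
    simpa using hB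
  obtain ⟨δ, h4, h5⟩ := (h3.and self_mem_nhdsWithin).exists
  exact ⟨B, δ, h5, h4⟩

/-- Growth of a superharmonic function in the direction transverse to the boundary. -/
theorem Hyp.transverse_growth (h : Hyp μ θ m i₀) {s : ℝ} (hs : 0 < s) (hsθ : s ≤ θ) :
    ∃ δ C R₀ : ℝ, 0 < δ ∧ 0 < C ∧ ∀ (F : (Fin d → ℤ) → ℝ≥0∞) (R : ℝ),
      (∀ x ∈ posDom {i₀}, F x ≠ ⊤) → (∀ x ∈ posDom {i₀}, 0 < F x) →
      (∀ x ∈ posDom {i₀}, PA μ (posDom {i₀}) F x ≤ F x) →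
      (∀ x' ∈ posDom {i₀}, ∀ x, x i₀ = x' i₀ → znorm x' + znorm (x - x') ≤ R →
        F x ≤ ENNReal.ofReal (Real.exp (δ * znorm (x - x'))) * F x') →
      ∀ U : ℤ, 1 ≤ U → U + R₀ ≤ R →
        F (lift1 i₀ U) ≤ ENNReal.ofReal (C * Real.exp (s * U)) * F (base d) := by
  obtain ⟨B, δ, hδ, hB⟩ := h.exists_finite_part hs hsθ
  obtain ⟨c, hc, hH⟩ := h.harnack
  obtain ⟨L, hL0, hLB⟩ : ∃ L : ℕ, 0 ≤ L ∧ ∀ z ∈ B, znorm z ≤ L := by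
    refine ⟨⌈∑ z ∈ B, znorm z⌉₊, Nat.zero_le _, fun z hz => ?_⟩
    exact (Finset.single_le_sum (fun z _ => znorm_nonneg z) hz).trans (Nat.le_ceil _)
  have hes : 0 < Real.exp s - 1 := by have := Real.add_one_lt_exp hs.ne'; linarith
  refine ⟨δ, Real.exp (c * L) * Real.exp (s * L) / (Real.exp s - 1), d + 2 * L, hδ, by positivity,
    fun F R hFt hF0 hF hlat U hU hUR => ?_⟩
  set f : ℤ → ℝ := fun u => (F (lift1 i₀ u)).toReal with hf
  have hfU : 0 < f U := ENNReal.toReal_pos (hF0 _ (lift1_mem (by omega))).ne' (hFt _ (lift1_mem (by omega)))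
  have hexp : ∀ u : ℤ, 1 ≤ u → 0 < Real.exp (s * u) - 1 := by
    intro u hu
    have h1 : (1 : ℝ) ≤ u := by exact_mod_cast hu
    have := Real.add_one_lt_exp (x := s * u) (by positivity)
    have : 0 < s * u := by positivity
    linarith
  set κ : ℝ := Real.exp (-c * L) * f U / Real.exp (s * (U + L)) with hκ
  have key := growth_of_finite_range (B := B) (w := fun z => μ z * Real.exp (-δ * znorm z))
    (ξ := fun z => z i₀) (s := s) (L := L) (U := U) hs
    (fun z _ => mul_nonneg (h.nn z) (Real.exp_pos _).le) ?_ hB ?_ (by positivity) (f := f) ?_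
    (κ := κ) (by positivity) ?_ hU
  · have h1 : f U ≤ Real.exp (c * L) * Real.exp (s * L) / (Real.exp s - 1) * Real.exp (s * U) *
        f 1 := by
      have h2 : f U = κ * (Real.exp s - 1) *
          (Real.exp (c * L) * Real.exp (s * L) / (Real.exp s - 1) * Real.exp (s * U)) := by
        rw [hκ, neg_mul, Real.exp_neg, mul_add, Real.exp_add]
        field_simp
      rw [h2, mul_comm]
      gcongr
    simp only [hf, lift1_one] at h1
    rw [← ENNReal.ofReal_toReal (hFt _ (lift1_mem (show 0 < U by omega))),
      ← ENNReal.ofReal_toReal (hFt _ base_mem), ← ENNReal.ofReal_mul (by positivity)]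
    exact ENNReal.ofReal_le_ofReal h1
  · calc _ ≤ ∑ z ∈ B, μ z := by
          refine Finset.sum_le_sum fun z _ => mul_le_of_le_one_right (h.nn z) ?_
          rw [Real.exp_le_one_iff]
          have := znorm_nonneg z
          nlinarith
      _ ≤ 1 := sum_le_hasSum _ (fun z _ => h.nn z) h.sum
  · intro z hz
    have h1 := (le_abs_self (z i₀ : ℝ)).trans ((abs_apply_le_znorm z i₀).trans (hLB z hz))
    exact_mod_cast h1
  · intro u hu huU
    have hmem := lift1_mem (i₀ := i₀) (show 0 < u by omega)
    have hsup := hF _ hmem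
    rw [PA_apply hmem] at hsup
    have h1 : ∑ z ∈ B with 0 < u + z i₀, ENNReal.ofReal (μ z * Real.exp (-δ * znorm z)) *
        F (lift1 i₀ (u + z i₀)) ≤ F (lift1 i₀ u) := by
      refine le_trans ?_ hsup
      unfold Ex
      refine le_trans ?_ (ENNReal.sum_le_tsum (B.filter fun z => 0 < u + z i₀))
      refine Finset.sum_le_sum fun z hz => ?_
      rw [Finset.mem_filter] at hz
      have hzm : lift1 i₀ u + z ∈ posDom {i₀} := by
        rw [mem_posDom_singleton, Pi.add_apply, lift1_apply]; exact hz.2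
      simp only [if_pos hzm]
      rw [ENNReal.ofReal_mul (h.nn z), mul_assoc]
      gcongr
      have hd : znorm (lift1 i₀ (u + z i₀) - (lift1 i₀ u + z)) ≤ znorm z := by
        unfold znorm
        refine Finset.sum_le_sum fun j _ => ?_
        by_cases hj : j = i₀
        · subst hj; simp [lift1_apply]
        · simp [lift1, hj]
      have h2 := hlat _ hzm (lift1 i₀ (u + z i₀)) (by simp [lift1_apply]) (by
        have h3 := znorm_add_le (lift1 i₀ u) z
        have h4 := znorm_lift1_le (i₀ := i₀) u
        have h5 := hLB z hz.1
        rw [abs_of_nonneg (by exact_mod_cast (show (0 : ℤ) ≤ u by omega))] at h4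
        have h6 : (u : ℝ) ≤ U := by exact_mod_cast huU
        linarith)
      calc _ ≤ ENNReal.ofReal (Real.exp (-δ * znorm z)) *
            (ENNReal.ofReal (Real.exp (δ * znorm z)) * F (lift1 i₀ u + z)) := by
            gcongr
            refine h2.trans ?_
            gcongr
        _ = F (lift1 i₀ u + z) := by
            rw [← mul_assoc, ← ENNReal.ofReal_mul (by positivity), ← Real.exp_add]
            simp
    have h2 := ENNReal.toReal_mono (hFt _ hmem) h1
    rw [ENNReal.toReal_sum] at h2
    · refine le_trans (le_of_eq ?_) h2
      refine Finset.sum_congr rfl fun z _ => ?_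
      rw [ENNReal.toReal_mul, ENNReal.toReal_ofReal (mul_nonneg (h.nn z) (Real.exp_pos _).le)]
    · intro z hz
      rw [Finset.mem_filter] at hz
      exact ENNReal.mul_ne_top ENNReal.ofReal_ne_top (hFt _ (lift1_mem hz.2))
  · intro u hu huL
    have hmem := lift1_mem (i₀ := i₀) (show 0 < u by omega)
    have h1 := hH F hF _ hmem _ (lift1_mem (show 0 < U by omega))
    rw [znorm_lift1_sub] at h1
    have h2 := ENNReal.toReal_mono (hFt _ hmem) h1
    rw [ENNReal.toReal_mul, ENNReal.toReal_ofReal (Real.exp_pos _).le] at h2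
    have hu1 : (U : ℝ) ≤ u := by exact_mod_cast hu
    have hu2 : (u : ℝ) ≤ U + L := by exact_mod_cast huL
    have h3 : Real.exp (-c * L) * f U ≤ f u := by
      refine le_trans ?_ h2
      refine mul_le_mul_of_nonneg_right (Real.exp_le_exp.2 ?_) hfU.le
      rw [abs_of_nonneg (by linarith)]
      nlinarith
    refine le_trans ?_ h3
    rw [hκ, div_mul_eq_mul_div, div_le_iff₀ (Real.exp_pos _)]
    refine mul_le_mul_of_nonneg_left ?_ (by positivity)
    have : Real.exp (s * u) ≤ Real.exp (s * (U + L)) := by gcongr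
    linarith

theorem Hyp.green_pos (h : Hyp μ θ m i₀) {y : Fin d → ℤ} (hy : y ∈ posDom {i₀}) {x : Fin d → ℤ}
    (hx : x ∈ posDom {i₀}) : 0 < pot (PA μ (posDom {i₀})) (dl y) x := by
  obtain ⟨c, hc, hH⟩ := h.harnack
  refine lt_of_lt_of_le ?_ (hH _ (superharm_green μ _ y) x hx y hy)
  refine ENNReal.mul_pos (by simp [Real.exp_pos]) ?_
  exact (zero_lt_one.trans_le (one_le_pot_dl _ y)).ne'

theorem Hyp.green_ne_top (h : Hyp μ θ m i₀) (y : Fin d → ℤ) {x : Fin d → ℤ}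
    (hx : x ∈ posDom {i₀}) : pot (PA μ (posDom {i₀})) (dl y) x ≠ ⊤ := by
  obtain ⟨C, hC, H⟩ := h.green_le one_pos
  exact ne_top_of_le_ne_top ENNReal.ofReal_ne_top (H x hx y)

/-- Uniform subexponential bound for the normalized Green functions. -/
theorem Hyp.green_dominated (h : Hyp μ θ m i₀) {t : ℕ → ℝ} {y : ℕ → Fin d → ℤ}
    (hy : Dir m i₀ t y) {δ : ℝ} (hδ : 0 < δ) :
    ∃ C > 0, ∀ᶠ n in atTop, ∀ x ∈ posDom {i₀},
      pot (PA μ (posDom {i₀})) (dl (y n)) x ≤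
        ENNReal.ofReal (C * Real.exp (δ * znorm x)) *
          pot (PA μ (posDom {i₀})) (dl (y n)) (base d) := by
  have hθ := h.θpos
  set s := min (δ / 2) θ with hs
  have hs0 : 0 < s := by rw [hs]; positivity
  obtain ⟨δ₁, C₁, R₀, hδ₁, hC₁, hT⟩ := h.transverse_growth hs0 (min_le_right _ _)
  set δ₂ := min δ₁ (δ / 2) with hδ₂
  have hδ₂0 : 0 < δ₂ := by rw [hδ₂]; positivity
  obtain ⟨η, hη, hlat⟩ := h.green_lateral hy hδ₂0
  obtain ⟨M, hM, hyM⟩ := hy.znorm_le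
  set r := δ / (2 * (1 + 4 * M / η)) with hr
  have hr0 : 0 < r := by positivity
  have hr1 : r * (1 + 4 * M / η) = δ / 2 := by rw [hr]; field_simp
  obtain ⟨C₂, hC₂, hG⟩ := h.green_le hr0
  have hlow := h.green_lower hy (ε := δ * η / 8) (by positivity)
  refine ⟨C₁ * Real.exp (δ * d) + C₂, by positivity, ?_⟩
  filter_upwards [hlat, hyM, hlow, hy.t_top.eventually_ge_atTop 0,
    (hy.t_top.const_mul_atTop (show 0 < η / 4 by positivity)).eventually_ge_atTop (|R₀| + 2 * d)]
    with n hlat hyM hlow ht hbig x hx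
  set F := pot (PA μ (posDom {i₀})) (dl (y n)) with hF
  have hx0 := znorm_nonneg x
  by_cases hxs : znorm x ≤ η / 4 * t n
  · have hxi : 0 < x i₀ := mem_posDom_singleton.1 hx
    have hxi' : (1 : ℝ) ≤ x i₀ := by exact_mod_cast hxi
    have h0 := (le_abs_self (x i₀ : ℝ)).trans (abs_apply_le_znorm x i₀)
    have h1 := znorm_sub_lift1_le (i₀ := i₀) x
    have h2 := znorm_lift1_le (i₀ := i₀) (x i₀)
    rw [abs_of_nonneg (by linarith)] at h2
    have hR := abs_nonneg R₀
    have h3 := hlat _ (lift1_mem hxi) x (lift1_apply _).symm (by linarith)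
    have h4 := hT F (η * t n) (fun x hx => h.green_ne_top _ hx)
      (fun x hx => h.green_pos (hy.mem n) hx) (superharm_green μ _ _)
      (fun x' hx' x hxx' hR => (hlat x' hx' x hxx' hR).trans (by
        have := znorm_nonneg (x - x')
        gcongr; exact min_le_left _ _)) (x i₀) hxi (by have := le_abs_self R₀; linarith)
    calc F x ≤ _ := h3
      _ ≤ ENNReal.ofReal (Real.exp (δ₂ * znorm (x - lift1 i₀ (x i₀)))) *
          (ENNReal.ofReal (C₁ * Real.exp (s * (x i₀))) * F (base d)) := by gcongr
      _ ≤ _ := by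
        rw [← mul_assoc, ← ENNReal.ofReal_mul (by positivity)]
        refine mul_le_mul_left (ENNReal.ofReal_le_ofReal ?_) _
        have h5 : δ₂ * znorm (x - lift1 i₀ (x i₀)) ≤ δ / 2 * (znorm x + d) :=
          mul_le_mul (min_le_right _ _) h1 (znorm_nonneg _) (by positivity)
        have h6 : s * x i₀ ≤ δ / 2 * znorm x :=
          mul_le_mul (min_le_left _ _) h0 (by linarith) (by positivity)
        have hd0 : (0 : ℝ) ≤ d := by positivity
        calc _ ≤ Real.exp (δ / 2 * (znorm x + d)) * (C₁ * Real.exp (δ / 2 * znorm x)) := by gcongr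
          _ = C₁ * (Real.exp (δ / 2 * d) * Real.exp (δ * znorm x)) := by
            rw [mul_left_comm, ← Real.exp_add, ← Real.exp_add]
            congr 2; ring
          _ ≤ C₁ * (Real.exp (δ * d) * Real.exp (δ * znorm x)) := by
            gcongr
            linarith
          _ ≤ _ := by
            rw [← mul_assoc]
            gcongr
            linarith
  · push Not at hxs
    have h1 : F x ≤ ENNReal.ofReal (C₂ * Real.exp (δ / 2 * znorm x)) := by
      refine (hG x hx (y n)).trans (ENNReal.ofReal_le_ofReal ?_)
      refine mul_le_mul_of_nonneg_left (Real.exp_le_exp.2 ?_) hC₂.le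
      have h2 := znorm_sub_le x (y n)
      have h3 : M * t n ≤ 4 * M / η * znorm x := by
        have h4 : t n ≤ 4 / η * znorm x := by
          rw [div_mul_eq_mul_div, le_div_iff₀ hη]; linarith
        calc M * t n ≤ M * (4 / η * znorm x) := by gcongr
          _ = _ := by ring
      rw [← hr1]
      calc r * znorm (x - y n) ≤ r * (znorm x + 4 * M / η * znorm x) := by gcongr; linarith
        _ = _ := by ring
    have h2 : ENNReal.ofReal (Real.exp (-(δ / 2 * znorm x))) ≤ F (base d) := by
      refine le_trans (ENNReal.ofReal_le_ofReal (Real.exp_le_exp.2 ?_)) hlow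
      nlinarith
    calc F x ≤ _ := h1
      _ = ENNReal.ofReal (C₂ * Real.exp (δ * znorm x)) *
          ENNReal.ofReal (Real.exp (-(δ / 2 * znorm x))) := by
          rw [← ENNReal.ofReal_mul (by positivity), mul_assoc, ← Real.exp_add]
          congr 3; ring
      _ ≤ _ := by
          gcongr
          have : 0 < C₁ * Real.exp (δ * d) := by positivity
          linarith

end Domination
theorem ENNReal.tendsto_tsum_of_dominated {α β : Type*} {l : Filter α} {f : α → β → ℝ≥0∞}
    {g b : β → ℝ≥0∞} (hb : ∑' k, b k ≠ ⊤) (hf : ∀ k, Tendsto (fun n => f n k) l (𝓝 (g k)))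
    (hfb : ∀ᶠ n in l, ∀ k, f n k ≤ b k) :
    Tendsto (fun n => ∑' k, f n k) l (𝓝 (∑' k, g k)) := by
  rcases l.eq_or_neBot with rfl | hl
  · exact tendsto_bot
  have hbt : ∀ k, b k ≠ ⊤ := ENNReal.ne_top_of_tsum_ne_top hb
  have hgb : ∀ k, g k ≤ b k := fun k =>
    le_of_tendsto (hf k) (hfb.mono fun n hn => hn k)
  have hgt : ∀ k, g k ≠ ⊤ := fun k => ne_top_of_le_ne_top (hbt k) (hgb k)
  have hgs : ∑' k, g k ≠ ⊤ := ne_top_of_le_ne_top hb (ENNReal.tsum_le_tsum hgb)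
  have key : Tendsto (fun n => ∑' k, (f n k).toReal) l (𝓝 (∑' k, (g k).toReal)) := by
    refine tendsto_tsum_of_dominated_convergence (bound := fun k => (b k).toReal)
      (ENNReal.summable_toReal hb) (fun k => (ENNReal.tendsto_toReal (hgt k)).comp (hf k)) ?_
    filter_upwards [hfb] with n hn k
    rw [Real.norm_of_nonneg ENNReal.toReal_nonneg]
    exact ENNReal.toReal_mono (hbt k) (hn k)
  rw [← ENNReal.tsum_toReal_eq hgt] at key
  have key2 := ENNReal.tendsto_ofReal key
  rw [ENNReal.ofReal_toReal hgs] at key2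
  refine key2.congr' ?_
  filter_upwards [hfb] with n hn
  have hft : ∀ k, f n k ≠ ⊤ := fun k => ne_top_of_le_ne_top (hbt k) (hn k)
  rw [← ENNReal.tsum_toReal_eq hft, ENNReal.ofReal_toReal]
  exact ne_top_of_le_ne_top hb (ENNReal.tsum_le_tsum hn)

section Limit

variable {d : ℕ} {μ : (Fin d → ℤ) → ℝ} {θ : ℝ} {m : Fin d → ℝ} {i₀ : Fin d}

theorem Hyp.Ex_exp_znorm_ne_top (h : Hyp μ θ m i₀) (C : ℝ) (x : Fin d → ℤ) :
    Ex μ (fun u => ENNReal.ofReal (C * Real.exp (θ / 4 * znorm (x + u)))) ≠ ⊤ := by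
  have hθ := h.θpos
  have h1 : ∀ u, ENNReal.ofReal (C * Real.exp (θ / 4 * znorm (x + u))) ≤
      ENNReal.ofReal (|C| * Real.exp (θ / 4 * znorm x)) *
        ENNReal.ofReal (Real.exp (θ / 4 * znorm u)) := by
    intro u
    rw [← ENNReal.ofReal_mul (by positivity), mul_assoc, ← Real.exp_add]
    refine ENNReal.ofReal_le_ofReal ?_
    refine (mul_le_mul_of_nonneg_right (le_abs_self C) (Real.exp_pos _).le).trans ?_
    gcongr
    rw [← mul_add]
    gcongr
    exact znorm_add_le x u
  refine ne_top_of_le_ne_top ?_ (Ex_mono h1)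
  rw [Ex_const_mul]
  exact ENNReal.mul_ne_top ENNReal.ofReal_ne_top (ne_top_of_le_ne_top ENNReal.ofReal_ne_top
    (h.Ex_znorm_le (by positivity) le_rfl))

theorem Dir.eventually_ne (h : Hyp μ θ m i₀) {t : ℕ → ℝ} {y : ℕ → Fin d → ℤ} (hy : Dir m i₀ t y)
    (x : Fin d → ℤ) : ∀ᶠ n in atTop, x ≠ y n := by
  obtain ⟨κ, hκ, hyκ⟩ := h.le_znorm_dir hy
  filter_upwards [hyκ, (hy.t_top.const_mul_atTop hκ).eventually_gt_atTop (znorm x)] with n h1 h2 h3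
  rw [← h3] at h1
  linarith

/-- Limits of normalized Green functions only depend on the distance to the boundary. -/
theorem Hyp.exists_limit (h : Hyp μ θ m i₀) {t : ℕ → ℝ} {y : ℕ → Fin d → ℤ}
    (hy : Dir m i₀ t y) (l : Ultrafilter ℕ) (hl : (l : Filter ℕ) ≤ atTop) :
    ∃ f : ℤ → ℝ≥0∞, (∀ δ > 0, ∃ C : ℝ, 0 < C ∧ ∀ u : ℤ, 0 < u →
        f u ≤ ENNReal.ofReal (C * Real.exp (δ * u))) ∧
      (∀ x ∈ posDom {i₀}, PA μ (posDom {i₀}) (fun z => f (z i₀)) x = f (x i₀)) ∧ f 1 = 1 ∧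
      ∀ x ∈ posDom {i₀}, Tendsto (fun n => pot (PA μ (posDom {i₀})) (dl (y n)) x /
        pot (PA μ (posDom {i₀})) (dl (y n)) (base d)) l (𝓝 (f (x i₀))) := by
  have hθ := h.θpos
  set F : ℕ → (Fin d → ℤ) → ℝ≥0∞ := fun n => pot (PA μ (posDom {i₀})) (dl (y n)) with hF
  have hF0 : ∀ n, F n (base d) ≠ 0 := fun n => (h.green_pos (hy.mem n) base_mem).ne'
  have hFt : ∀ n, F n (base d) ≠ ⊤ := fun n => h.green_ne_top _ base_mem
  have hlim : ∀ x, ∃ a, Tendsto (fun n => F n x / F n (base d)) l (𝓝 a) := by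
    intro x
    obtain ⟨a, -, ha⟩ := isCompact_univ.ultrafilter_le_nhds
      (l.map fun n => F n x / F n (base d)) (by simp)
    exact ⟨a, ha⟩
  choose g hg using hlim
  have hdom : ∀ δ > 0, ∃ C : ℝ, 0 < C ∧ ∀ᶠ n in (l : Filter ℕ), ∀ x ∈ posDom {i₀},
      F n x / F n (base d) ≤ ENNReal.ofReal (C * Real.exp (δ * znorm x)) := by
    intro δ hδ
    obtain ⟨C, hC, H⟩ := h.green_dominated hy hδ
    refine ⟨C, hC, hl ?_⟩
    filter_upwards [H] with n hn x hx
    exact ENNReal.div_le_of_le_mul (hn x hx)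
  have hgdom : ∀ δ > 0, ∃ C : ℝ, 0 < C ∧ ∀ x ∈ posDom {i₀},
      g x ≤ ENNReal.ofReal (C * Real.exp (δ * znorm x)) := by
    intro δ hδ
    obtain ⟨C, hC, H⟩ := hdom δ hδ
    exact ⟨C, hC, fun x hx => le_of_tendsto (hg x) (H.mono fun n hn => hn x hx)⟩
  -- invariance along the boundary
  have hinv : ∀ x ∈ posDom {i₀}, ∀ w : Fin d → ℤ, w i₀ = 0 → g (x + w) ≤ g x := by
    intro x hx w hw
    have h1 : ∀ δ > 0, g (x + w) ≤ ENNReal.ofReal (Real.exp δ) * g x := by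
      intro δ hδ
      obtain ⟨η, hη, H⟩ := h.green_shift_eventually hy hw hδ
      have h2 : ∀ᶠ n in (l : Filter ℕ), F n (x + w) / F n (base d) ≤
          ENNReal.ofReal (Real.exp δ) * (F n x / F n (base d)) := by
        refine hl ?_
        filter_upwards [H, (hy.t_top.const_mul_atTop hη).eventually_ge_atTop (znorm x)] with n hn hx'
        rw [← mul_div_assoc]
        exact ENNReal.div_le_div_right (hn x hx hx') _
      exact le_of_tendsto_of_tendsto (hg _)
        (ENNReal.Tendsto.const_mul (hg x) (Or.inr ENNReal.ofReal_ne_top)) h2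
    have h2 : Tendsto (fun δ : ℝ => ENNReal.ofReal (Real.exp δ) * g x) (𝓝[>] 0) (𝓝 (1 * g x)) := by
      refine ENNReal.Tendsto.mul_const ?_ (Or.inl one_ne_zero)
      have h3 : Tendsto (fun δ : ℝ => ENNReal.ofReal (Real.exp δ)) (𝓝 0)
          (𝓝 (ENNReal.ofReal (Real.exp 0))) :=
        (ENNReal.continuous_ofReal.comp Real.continuous_exp).tendsto 0
      rw [Real.exp_zero, ENNReal.ofReal_one] at h3
      exact h3.mono_left nhdsWithin_le_nhds
    rw [one_mul] at h2
    refine ge_of_tendsto h2 ?_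
    filter_upwards [self_mem_nhdsWithin] with δ hδ using h1 δ hδ
  have hgl : ∀ x ∈ posDom {i₀}, g x = g (lift1 i₀ (x i₀)) := by
    intro x hx
    refine le_antisymm ?_ ?_
    · have := hinv _ (lift1_mem (mem_posDom_singleton.1 hx)) (x - lift1 i₀ (x i₀))
        (by simp [lift1_apply])
      simpa using this
    · have := hinv _ hx (lift1 i₀ (x i₀) - x) (by simp [lift1_apply])
      simpa using this
  refine ⟨fun u => g (lift1 i₀ u), fun δ hδ => ?_, fun x hx => ?_, ?_, fun x hx => ?_⟩
  · obtain ⟨C, hC, H⟩ := hgdom δ hδ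
    refine ⟨C * Real.exp (δ * d), by positivity, fun u hu => ?_⟩
    refine (H _ (lift1_mem hu)).trans (ENNReal.ofReal_le_ofReal ?_)
    rw [mul_assoc, ← Real.exp_add, ← mul_add]
    have := znorm_lift1_le (i₀ := i₀) u
    rw [abs_of_pos (by exact_mod_cast hu)] at this
    gcongr
    linarith
  · simp only
    rw [← hgl x hx, PA_congr (G := g) fun z hz => (hgl z hz).symm]
    obtain ⟨C, hC, H⟩ := hdom (θ / 4) (by positivity)
    have h1 : Tendsto (fun n => PA μ (posDom {i₀}) (fun z => F n z / F n (base d)) x) l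
        (𝓝 (PA μ (posDom {i₀}) g x)) := by
      simp only [PA_apply hx]
      unfold Ex
      refine ENNReal.tendsto_tsum_of_dominated (h.Ex_exp_znorm_ne_top C x) (fun u => ?_) ?_
      · refine ENNReal.Tendsto.const_mul ?_ (Or.inr ENNReal.ofReal_ne_top)
        simp only
        split_ifs
        · exact hg _
        · exact tendsto_const_nhds
      · filter_upwards [H] with n hn u
        gcongr
        split_ifs with hu
        · exact hn _ hu
        · exact zero_le
    refine tendsto_nhds_unique h1 ((hg x).congr' ?_)
    refine hl ?_
    filter_upwards [Dir.eventually_ne h hy x] with n hn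
    have h2 : F n x = PA μ (posDom {i₀}) (F n) x := by
      conv_lhs => rw [hF]; simp only; rw [(isKop_PA μ _).pot_eq]
      simp [dl, hn, hF]
    rw [h2, PA_apply hx, PA_apply hx, div_eq_mul_inv, mul_comm, ← Ex_const_mul]
    congr 1
    funext u
    split_ifs
    · rw [div_eq_mul_inv, mul_comm]
    · simp
  · simp only
    rw [lift1_one]
    refine tendsto_nhds_unique (hg _) (tendsto_const_nhds.congr fun n => ?_)
    exact (ENNReal.div_self (hF0 n) (hFt n)).symm
  · simp only
    rw [← hgl x hx]
    exact hg x

end Limit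

section
variable {d : ℕ} {μ : (Fin d → ℤ) → ℝ} {θ : ℝ} {m : Fin d → ℝ} {i₀ : Fin d}

theorem Hyp.summable (h : Hyp μ θ m i₀) : Summable μ := h.sum.summable

theorem Hyp.summable_indicator (h : Hyp μ θ m i₀) (s : (Fin d → ℤ) → Prop) [DecidablePred s] {f : (Fin d → ℤ) → ℝ}
    (hf : Summable fun z => μ z * f z) (hf0 : ∀ z, 0 ≤ f z) :
    Summable fun z => μ z * (if s z then f z else 0) := by
  refine Summable.of_nonneg_of_le (fun z => mul_nonneg (h.nn z) ?_) (fun z => ?_) hf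
  · split_ifs <;> simp [hf0]
  · refine mul_le_mul_of_nonneg_left ?_ (h.nn z)
    split_ifs <;> simp [hf0]

/-- Expected overshoot below `0` after one step from height `u`. -/
noncomputable def overshoot (μ : (Fin d → ℤ) → ℝ) (i₀ : Fin d) (u : ℤ) : ℝ≥0∞ :=
  Ex μ fun z => ENNReal.ofReal (-((u : ℝ) + z i₀))

theorem Hyp.overshoot_le (h : Hyp μ θ m i₀) {s : ℝ} (hs : 0 < s) (hs' : s ≤ θ) (u : ℤ) :
    overshoot μ i₀ u ≤
      ENNReal.ofReal ((∑' z, μ z * Real.exp (-s * z i₀)) / s * Real.exp (-s * u)) := by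
  have hS : Summable fun z : Fin d → ℤ => μ z * Real.exp (-s * z i₀) :=
    h.summable_exp (by rw [abs_neg, abs_of_pos hs]; exact hs')
  have : ∀ z : Fin d → ℤ, μ z * (Real.exp (-s * u) / s * Real.exp (-s * z i₀)) =
      (Real.exp (-s * u) / s) * (μ z * Real.exp (-s * z i₀)) := fun z => by ring
  calc overshoot μ i₀ u
      ≤ Ex μ (fun z => ENNReal.ofReal (Real.exp (-s * u) / s * Real.exp (-s * z i₀))) := by
        refine Ex_mono fun z => ENNReal.ofReal_le_ofReal ?_
        rw [div_mul_eq_mul_div, ← Real.exp_add, le_div_iff₀ hs]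
        have := Real.add_one_le_exp (-s * u + -s * z i₀)
        nlinarith
    _ = _ := by
        rw [Ex_ofReal h.nn (fun z => by positivity) (by simp_rw [this]; exact hS.mul_left _)]
        simp_rw [this]
        rw [tsum_mul_left]
        congr 1
        ring

theorem exists_scale (T p : ℕ → ℝ) (hT0 : ∀ u, 0 ≤ T u) (hp0 : ∀ u, 0 ≤ p u)
    (hpT : ∀ u, p u = 0 → T u = 0) (L : ℕ) :
    ∃ β : ℝ, 0 < β ∧ β ≤ 1 ∧ ∀ u ∈ Finset.range L, β * T u ≤ p u := by
  induction L with
  | zero => exact ⟨1, one_pos, le_rfl, by simp⟩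
  | succ L ih =>
    obtain ⟨β, h0, h1, h2⟩ := ih
    by_cases hp : p L = 0
    · refine ⟨β, h0, h1, fun u hu => ?_⟩
      rcases Finset.mem_range_succ_iff.1 hu |>.lt_or_eq with hu | rfl
      · exact h2 u (Finset.mem_range.2 hu)
      · rw [hpT _ hp, mul_zero]; exact hp0 _
    · have hp' : 0 < p L := lt_of_le_of_ne (hp0 _) (Ne.symm hp)
      have hT' : 0 < T L + 1 := by linarith [hT0 L]
      refine ⟨min β (p L / (T L + 1)), lt_min h0 (by positivity), (min_le_left _ _).trans h1,
        fun u hu => ?_⟩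
      rcases Finset.mem_range_succ_iff.1 hu |>.lt_or_eq with hu | rfl
      · exact (mul_le_mul_of_nonneg_right (min_le_left _ _) (hT0 _)).trans
          (h2 u (Finset.mem_range.2 hu))
      · refine (mul_le_mul_of_nonneg_right (min_le_right _ _) (hT0 _)).trans ?_
        rw [div_mul_eq_mul_div, div_le_iff₀ hT']
        nlinarith [hT0 u]

/-- Exponential moment of a jump that carries the walk from height `u` to `≤ 0`. -/
noncomputable def jumpExp (μ : (Fin d → ℤ) → ℝ) (i₀ : Fin d) (s : ℝ) (u : ℤ) : ℝ :=
  ∑' z, μ z * (if u + z i₀ ≤ 0 then Real.exp (-s * z i₀) else 0)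

theorem Hyp.summable_jumpExp (h : Hyp μ θ m i₀) {s : ℝ} (hs : 0 ≤ s) (hs' : s ≤ θ) (u : ℤ) :
    Summable fun z => μ z *
      (if u + z i₀ ≤ 0 then Real.exp (-s * z i₀) else 0) :=
  h.summable_indicator (fun z => u + z i₀ ≤ 0) (h.summable_exp (by rw [abs_neg, abs_of_nonneg hs]; exact hs'))
    fun _ => (Real.exp_pos _).le

theorem Hyp.jumpExp_nonneg (h : Hyp μ θ m i₀) (s : ℝ) (u : ℤ) : 0 ≤ jumpExp μ i₀ s u :=
  tsum_nonneg fun z => mul_nonneg (h.nn z) (by split_ifs <;> positivity)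

theorem Hyp.jumpExp_eq_zero (h : Hyp μ θ m i₀) {s : ℝ} {u : ℤ} (hu : jumpExp μ i₀ 0 u = 0) :
    jumpExp μ i₀ s u = 0 := by
  have h0 := (h.summable_jumpExp le_rfl h.θpos.le u).hasSum
  rw [← jumpExp, hu, hasSum_zero_iff_of_nonneg
    (fun z => mul_nonneg (h.nn z) (by split_ifs <;> positivity))] at h0
  refine (tsum_congr fun z => ?_).trans tsum_zero
  have h2 := congrFun h0 z
  simp only [Pi.zero_apply] at h2
  split_ifs at h2 ⊢ with hz
  · rw [neg_zero, zero_mul, Real.exp_zero, mul_one] at h2; rw [h2, zero_mul]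
  · simp

theorem Hyp.jumpExp_le (h : Hyp μ θ m i₀) {s : ℝ} (hs : 0 < s) (hs' : 2 * s ≤ θ) (u : ℤ) :
    jumpExp μ i₀ s u ≤ Real.exp (-s * u) * ∑' z, μ z * Real.exp (-(2 * s) * z i₀) := by
  have hS2 : Summable fun z : Fin d → ℤ => μ z * Real.exp (-(2 * s) * z i₀) :=
    h.summable_exp (by rw [abs_neg, abs_of_pos (by linarith)]; linarith)
  rw [← tsum_mul_left]
  refine Summable.tsum_le_tsum (fun z => ?_) (h.summable_jumpExp hs.le (by linarith) u)
    (hS2.mul_left _)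
  rw [mul_left_comm]
  refine mul_le_mul_of_nonneg_left ?_ (h.nn z)
  split_ifs with hz
  · rw [← Real.exp_add]
    refine Real.exp_le_exp.2 ?_
    have : (u : ℝ) + z i₀ ≤ 0 := by exact_mod_cast hz
    nlinarith
  · positivity

theorem Hyp.PA_barrier (h : Hyp μ θ m i₀) {s β : ℝ} (hs : 0 < s) (hs' : s ≤ θ) (hβ0 : 0 < β)
    (hβ1 : β ≤ 1) {x : Fin d → ℤ} (hx : x ∈ posDom {i₀}) :
    ∃ w : ℝ, 0 ≤ w ∧
      PA μ (posDom {i₀}) (fun z => ENNReal.ofReal (1 - β * Real.exp (-s * z i₀))) x =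
        ENNReal.ofReal w ∧
      w = 1 - β * Real.exp (-s * x i₀) * (∑' z, μ z * Real.exp (-s * z i₀)) +
        β * Real.exp (-s * x i₀) * jumpExp μ i₀ s (x i₀) - jumpExp μ i₀ 0 (x i₀) := by
  have hS : Summable fun z : Fin d → ℤ => μ z * Real.exp (-s * z i₀) :=
    h.summable_exp (by rw [abs_neg, abs_of_pos hs]; linarith)
  set u : ℤ := x i₀ with hu
  let f : (Fin d → ℤ) → ℝ := fun z =>
    if 0 < u + z i₀ then 1 - β * Real.exp (-s * (u + z i₀)) else 0
  have hf0 : ∀ z, 0 ≤ f z := by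
    intro z
    simp only [f]
    split_ifs with hz
    · have : Real.exp (-s * (u + z i₀)) ≤ 1 := Real.exp_le_one_iff.2 (by
        have : (0 : ℝ) < u + z i₀ := by exact_mod_cast hz
        nlinarith)
      nlinarith [Real.exp_pos (-s * (u + z i₀))]
    · exact le_rfl
  have hfe : ∀ z, μ z * f z = μ z - β * Real.exp (-s * u) * (μ z * Real.exp (-s * z i₀)) +
      β * Real.exp (-s * u) * (μ z *
        (if u + z i₀ ≤ 0 then Real.exp (-s * z i₀) else 0)) -
      μ z * (if u + z i₀ ≤ 0 then Real.exp (-0 * z i₀) else 0) := by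
    intro z
    simp only [f, neg_zero, zero_mul, Real.exp_zero]
    by_cases hz : 0 < u + z i₀
    · rw [if_pos hz, if_neg (by omega), if_neg (by omega), mul_add, Real.exp_add]; ring
    · rw [if_neg hz, if_pos (by omega), if_pos (by omega)]; ring
  have hsum : HasSum (fun z => μ z * f z) (1 - β * Real.exp (-s * u) *
      (∑' z, μ z * Real.exp (-s * z i₀)) + β * Real.exp (-s * u) * jumpExp μ i₀ s u
      - jumpExp μ i₀ 0 u) := by
    simp_rw [hfe]
    exact (((h.sum.sub (hS.hasSum.mul_left _)).add
      ((h.summable_jumpExp hs.le hs' u).hasSum.mul_left _))).sub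
      (h.summable_jumpExp le_rfl h.θpos.le u).hasSum
  have hfx : (fun z => if x + z ∈ posDom {i₀} then
      ENNReal.ofReal (1 - β * Real.exp (-s * (x + z) i₀)) else 0)
      = fun z => ENNReal.ofReal (f z) := by
    funext z
    simp only [f, mem_posDom_singleton, Pi.add_apply, ← hu, Int.cast_add]
    split_ifs <;> simp
  refine ⟨_, tsum_nonneg fun z => mul_nonneg (h.nn z) (hf0 z), ?_, hsum.tsum_eq⟩
  rw [PA_apply hx, hfx, Ex_ofReal h.nn hf0 hsum.summable]

theorem Hyp.exists_barrier (h : Hyp μ θ m i₀) {s : ℝ} (hs : 0 < s) (hs' : 2 * s ≤ θ) :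
    ∃ β c : ℝ, 0 < β ∧ β ≤ 1 ∧ 0 < c ∧ ∀ x ∈ posDom {i₀},
      PA μ (posDom {i₀}) (fun z => ENNReal.ofReal (1 - β * Real.exp (-s * z i₀))) x +
        ENNReal.ofReal (c * Real.exp (-s * x i₀)) ≤
      ENNReal.ofReal (1 - β * Real.exp (-s * x i₀)) := by
  have hφ := h.one_lt_mgf (s := -s) (by linarith) (by rw [abs_neg, abs_of_pos hs]; linarith)
  set φ := ∑' z : Fin d → ℤ, μ z * Real.exp (-s * z i₀) with hφd
  have htend : Tendsto (fun n : ℕ => Real.exp (-s * (n : ℝ)) *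
      ∑' z, μ z * Real.exp (-(2 * s) * z i₀)) atTop (𝓝 0) := by
    have : Tendsto (fun n : ℕ => Real.exp (-s * (n : ℝ))) atTop (𝓝 0) := by
      refine Real.tendsto_exp_atBot.comp ?_
      exact (tendsto_natCast_atTop_atTop).const_mul_atTop_of_neg (by linarith)
    simpa using this.mul_const _
  obtain ⟨L, hL⟩ := eventually_atTop.1
    (htend.eventually (gt_mem_nhds (show (0 : ℝ) < (φ - 1) / 2 by linarith)))
  obtain ⟨β, hβ0, hβ1, hβ⟩ := exists_scale (fun u => jumpExp μ i₀ s u) (fun u => jumpExp μ i₀ 0 u)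
    (fun u => h.jumpExp_nonneg s u) (fun u => h.jumpExp_nonneg 0 u)
    (fun u hu => h.jumpExp_eq_zero hu) L
  refine ⟨β, β * ((φ - 1) / 2), hβ0, hβ1, mul_pos hβ0 (by linarith), fun x hx => ?_⟩
  obtain ⟨w, hw0, hw, hwe⟩ := h.PA_barrier hs (by linarith) hβ0 hβ1 hx
  have hx' : 0 < x i₀ := mem_posDom_singleton.1 hx
  set u : ℤ := x i₀ with hu
  have hE : Real.exp (-s * u) ≤ 1 := Real.exp_le_one_iff.2 (by
    have : (0 : ℝ) < u := by exact_mod_cast hx'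
    nlinarith)
  have hEp := Real.exp_pos (-s * u)
  have hg : 0 ≤ β * ((φ - 1) / 2) * Real.exp (-s * u) :=
    mul_nonneg (mul_nonneg hβ0.le (by linarith)) hEp.le
  rw [hw, ← ENNReal.ofReal_add hw0 hg]
  refine ENNReal.ofReal_le_ofReal ?_
  have hT0 := h.jumpExp_nonneg s u
  have hp0 := h.jumpExp_nonneg 0 u
  have hgain : β * Real.exp (-s * u) * jumpExp μ i₀ s u ≤
      jumpExp μ i₀ 0 u + β * ((φ - 1) / 2) * Real.exp (-s * u) := by
    by_cases huL : u < L
    · have h1 := hβ u.toNat (by simp; omega)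
      rw [Int.toNat_of_nonneg hx'.le] at h1
      have h2 : β * Real.exp (-s * u) * jumpExp μ i₀ s u ≤ β * jumpExp μ i₀ s u := by
        nlinarith [mul_nonneg hβ0.le hT0]
      linarith
    · have h1 := hL u.toNat (by omega)
      have h2 : (u.toNat : ℝ) = u := by exact_mod_cast Int.toNat_of_nonneg hx'.le
      rw [h2] at h1
      have h3 : jumpExp μ i₀ s u ≤ (φ - 1) / 2 := (h.jumpExp_le hs hs' u).trans h1.le
      have := mul_le_mul_of_nonneg_left h3 (mul_nonneg hβ0.le hEp.le)
      linarith
  rw [hwe]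
  linarith

theorem Hyp.pot_overshoot_le (h : Hyp μ θ m i₀) : ∃ K : ℝ, 0 < K ∧ ∀ x ∈ posDom {i₀},
    pot (PA μ (posDom {i₀})) (fun z => overshoot μ i₀ (z i₀)) x ≤ ENNReal.ofReal K := by
  have hs : 0 < θ / 2 := by linarith [h.θpos]
  obtain ⟨β, c, hβ0, hβ1, hc, hb⟩ := h.exists_barrier hs (by linarith)
  have hφ := h.one_lt_mgf (s := -(θ / 2)) (by linarith) (by
    rw [abs_neg, abs_of_pos hs]; linarith)
  set a := (∑' z : Fin d → ℤ, μ z * Real.exp (-(θ / 2) * z i₀)) / (θ / 2) with ha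
  have ha0 : 0 < a := div_pos (by linarith) hs
  refine ⟨a / c, by positivity, fun x hx => ?_⟩
  have hpot := pot_PA_le hb x hx
  calc pot (PA μ (posDom {i₀})) (fun z => overshoot μ i₀ (z i₀)) x
      ≤ pot (PA μ (posDom {i₀})) (ENNReal.ofReal (a / c) • fun z : Fin d → ℤ =>
          ENNReal.ofReal (c * Real.exp (-(θ / 2) * z i₀))) x := by
        refine (isKop_PA _ _).pot_mono (fun z => ?_) x
        refine (h.overshoot_le hs (by linarith) _).trans (le_of_eq ?_)
        rw [Pi.smul_apply, smul_eq_mul, ← ENNReal.ofReal_mul (by positivity)]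
        congr 1
        rw [← ha, ← mul_assoc, div_mul_cancel₀ _ hc.ne']
    _ ≤ ENNReal.ofReal (a / c) * ENNReal.ofReal 1 := by
        rw [pot_smul]
        refine mul_le_mul_right (hpot.trans (ENNReal.ofReal_le_ofReal ?_)) _
        nlinarith [Real.exp_pos (-(θ / 2) * x i₀)]
    _ = ENNReal.ofReal (a / c) := by simp

/-- `F` depends only on the coordinate `i₀`. -/
def Dep (i₀ : Fin d) (F : (Fin d → ℤ) → ℝ≥0∞) : Prop := ∀ x y, x i₀ = y i₀ → F x = F y

theorem Dep.PA {F : (Fin d → ℤ) → ℝ≥0∞} (hF : Dep i₀ F) : Dep i₀ (PA μ (posDom {i₀}) F) := by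
  intro x y hxy
  by_cases hx : x ∈ posDom {i₀}
  · have hy : y ∈ posDom {i₀} := by
      rw [mem_posDom_singleton] at hx ⊢; omega
    rw [PA_apply hx, PA_apply hy]
    congr 1
    funext z
    simp only [mem_posDom_singleton, Pi.add_apply, hxy]
    rw [hF (x + z) (y + z) (by simp [hxy])]
  · have hy : y ∉ posDom {i₀} := by
      rw [mem_posDom_singleton] at hx ⊢; omega
    rw [PA_apply_of_notMem hx, PA_apply_of_notMem hy]

theorem Dep.pot_PA {F : (Fin d → ℤ) → ℝ≥0∞} (hF : Dep i₀ F) :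
    Dep i₀ (pot (_root_.PA μ (posDom {i₀})) F) := by
  have : ∀ n : ℕ, Dep i₀ ((_root_.PA μ (posDom {i₀}) ^ n) F) := by
    intro n
    induction n with
    | zero => simpa using hF
    | succ n ih => rw [pow_succ_apply']; exact ih.PA
  exact fun x y hxy => tsum_congr fun n => this n x y hxy

/-- The potential of the overshoot of the walk killed outside the half-space. -/
noncomputable def renewCorr (μ : (Fin d → ℤ) → ℝ) (i₀ : Fin d) : (Fin d → ℤ) → ℝ≥0∞ :=
  pot (PA μ (posDom {i₀})) (fun z => overshoot μ i₀ (z i₀))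

/-- The positive harmonic function of the walk killed outside the half-space, as a function of
the height. -/
noncomputable def renew (μ : (Fin d → ℤ) → ℝ) (i₀ : Fin d) (u : ℤ) : ℝ≥0∞ :=
  ENNReal.ofReal u + renewCorr μ i₀ (lift1 i₀ u)

theorem renew_apply (x : Fin d → ℤ) :
    renew μ i₀ (x i₀) = ENNReal.ofReal (x i₀) + renewCorr μ i₀ x := by
  rw [renew]
  congr 1
  refine Dep.pot_PA (fun x y hxy => by simp only [hxy]) _ _ ?_
  simp [lift1_apply]

theorem Hyp.PA_height (h : Hyp μ θ m i₀) {x : Fin d → ℤ} (hx : x ∈ posDom {i₀}) :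
    PA μ (posDom {i₀}) (fun z => ENNReal.ofReal (z i₀)) x =
      ENNReal.ofReal (x i₀) + overshoot μ i₀ (x i₀) := by
  have hx' : (0 : ℝ) < x i₀ := by exact_mod_cast mem_posDom_singleton.1 hx
  have hm := h.mean i₀
  rw [h.m0] at hm
  have hab : Summable fun z : Fin d → ℤ => μ z * |(z i₀ : ℝ)| := by
    refine hm.summable.abs.congr fun z => ?_
    rw [abs_mul, abs_of_nonneg (h.nn z)]
  set u : ℝ := ((x i₀ : ℤ) : ℝ) with hu
  have hp : Summable fun z : Fin d → ℤ => μ z * max (u + z i₀) 0 := by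
    refine Summable.of_nonneg_of_le (fun z => mul_nonneg (h.nn z) (le_max_right _ _)) (fun z => ?_)
      ((h.summable.mul_left u).add hab)
    rw [mul_comm u, ← mul_add]
    refine mul_le_mul_of_nonneg_left (max_le ?_ (by positivity)) (h.nn z)
    linarith [le_abs_self (z i₀ : ℝ)]
  have hn : Summable fun z : Fin d → ℤ => μ z * max (-(u + z i₀)) 0 := by
    refine Summable.of_nonneg_of_le (fun z => mul_nonneg (h.nn z) (le_max_right _ _)) (fun z => ?_) hab
    refine mul_le_mul_of_nonneg_left (max_le ?_ (by positivity)) (h.nn z)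
    linarith [neg_abs_le (z i₀ : ℝ)]
  have e : ∑' z : Fin d → ℤ, μ z * max (u + z i₀) 0 =
      u + ∑' z : Fin d → ℤ, μ z * max (-(u + z i₀)) 0 := by
    have h1 : HasSum (fun z : Fin d → ℤ => u * μ z + μ z * z i₀) (u * 1 + 0) :=
      (h.sum.mul_left u).add hm
    have h2 := h1.add hn.hasSum
    rw [mul_one, add_zero] at h2
    rw [← h2.tsum_eq]
    refine tsum_congr fun z => ?_
    rcases le_total 0 (u + (z i₀ : ℝ)) with h0 | h0
    · rw [max_eq_left h0, max_eq_right (by linarith)]; ring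
    · rw [max_eq_right h0, max_eq_left (by linarith)]; ring
  have e1 : overshoot μ i₀ (x i₀) = ENNReal.ofReal (∑' z : Fin d → ℤ, μ z * max (-(u + z i₀)) 0) := by
    rw [← Ex_ofReal h.nn (fun z => le_max_right _ _) hn, overshoot]
    congr 1
    funext z
    rw [ENNReal.ofReal_max, ENNReal.ofReal_zero, max_eq_left zero_le]
  rw [PA_apply hx, e1, ← ENNReal.ofReal_add hx'.le
    (tsum_nonneg fun z => mul_nonneg (h.nn z) (le_max_right _ _)), ← e,
    ← Ex_ofReal h.nn (fun z => le_max_right _ _) hp]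
  congr 1
  funext z
  simp only [mem_posDom_singleton, Pi.add_apply, Int.cast_add]
  split_ifs with hz
  · rw [max_eq_left]
    rw [hu]
    exact_mod_cast hz.le
  · rw [max_eq_right, ENNReal.ofReal_zero]
    have : x i₀ + z i₀ ≤ 0 := by omega
    rw [hu]
    exact_mod_cast this

theorem Hyp.PA_renew (h : Hyp μ θ m i₀) {x : Fin d → ℤ} (hx : x ∈ posDom {i₀}) :
    PA μ (posDom {i₀}) (fun z => renew μ i₀ (z i₀)) x = renew μ i₀ (x i₀) := by
  have e : (fun z : Fin d → ℤ => renew μ i₀ (z i₀)) =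
      (fun z : Fin d → ℤ => ENNReal.ofReal (z i₀)) + renewCorr μ i₀ :=
    funext fun z => renew_apply z
  rw [e, map_add, Pi.add_apply, h.PA_height hx, renew_apply, add_assoc]
  congr 1
  conv_rhs => rw [renewCorr, (isKop_PA _ _).pot_eq]
  rfl

theorem Hyp.renew_le (h : Hyp μ θ m i₀) : ∃ C : ℝ, 1 ≤ C ∧ ∀ u : ℤ, 0 < u →
    renew μ i₀ u ≤ ENNReal.ofReal (C * u) := by
  obtain ⟨K, hK, hb⟩ := h.pot_overshoot_le
  refine ⟨1 + K, by linarith, fun u hu => ?_⟩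
  have h1 : (1 : ℝ) ≤ u := by exact_mod_cast hu
  rw [renew, add_mul, one_mul, ENNReal.ofReal_add (by positivity) (by positivity)]
  refine add_le_add le_rfl ((hb _ (lift1_mem hu)).trans (ENNReal.ofReal_le_ofReal ?_))
  nlinarith

theorem le_renew (u : ℤ) : ENNReal.ofReal u ≤ renew μ i₀ u := le_self_add

end

section
variable {d : ℕ} {μ : (Fin d → ℤ) → ℝ} {θ : ℝ} {m : Fin d → ℝ} {i₀ : Fin d}

/-- Nonnegative functions of the height that are harmonic for the walk killed outside the
half-space. -/
structure HeightHarm (μ : (Fin d → ℤ) → ℝ) (i₀ : Fin d) (a : ℤ → ℝ) : Prop where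
  nonneg : ∀ u > 0, 0 ≤ a u
  harm : ∀ u > 0, HasSum (fun z : Fin d → ℤ => μ z * (if 0 < u + z i₀ then a (u + z i₀) else 0)) (a u)

theorem HeightHarm.PA (h : Hyp μ θ m i₀) {a : ℤ → ℝ} (ha : HeightHarm μ i₀ a) {x : Fin d → ℤ}
    (hx : x ∈ posDom {i₀}) :
    PA μ (posDom {i₀}) (fun z => ENNReal.ofReal (a (z i₀))) x = ENNReal.ofReal (a (x i₀)) := by
  have hs := ha.harm _ (mem_posDom_singleton.1 hx)
  rw [PA_apply hx, ← hs.tsum_eq, ← Ex_ofReal h.nn (fun z => ?_) hs.summable]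
  · congr 1
    funext z
    simp only [mem_posDom_singleton, Pi.add_apply]
    split_ifs <;> simp
  · split_ifs with hz
    · exact ha.nonneg _ hz
    · exact le_rfl

theorem Hyp.heightHarm_toReal (h : Hyp μ θ m i₀) {f : ℤ → ℝ≥0∞} (hf : ∀ u > 0, f u ≠ ⊤)
    (hP : ∀ x ∈ posDom {i₀}, PA μ (posDom {i₀}) (fun z => f (z i₀)) x = f (x i₀)) :
    HeightHarm μ i₀ fun u => (f u).toReal := by
  refine ⟨fun u _ => ENNReal.toReal_nonneg, fun u hu => ?_⟩
  have h1 := hP _ (lift1_mem hu)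
  rw [PA_apply (lift1_mem hu), lift1_apply, Ex] at h1
  have h2 : ∀ z : Fin d → ℤ, (ENNReal.ofReal (μ z) *
      (if lift1 i₀ u + z ∈ posDom {i₀} then f ((lift1 i₀ u + z) i₀) else 0)).toReal =
      μ z * (if 0 < u + z i₀ then (f (u + z i₀)).toReal else 0) := by
    intro z
    simp only [mem_posDom_singleton, Pi.add_apply, lift1_apply]
    rw [ENNReal.toReal_mul, ENNReal.toReal_ofReal (h.nn z)]
    split_ifs <;> simp
  have hfin : ∑' z : Fin d → ℤ, ENNReal.ofReal (μ z) *
      (if lift1 i₀ u + z ∈ posDom {i₀} then f ((lift1 i₀ u + z) i₀) else 0) ≠ ⊤ := by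
    rw [h1]; exact hf u hu
  have h3 := (ENNReal.summable_toReal hfin).hasSum
  rw [← ENNReal.tsum_toReal_eq (ENNReal.ne_top_of_tsum_ne_top hfin), h1] at h3
  simp_rw [h2] at h3
  exact h3

theorem Hyp.heightHarm_harnack (h : Hyp μ θ m i₀) : ∃ c : ℝ, 0 < c ∧ ∀ a, HeightHarm μ i₀ a →
    ∀ u v : ℤ, 0 < u → 0 < v → Real.exp (-c * |(u : ℝ) - v|) * a v ≤ a u := by
  obtain ⟨c, hc, H⟩ := h.harnack
  refine ⟨c, hc, fun a ha u v hu hv => ?_⟩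
  have h1 := H _ (fun x hx => (ha.PA h hx).le) _ (lift1_mem hu) _ (lift1_mem hv)
  rw [znorm_lift1_sub, lift1_apply, lift1_apply, ← ENNReal.ofReal_mul (Real.exp_pos _).le] at h1
  exact (ENNReal.ofReal_le_ofReal_iff (ha.nonneg u hu)).1 h1

theorem Hyp.heightHarm_growth (h : Hyp μ θ m i₀) {s : ℝ} (hs : 0 < s) (hsθ : s ≤ θ) :
    ∃ K : ℝ, 0 < K ∧ ∀ a, HeightHarm μ i₀ a → (∀ u > 0, 0 < a u) → ∀ N u : ℤ, 0 < N → N ≤ u →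
      a u ≤ K * Real.exp (s * (u - N)) * a N := by
  obtain ⟨δ, C, R₀, hδ, hC, H⟩ := h.transverse_growth hs hsθ
  refine ⟨C * Real.exp s, by positivity, fun a ha hpos N u hN hu => ?_⟩
  have h1 := H (fun x => ENNReal.ofReal (a (x i₀ + (N - 1)))) (((u - N + 1 : ℤ) : ℝ) + R₀)
    (fun x hx => ENNReal.ofReal_ne_top)
    (fun x hx => ENNReal.ofReal_pos.2 (hpos _ (by
      have := mem_posDom_singleton.1 hx; omega)))
    (fun x hx => ?_) (fun x' hx' x hx hR => ?_) (u - N + 1) (by omega) le_rfl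
  · rw [lift1_apply, ← lift1_one (i₀ := i₀), lift1_apply,
      ← ENNReal.ofReal_mul (by positivity)] at h1
    have hN' := hpos N hN
    rw [show u - N + 1 + (N - 1) = u by ring, show 1 + (N - 1) = N by ring] at h1
    have h2 := (ENNReal.ofReal_le_ofReal_iff (by positivity)).1 h1
    refine h2.trans (le_of_eq ?_)
    rw [mul_assoc C (Real.exp s), ← Real.exp_add]
    congr 3
    push_cast
    ring
  · have hx' := mem_posDom_singleton.1 hx
    have hxN : (lift1 i₀ (x i₀ + (N - 1)) : Fin d → ℤ) ∈ posDom {i₀} := lift1_mem (by omega)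
    have h2 := ha.PA h hxN
    rw [lift1_apply, PA_apply hxN] at h2
    rw [← h2, PA_apply hx]
    refine Ex_mono fun z => ?_
    simp only [mem_posDom_singleton, Pi.add_apply, lift1_apply]
    by_cases hz : 0 < x i₀ + z i₀
    · rw [if_pos hz, if_pos (by omega)]
      refine le_of_eq ?_
      congr 2
      ring
    · rw [if_neg hz]; exact zero_le
  · simp only [hx]
    have : (1 : ℝ≥0∞) ≤ ENNReal.ofReal (Real.exp (δ * znorm (x - x'))) := by
      rw [ENNReal.one_le_ofReal]
      exact Real.one_le_exp (mul_nonneg hδ.le (znorm_nonneg _))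
    simpa using mul_le_mul_left this (ENNReal.ofReal (a (x' i₀ + (N - 1))))

/-- Comparison of a harmonic function of the height with a barrier up to height `N - L`. -/
theorem Hyp.heightHarm_barrier (h : Hyp μ θ m i₀) {s : ℝ} (hs : 0 < s) (hsθ : 2 * s ≤ θ) {L : ℕ}
    (hL : 2 * (Real.exp (-s * L) * ∑' z : Fin d → ℤ, μ z * Real.exp (2 * s * z i₀)) <
      (∑' z : Fin d → ℤ, μ z * Real.exp (s * z i₀)) - 1)
    {a U : ℤ → ℝ} (ha : HeightHarm μ i₀ a) (hU : HeightHarm μ i₀ U) (hUle : ∀ u : ℤ, 0 < u → (u : ℝ) ≤ U u)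
    {K K' : ℝ} (hK : 0 < K) (hK' : 0 < K') {N : ℤ} (hN1 : L < N) (hN2 : 2 * L ≤ N)
    (h1 : ∀ u, N < u → a u ≤ K * Real.exp (s * (u - N)))
    (h2 : ∀ u, N - L < u → u ≤ N → a u ≤ K') :
    a 1 ≤ 2 * (K + K') * U 1 / N := by
  have hφs : Summable fun z : Fin d → ℤ => μ z * Real.exp (s * z i₀) :=
    h.summable_exp (by rw [abs_of_pos hs]; linarith)
  have hφ2s : Summable fun z : Fin d → ℤ => μ z * Real.exp (2 * s * z i₀) :=
    h.summable_exp (by rw [abs_of_pos (by linarith)]; linarith)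
  set φ := ∑' z : Fin d → ℤ, μ z * Real.exp (s * z i₀)
  set φ2 := ∑' z : Fin d → ℤ, μ z * Real.exp (2 * s * z i₀)
  have hN0 : (0 : ℝ) < N := by exact_mod_cast (show (0 : ℤ) < N by omega)
  set A := 2 * (K + K') with hA
  let G : ℤ → ℝ := fun u => A / N * U u - K * Real.exp (-s * N) * (Real.exp (s * u) - 1)
  have hbelow : ∀ u : ℤ, N - L < u → u ≤ N → a u ≤ G u := by
    intro u hu hu'
    refine (h2 u hu hu').trans ?_
    have hU1 := hUle u (by omega)
    have hu2 : (N : ℝ) ≤ 2 * u := by exact_mod_cast (show N ≤ 2 * u by omega)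
    have h3 : K + K' ≤ A / N * U u := by
      rw [div_mul_eq_mul_div, le_div_iff₀ hN0]
      nlinarith
    have h4 : Real.exp (-s * N) * (Real.exp (s * u) - 1) ≤ 1 := by
      have : Real.exp (-s * N) * Real.exp (s * u) ≤ 1 := by
        rw [← Real.exp_add, Real.exp_le_one_iff]
        have : (u : ℝ) ≤ N := by exact_mod_cast hu'
        nlinarith
      nlinarith [Real.exp_pos (-s * N)]
    have := mul_le_mul_of_nonneg_left h4 hK.le
    simp only [G]
    nlinarith
  -- maximum principle on `[1, N - L]`
  suffices hmax : ∀ u ∈ Finset.Icc (1 : ℤ) (N - L), a u ≤ G u by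
    refine (hmax 1 (Finset.mem_Icc.2 ⟨le_rfl, by omega⟩)).trans ?_
    have : 0 ≤ K * Real.exp (-s * N) * (Real.exp (s * (1 : ℤ)) - 1) := by
      refine mul_nonneg (by positivity) (sub_nonneg.2 (Real.one_le_exp (by push_cast; linarith)))
    simp only [G]
    have e : A * U 1 / N = A / N * U 1 := mul_div_right_comm _ _ _
    rw [e]
    exact sub_le_self _ this
  obtain ⟨u, hu, hmaxu⟩ := Finset.exists_max_image (Finset.Icc (1 : ℤ) (N - L)) (fun u => a u - G u)
    ⟨1, Finset.mem_Icc.2 ⟨le_rfl, by omega⟩⟩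
  by_contra hcon
  push Not at hcon
  obtain ⟨w, hw, hw'⟩ := hcon
  have hv : 0 < a u - G u := lt_of_lt_of_le (by linarith) (hmaxu w hw)
  set v := a u - G u with hvd
  rw [Finset.mem_Icc] at hu
  have hE : ∀ w : ℤ, 0 < w → w ≤ N → a w ≤ G w + v := by
    intro w h0 hN
    by_cases hw : w ≤ N - L
    · linarith [hmaxu w (Finset.mem_Icc.2 ⟨h0, hw⟩)]
    · linarith [hbelow w (by omega) hN]
  let Q : (Fin d → ℤ) → ℝ := fun z =>
    A / N * (μ z * (if 0 < u + z i₀ then U (u + z i₀) else 0))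
      - K * Real.exp (s * (u - N)) * (μ z * Real.exp (s * z i₀))
      + (K * Real.exp (-s * N) + v) * μ z
      + 2 * K * Real.exp (s * (u - N)) * Real.exp (-s * L) * (μ z * Real.exp (2 * s * z i₀))
  have hQ : HasSum Q (A / N * U u - K * Real.exp (s * (u - N)) * φ
      + (K * Real.exp (-s * N) + v) * 1
      + 2 * K * Real.exp (s * (u - N)) * Real.exp (-s * L) * φ2) :=
    ((((hU.harm u (by omega)).mul_left _).sub (hφs.hasSum.mul_left _)).add
      (h.sum.mul_left _)).add (hφ2s.hasSum.mul_left _)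
  have hle : a u ≤ _ := hasSum_le (fun z => ?_) (ha.harm u (by omega)) hQ
  · have hGu : a u = A / N * U u - K * Real.exp (s * (u - N)) + K * Real.exp (-s * N) + v := by
      have : G u = A / N * U u - K * Real.exp (s * (u - N)) + K * Real.exp (-s * N) := by
        simp only [G]
        rw [mul_sub, mul_assoc K, ← Real.exp_add, mul_one]
        ring_nf
      linarith
    have hp : 0 < K * Real.exp (s * (u - N)) := by positivity
    nlinarith [mul_lt_mul_of_pos_left hL hp]
  · have e1 : Real.exp (-s * N) * Real.exp (s * ((u + z i₀ : ℤ) : ℝ)) =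
        Real.exp (s * (u - N)) * Real.exp (s * z i₀) := by
      rw [← Real.exp_add, ← Real.exp_add]; push_cast; ring_nf
    have hpos2 : 0 ≤ 2 * K * Real.exp (s * (u - N)) * Real.exp (-s * L) * Real.exp (2 * s * z i₀) := by
      positivity
    have key : (if 0 < u + z i₀ then a (u + z i₀) else 0) ≤
        A / N * (if 0 < u + z i₀ then U (u + z i₀) else 0)
        - K * Real.exp (s * (u - N)) * Real.exp (s * z i₀)
        + (K * Real.exp (-s * N) + v)
        + 2 * K * Real.exp (s * (u - N)) * Real.exp (-s * L) * Real.exp (2 * s * z i₀) := by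
      split_ifs with hz
      · by_cases hzN : u + z i₀ ≤ N
        · have := hE _ hz hzN
          simp only [G] at this
          have e2 : K * Real.exp (-s * N) * (Real.exp (s * ((u + z i₀ : ℤ) : ℝ)) - 1) =
              K * (Real.exp (s * (u - N)) * Real.exp (s * z i₀)) - K * Real.exp (-s * N) := by
            rw [← e1]; ring
          rw [e2] at this
          linarith
        · have := h1 (u + z i₀) (by omega)
          have e3 : Real.exp (s * (((u + z i₀ : ℤ) : ℝ) - N)) =
              Real.exp (s * (u - N)) * Real.exp (s * z i₀) := by
            rw [← Real.exp_add]; push_cast; ring_nf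
          rw [e3] at this
          have hUp : 0 ≤ A / N * U (u + z i₀) := mul_nonneg (by positivity) (hU.nonneg _ hz)
          have e4 : Real.exp (s * z i₀) ≤ Real.exp (-s * L) * Real.exp (2 * s * z i₀) := by
            rw [← Real.exp_add]
            refine Real.exp_le_exp.2 ?_
            have : (L : ℝ) ≤ z i₀ := by exact_mod_cast (show (L : ℤ) ≤ z i₀ by omega)
            nlinarith
          have := mul_le_mul_of_nonneg_left e4
            (show 0 ≤ 2 * K * Real.exp (s * (u - N)) by positivity)
          have : 0 < K * Real.exp (-s * N) := by positivity
          nlinarith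
      · have e5 : K * (Real.exp (s * (u - N)) * Real.exp (s * z i₀)) ≤ K * Real.exp (-s * N) := by
          rw [← e1]
          refine mul_le_mul_of_nonneg_left ?_ hK.le
          have : Real.exp (s * ((u + z i₀ : ℤ) : ℝ)) ≤ 1 := by
            rw [Real.exp_le_one_iff]
            have : ((u + z i₀ : ℤ) : ℝ) ≤ 0 := by exact_mod_cast (show u + z i₀ ≤ 0 by omega)
            nlinarith
          nlinarith [Real.exp_pos (-s * N)]
        linarith
    have := mul_le_mul_of_nonneg_left key (h.nn z)
    simp only [Q]
    linarith

theorem Hyp.heightHarm_lower (h : Hyp μ θ m i₀) {U : ℤ → ℝ} (hU : HeightHarm μ i₀ U)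
    (hUle : ∀ u : ℤ, 0 < u → (u : ℝ) ≤ U u) {a : ℤ → ℝ} (ha : HeightHarm μ i₀ a) (hpos : ∀ u > 0, 0 < a u) :
    ∃ c : ℝ, 0 < c ∧ ∀ u : ℤ, 0 < u → c * (u : ℝ) ≤ a u := by
  have hθ := h.θpos
  obtain ⟨s, hsd⟩ : ∃ s, s = θ / 2 := ⟨_, rfl⟩
  have hs : 0 < s := by linarith
  have hφ := h.one_lt_mgf (s := s) hs.ne' (by rw [abs_of_pos hs]; linarith)
  set φ := ∑' z : Fin d → ℤ, μ z * Real.exp (s * z i₀) with hφd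
  obtain ⟨L, hL⟩ : ∃ L : ℕ, 2 * (Real.exp (-s * L) *
      ∑' z : Fin d → ℤ, μ z * Real.exp (2 * s * z i₀)) < φ - 1 := by
    have : Tendsto (fun n : ℕ => Real.exp (-s * (n : ℝ))) atTop (𝓝 0) := by
      refine Real.tendsto_exp_atBot.comp ?_
      exact (tendsto_natCast_atTop_atTop).const_mul_atTop_of_neg (by linarith)
    have := (this.mul_const (∑' z : Fin d → ℤ, μ z * Real.exp (2 * s * z i₀))).const_mul 2
    rw [zero_mul, mul_zero] at this
    exact (this.eventually (gt_mem_nhds (by linarith))).exists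
  obtain ⟨K, hK, hgrow⟩ := h.heightHarm_growth hs (by linarith)
  obtain ⟨c₁, hc₁, hH⟩ := h.heightHarm_harnack
  set K' := Real.exp (c₁ * L)
  have hK' : 0 < K' := Real.exp_pos _
  have hU1 : 1 ≤ U 1 := by simpa using hUle 1 one_pos
  have ha1 := hpos 1 one_pos
  set c := min (a 1 / (2 * (K + K') * U 1)) (Real.exp (-c₁ * (2 * L + 2)) * a 1 / (2 * L + 2))
  refine ⟨c, lt_min (by positivity) (by positivity), fun N hN => ?_⟩
  have hN0 : (0 : ℝ) < N := by exact_mod_cast hN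
  by_cases hNL : 2 * (L : ℤ) + 1 ≤ N
  · have haN := hpos N hN
    have hb : HeightHarm μ i₀ fun u => a u / a N := by
      refine ⟨fun u hu => div_nonneg (hpos u hu).le haN.le, fun u hu => ?_⟩
      have e : (fun z : Fin d → ℤ => μ z * (if 0 < u + z i₀ then a (u + z i₀) / a N else 0)) =
          fun z => μ z * (if 0 < u + z i₀ then a (u + z i₀) else 0) / a N := by
        funext z
        split_ifs <;> simp [mul_div_assoc]
      rw [e]
      exact (ha.harm u hu).div_const (a N)
    have h1 := h.heightHarm_barrier hs (by linarith) hL hb hU hUle hK hK'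
      (N := N) (by omega) (by omega) (fun u hu => ?_) (fun u hu hu' => ?_)
    · rw [div_le_div_iff₀ haN hN0] at h1
      have h2 : c ≤ a 1 / (2 * (K + K') * U 1) := min_le_left _ _
      rw [le_div_iff₀ (by positivity)] at h2
      have h3 : 0 < 2 * (K + K') * U 1 := by positivity
      refine le_of_mul_le_mul_left ?_ h3
      calc _ = c * (2 * (K + K') * U 1) * N := by ring
        _ ≤ a 1 * N := by gcongr
        _ ≤ _ := h1
    · rw [div_le_iff₀ haN]
      exact hgrow a ha hpos N u hN hu.le
    · rw [div_le_iff₀ haN]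
      have h2 := hH a ha N u hN (by omega)
      have h3 : |(N : ℝ) - u| ≤ L := by
        rw [abs_le]
        constructor
        · have : (u : ℝ) ≤ N := by exact_mod_cast hu'
          have : (0 : ℝ) ≤ L := by positivity
          linarith
        · have : (N : ℝ) - L < u := by exact_mod_cast hu
          linarith
      have h4 : Real.exp (-c₁ * L) * a u ≤ a N := by
        refine le_trans (mul_le_mul_of_nonneg_right (Real.exp_le_exp.2 ?_) (hpos u (by omega)).le) h2
        nlinarith
      calc a u = K' * (Real.exp (-c₁ * L) * a u) := by
            rw [← mul_assoc, ← Real.exp_add]; simp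
        _ ≤ _ := by gcongr
  · have h2 := hH a ha N 1 hN one_pos
    have h5 : (N : ℝ) ≤ 2 * L + 1 := by exact_mod_cast (show N ≤ 2 * (L : ℤ) + 1 by omega)
    have h6 : (1 : ℝ) ≤ N := by exact_mod_cast hN
    have h3 : |(N : ℝ) - ((1 : ℤ) : ℝ)| ≤ 2 * L + 2 := by
      rw [abs_le]; push_cast; constructor <;> linarith
    have h4 : Real.exp (-c₁ * (2 * L + 2)) * a 1 ≤ a N := by
      refine le_trans (mul_le_mul_of_nonneg_right (Real.exp_le_exp.2 ?_) ha1.le) h2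
      nlinarith
    have h7 : c ≤ Real.exp (-c₁ * (2 * L + 2)) * a 1 / (2 * L + 2) := min_le_right _ _
    rw [le_div_iff₀ (by positivity)] at h7
    have hc0 : 0 ≤ c := le_min (by positivity) (by positivity)
    nlinarith

theorem Hyp.heightHarm_unique (h : Hyp μ θ m i₀) {U : ℤ → ℝ} (hU : HeightHarm μ i₀ U)
    (hUle : ∀ u : ℤ, 0 < u → (u : ℝ) ≤ U u) {C : ℝ} (hC : 0 < C) (hUC : ∀ u : ℤ, 0 < u → U u ≤ C * u)
    {a : ℤ → ℝ} (ha : HeightHarm μ i₀ a) : ∃ c : ℝ, 0 ≤ c ∧ ∀ u > 0, a u = c * U u := by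
  have hUpos : ∀ u > 0, 0 < U u := fun u hu =>
    lt_of_lt_of_le (by exact_mod_cast hu) (hUle u hu)
  set R := (fun u => a u / U u) '' Set.Ioi 0 with hR
  have hne : R.Nonempty := ⟨_, 1, Set.mem_Ioi.2 one_pos, rfl⟩
  have hbdd : BddBelow R := by
    refine ⟨0, ?_⟩
    rintro _ ⟨u, hu, rfl⟩
    exact div_nonneg (ha.nonneg u hu) (hUpos u hu).le
  set c := sInf R with hc
  have hcle : ∀ u > 0, c * U u ≤ a u := fun u hu => by
    rw [← le_div_iff₀ (hUpos u hu)]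
    exact csInf_le hbdd ⟨u, hu, rfl⟩
  have hg : HeightHarm μ i₀ fun u => a u - c * U u := by
    refine ⟨fun u hu => sub_nonneg.2 (hcle u hu), fun u hu => ?_⟩
    have e : (fun z : Fin d → ℤ => μ z *
        (if 0 < u + z i₀ then a (u + z i₀) - c * U (u + z i₀) else 0)) =
        fun z => μ z * (if 0 < u + z i₀ then a (u + z i₀) else 0) -
          c * (μ z * (if 0 < u + z i₀ then U (u + z i₀) else 0)) := by
      funext z
      split_ifs <;> ring
    rw [e]
    exact (ha.harm u hu).sub ((hU.harm u hu).mul_left c)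
  refine ⟨c, le_csInf hne ?_, ?_⟩
  · rintro _ ⟨u, hu, rfl⟩
    exact div_nonneg (ha.nonneg u hu) (hUpos u hu).le
  by_contra hcon
  push Not at hcon
  obtain ⟨v, hv, hv'⟩ := hcon
  obtain ⟨c₁, hc₁, hH⟩ := h.heightHarm_harnack
  have hgv : 0 < a v - c * U v := lt_of_le_of_ne (sub_nonneg.2 (hcle v hv)) (sub_ne_zero.2 hv').symm
  have hgpos : ∀ u > 0, 0 < a u - c * U u := fun u hu =>
    lt_of_lt_of_le (mul_pos (Real.exp_pos _) hgv) (hH _ hg u v hu hv)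
  obtain ⟨c', hc', hl⟩ := h.heightHarm_lower hU hUle hg hgpos
  have : c + c' / C ≤ c := by
    refine le_csInf hne ?_
    rintro _ ⟨u, hu, rfl⟩
    rw [le_div_iff₀ (hUpos u hu), add_mul]
    have h1 := hl u hu
    have h2 : c' / C * U u ≤ c' * u := by
      rw [div_mul_eq_mul_div, div_le_iff₀ hC]
      nlinarith [hUC u hu]
    linarith
  have : 0 < c' / C := by positivity
  linarith

theorem Hyp.tendsto_ratio (h : Hyp μ θ m i₀) {t : ℕ → ℝ} {y : ℕ → Fin d → ℤ}
    (hy : Dir m i₀ t y) {x : Fin d → ℤ} (hx : x ∈ posDom {i₀}) :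
    Tendsto (fun n => pot (PA μ (posDom {i₀})) (dl (y n)) x /
      pot (PA μ (posDom {i₀})) (dl (y n)) (base d)) atTop
      (𝓝 (renew μ i₀ (x i₀) / renew μ i₀ 1)) := by
  rw [tendsto_iff_ultrafilter]
  intro l hl
  obtain ⟨f, hexp, hharm, h1, hlim⟩ := h.exists_limit hy l hl
  obtain ⟨C, hC, hUC⟩ := h.renew_le
  have hUtop : ∀ u > 0, renew μ i₀ u ≠ ⊤ := fun u hu =>
    ne_top_of_le_ne_top ENNReal.ofReal_ne_top (hUC u hu)
  have hftop : ∀ u > 0, f u ≠ ⊤ := fun u hu => by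
    obtain ⟨C, -, hC⟩ := hexp 1 one_pos
    exact ne_top_of_le_ne_top ENNReal.ofReal_ne_top (hC u hu)
  have hU := h.heightHarm_toReal hUtop fun x hx => h.PA_renew hx
  have hf := h.heightHarm_toReal hftop hharm
  have hUle : ∀ u : ℤ, 0 < u → (u : ℝ) ≤ (renew μ i₀ u).toReal := fun u hu =>
    (ENNReal.ofReal_le_iff_le_toReal (hUtop u hu)).1 (le_renew u)
  obtain ⟨c, hc, hfc⟩ := h.heightHarm_unique hU hUle (by linarith) (fun u hu => by
    have h0 : (0 : ℝ) < u := by exact_mod_cast hu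
    exact ENNReal.toReal_le_of_le_ofReal (by positivity) (hUC u hu)) hf
  have hx' := mem_posDom_singleton.1 hx
  have h2 := hfc 1 one_pos
  rw [h1, ENNReal.toReal_one] at h2
  have h3 : f (x i₀) = renew μ i₀ (x i₀) / renew μ i₀ 1 := by
    have hU1 : 0 < (renew μ i₀ 1).toReal := lt_of_lt_of_le (by norm_num) (hUle 1 one_pos)
    refine (ENNReal.toReal_eq_toReal_iff' (hftop _ hx') ?_).1 ?_
    · exact ENNReal.div_ne_top (hUtop _ hx') (ENNReal.toReal_pos_iff.1 hU1).1.ne'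
    · rw [hfc _ hx', ENNReal.toReal_div, eq_div_iff hU1.ne']
      linear_combination (-(renew μ i₀ (x i₀)).toReal) * h2
  rw [← h3]
  exact hlim x hx

end

section
variable {V : Type*} [AddCommGroup V] {μ : V → ℝ}

/-- Expected value of `G` after one step on the event that the step ends in `B`. -/
noncomputable def stepInto (μ : V → ℝ) (B : Set V) (G : V → ℝ≥0∞) (z : V) : ℝ≥0∞ :=
  Ex μ fun u => if z + u ∈ B then G (z + u) else 0

theorem stepInto_mono {B : Set V} {F G : V → ℝ≥0∞} (h : ∀ x ∈ B, F x ≤ G x) (z : V) :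
    stepInto μ B F z ≤ stepInto μ B G z := by
  refine Ex_mono fun u => ?_
  split_ifs with hu
  · exact h _ hu
  · exact le_rfl

theorem stepInto_smul (B : Set V) (c : ℝ≥0∞) (G : V → ℝ≥0∞) :
    stepInto μ B (c • G) = c • stepInto μ B G := by
  funext z
  simp only [stepInto, Pi.smul_apply, smul_eq_mul, ← Ex_const_mul]
  congr 1
  funext u
  split_ifs <;> simp

theorem stepInto_add (B : Set V) (F G : V → ℝ≥0∞) :
    stepInto μ B (F + G) = stepInto μ B F + stepInto μ B G := by
  funext z
  simp only [stepInto, Pi.add_apply, ← Ex_add]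
  congr 1
  funext u
  split_ifs <;> simp

theorem PA_eq_add_stepInto {A H : Set V} (hAH : A ⊆ H) (G : V → ℝ≥0∞) {x : V} (hx : x ∈ A) :
    PA μ H G x = PA μ A G x + stepInto μ (H \ A) G x := by
  rw [PA_apply hx, PA_apply (hAH hx), stepInto, ← Ex_add]
  congr 1
  funext u
  by_cases h1 : x + u ∈ A
  · simp [h1, hAH h1]
  · simp [h1]

theorem IsKop.tendsto_pow_pot {V : Type*} {T : Module.End ℝ≥0∞ (V → ℝ≥0∞)} (hT : IsKop T) {f : V → ℝ≥0∞} {x : V}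
    (hx : pot T f x ≠ ⊤) : Tendsto (fun n => (T ^ n) (pot T f) x) atTop (𝓝 0) := by
  have h1 := ENNReal.tendsto_sum_nat_add (fun n => (T ^ n) f x) hx
  refine h1.congr fun n => ?_
  have : pot T f = fun z => ∑' k, (T ^ k) f z := rfl
  rw [this, (hT.pow n).tsum]
  refine tsum_congr fun k => ?_
  rw [add_comm, pow_add]
  rfl

/-- If `F = P F + f` on `A` and `P ^ n F → 0`, then `F` is the potential of `f`. -/
theorem eq_pot_PA {A : Set V} {f F : V → ℝ≥0∞} (h : ∀ x ∈ A, F x = PA μ A F x + f x) {x : V}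
    (hx : x ∈ A) (h0 : Tendsto (fun n => (PA μ A ^ n) F x) atTop (𝓝 0)) :
    F x = pot (PA μ A) f x := by
  have h1 := h0.add (ENNReal.tendsto_nat_tsum fun i => (PA μ A ^ i) f x)
  rw [zero_add] at h1
  refine tendsto_nhds_unique ?_ h1
  exact tendsto_const_nhds.congr fun n => eq_PA_pow_add_sum h n x hx

theorem pot_PA_decomp {A H : Set V} (hAH : A ⊆ H) {f : V → ℝ≥0∞} {x : V} (hx : x ∈ A)
    (hf : pot (PA μ H) f x ≠ ⊤) :
    pot (PA μ H) f x =
      pot (PA μ A) (stepInto μ (H \ A) (pot (PA μ H) f)) x + pot (PA μ A) f x := by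
  rw [← Pi.add_apply, ← pot_add]
  refine eq_pot_PA (fun z hz => ?_) hx ?_
  · conv_lhs => rw [(isKop_PA μ H).pot_eq]
    rw [Pi.add_apply, Pi.add_apply, PA_eq_add_stepInto hAH _ hz]
    ring
  · exact tendsto_of_tendsto_of_tendsto_of_le_of_le tendsto_const_nhds
      ((isKop_PA μ H).tendsto_pow_pot hf) (fun n => zero_le) fun n => PA_pow_mono_set hAH _ n x

end

section
variable {d : ℕ} {μ : (Fin d → ℤ) → ℝ} {θ : ℝ} {m : Fin d → ℝ} {i₀ : Fin d}

theorem Hyp.exit_bound (h : Hyp μ θ m i₀) : ∃ s δ : ℝ, 0 < δ ∧ δ ≤ θ / 4 ∧ δ * d < s ∧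
    ∀ x ∈ posAll, pot (PA μ posAll) (stepInto μ (posDom {i₀} \ posAll)
      (fun z => ENNReal.ofReal (Real.exp (δ * znorm z)))) x ≤
      ∑ j ∈ Finset.univ.erase i₀, ENNReal.ofReal (Real.exp (-s * x j + δ * znorm x)) := by
  have hθ := h.θpos
  have hK := h.momK_pos
  set K := momK μ θ
  obtain ⟨s, hs, hs1, hsθ, hsm⟩ : ∃ s : ℝ, 0 < s ∧ s ≤ 1 ∧ s ≤ θ / 4 ∧
      ∀ j, j ≠ i₀ → s ≤ m j / (2 * K) := by
    have e : ∀ c : ℝ, 0 < c → ∀ᶠ s in 𝓝[>] (0 : ℝ), s ≤ c := fun c hc =>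
      Filter.mem_of_superset (Ioo_mem_nhdsGT hc) fun s hs => hs.2.le
    have e3 : ∀ᶠ s in 𝓝[>] (0 : ℝ), ∀ j, j ≠ i₀ → s ≤ m j / (2 * K) := by
      refine eventually_all.2 fun j => ?_
      by_cases hj : j = i₀
      · exact Eventually.of_forall fun s hs => absurd hj hs
      · exact (e _ (div_pos (h.mpos j hj) (by positivity))).mono fun s hs _ => hs
    exact (((e 1 one_pos).and ((e (θ / 4) (by positivity)).and e3)).and
      self_mem_nhdsWithin).exists.imp fun s hs => ⟨hs.2, hs.1.1, hs.1.2.1, hs.1.2.2⟩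
  have hd : (0 : ℝ) < d + 1 := by positivity
  set δ := s ^ 2 / (d + 1) with hδ
  have hδ0 : 0 < δ := by positivity
  have hδs : δ * (d + 1) = s ^ 2 := div_mul_cancel₀ _ hd.ne'
  have hδle : δ ≤ s ^ 2 := by nlinarith [show (0 : ℝ) ≤ d by positivity]
  refine ⟨s, δ, hδ0, by nlinarith, by nlinarith, ?_⟩
  set E : (Fin d → ℤ) → ℝ≥0∞ := fun x =>
    ∑ j ∈ Finset.univ.erase i₀, ENNReal.ofReal (Real.exp (-s * x j + δ * znorm x)) with hE
  have hstep : ∀ x, Ex μ (fun u => E (x + u)) ≤ E x := by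
    intro x
    simp only [hE]
    rw [Ex_sum]
    refine Finset.sum_le_sum fun j hj => ?_
    have hj := Finset.ne_of_mem_erase hj
    calc Ex μ (fun u => ENNReal.ofReal (Real.exp (-s * ((x + u) j : ℤ) + δ * znorm (x + u))))
        ≤ Ex μ (fun u => ENNReal.ofReal (Real.exp (-s * x j + δ * znorm x)) *
            ENNReal.ofReal (Real.exp (-s * (u j : ℝ) + δ * znorm u))) := by
          refine Ex_mono fun u => ?_
          rw [← ENNReal.ofReal_mul (Real.exp_pos _).le, ← Real.exp_add]
          refine ENNReal.ofReal_le_ofReal (Real.exp_le_exp.2 ?_)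
          have := mul_le_mul_of_nonneg_left (znorm_add_le x u) hδ0.le
          simp only [Pi.add_apply]
          push_cast
          linarith
      _ ≤ ENNReal.ofReal (Real.exp (-s * x j + δ * znorm x)) * 1 := by
          rw [Ex_const_mul]
          refine mul_le_mul_right ((h.Ex_drift hs.le hsθ hδ0.le (by nlinarith)).trans ?_) _
          rw [ENNReal.ofReal_le_one]
          have h1 := hsm j hj
          rw [le_div_iff₀ (by positivity)] at h1
          have h2 : K * (s ^ 2 + δ) ≤ s * (s * (2 * K)) := by nlinarith
          nlinarith
      _ = _ := mul_one _
  intro x hx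
  refine (pot_PA_mono (fun z _ => stepInto_mono (fun w hw => ?_) z) x hx).trans
    (pot_PA_le (f := stepInto μ (posDom {i₀} \ posAll) E) (E := E) (fun z hz => ?_) x hx)
  · have : ∃ j, w j ≤ 0 := by
      by_contra hcon
      push Not at hcon
      exact hw.2 hcon
    obtain ⟨j, hj⟩ := this
    have hji : j ≠ i₀ := by
      rintro rfl
      exact absurd (mem_posDom_singleton.1 hw.1) (not_lt.2 hj)
    refine le_trans (ENNReal.ofReal_le_ofReal (Real.exp_le_exp.2 ?_))
      (Finset.single_le_sum (f := fun j => ENNReal.ofReal (Real.exp (-s * w j + δ * znorm w)))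
        (fun _ _ => zero_le) (Finset.mem_erase.2 ⟨hji, Finset.mem_univ j⟩))
    have : (w j : ℝ) ≤ 0 := by exact_mod_cast hj
    nlinarith
  · rw [← PA_eq_add_stepInto posAll_subset _ hz]
    exact (PA_le_Ex z E).trans (hstep z)

theorem Hyp.exit_ne_top (h : Hyp μ θ m i₀) : ∃ δ : ℝ, 0 < δ ∧ δ ≤ θ / 4 ∧ ∀ C : ℝ, 0 ≤ C →
    ∀ x ∈ posAll, pot (PA μ posAll) (stepInto μ (posDom {i₀} \ posAll)
      (fun z => ENNReal.ofReal (C * Real.exp (δ * znorm z)))) x ≠ ⊤ := by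
  obtain ⟨s, δ, hδ, hδθ, -, H⟩ := h.exit_bound
  refine ⟨δ, hδ, hδθ, fun C hC x hx => ?_⟩
  have e : (fun z : Fin d → ℤ => ENNReal.ofReal (C * Real.exp (δ * znorm z))) =
      ENNReal.ofReal C • fun z => ENNReal.ofReal (Real.exp (δ * znorm z)) := by
    funext z
    rw [Pi.smul_apply, smul_eq_mul, ENNReal.ofReal_mul hC]
  rw [e, stepInto_smul, pot_smul]
  refine ENNReal.mul_ne_top ENNReal.ofReal_ne_top (ne_top_of_le_ne_top ?_ (H x hx))
  exact ENNReal.sum_ne_top.2 fun _ _ => ENNReal.ofReal_ne_top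

/-- Dominated convergence for the exit functional. -/
theorem Hyp.tendsto_exit (h : Hyp μ θ m i₀) {G : ℕ → (Fin d → ℤ) → ℝ≥0∞} {g : (Fin d → ℤ) → ℝ≥0∞}
    (hG : ∀ x ∈ posDom {i₀}, Tendsto (fun n => G n x) atTop (𝓝 (g x)))
    (hdom : ∀ δ > 0, ∃ C > 0, ∀ᶠ n in atTop, ∀ x ∈ posDom {i₀},
      G n x ≤ ENNReal.ofReal (C * Real.exp (δ * znorm x))) {x : Fin d → ℤ} (hx : x ∈ posAll) :
    Tendsto (fun n => pot (PA μ posAll) (stepInto μ (posDom {i₀} \ posAll) (G n)) x) atTop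
      (𝓝 (pot (PA μ posAll) (stepInto μ (posDom {i₀} \ posAll) g) x)) := by
  obtain ⟨δ, hδ, hδθ, hfin⟩ := h.exit_ne_top
  obtain ⟨C, hC, hev⟩ := hdom δ hδ
  simp only [(isKop_PA μ posAll).pot_apply_eq (stepInto _ _ _)]
  refine ENNReal.tendsto_tsum_of_dominated (b := fun z => pot (PA μ posAll) (dl z) x *
    stepInto μ (posDom {i₀} \ posAll) (fun z => ENNReal.ofReal (C * Real.exp (δ * znorm z))) z)
    ?_ (fun z => ?_) ?_
  · rw [← (isKop_PA μ posAll).pot_apply_eq]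
    exact hfin C hC.le x hx
  · by_cases hz : pot (PA μ posAll) (dl z) x = ⊤
    · by_cases hzA : z ∈ posAll
      · refine absurd hz (ne_top_of_le_ne_top (h.green_ne_top z (posAll_subset hx)) ?_)
        exact ENNReal.tsum_le_tsum fun n => PA_pow_mono_set posAll_subset _ n x
      · have : pot (PA μ posAll) (dl z) x = 0 :=
          ENNReal.tsum_eq_zero.2 fun n => PA_pow_dl_zero_of_notMem hx hzA
        simp [this] at hz
    · refine ENNReal.Tendsto.const_mul ?_ (Or.inr hz)
      refine ENNReal.tendsto_tsum_of_dominated (h.Ex_exp_znorm_ne_top C z) (fun u => ?_) ?_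
      · refine ENNReal.Tendsto.const_mul ?_ (Or.inr ENNReal.ofReal_ne_top)
        simp only
        split_ifs with hu
        · exact hG _ hu.1
        · exact tendsto_const_nhds
      · filter_upwards [hev] with n hn u
        refine mul_le_mul_right ?_ _
        split_ifs with hu
        · refine (hn _ hu.1).trans (ENNReal.ofReal_le_ofReal ?_)
          have := znorm_nonneg (z + u)
          gcongr
        · exact zero_le
  · filter_upwards [hev] with n hn z
    exact mul_le_mul_right (stepInto_mono (fun w hw => hn w hw.1) z) _

/-- Normalized Green functions of the walk killed outside the orthant. -/
theorem Hyp.tendsto_green_orthant (h : Hyp μ θ m i₀) {t : ℕ → ℝ} {y : ℕ → Fin d → ℤ}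
    (hy : Dir m i₀ t y) {x : Fin d → ℤ} (hx : x ∈ posAll) :
    Tendsto (fun n => (pot (PA μ posAll) (dl (y n)) x).toReal /
        (pot (PA μ (posDom {i₀})) (dl (y n)) (base d)).toReal) atTop
      (𝓝 (((renew μ i₀ (x i₀)).toReal - (pot (PA μ posAll) (stepInto μ (posDom {i₀} \ posAll)
        (fun z => renew μ i₀ (z i₀))) x).toReal) / (renew μ i₀ 1).toReal)) := by
  set F : ℕ → (Fin d → ℤ) → ℝ≥0∞ := fun n => pot (PA μ (posDom {i₀})) (dl (y n)) with hF
  set U : (Fin d → ℤ) → ℝ≥0∞ := fun z => renew μ i₀ (z i₀)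
  set B := fun G => pot (PA μ posAll) (stepInto μ (posDom {i₀} \ posAll) G) x with hB
  have hb := base_mem (d := d) (i₀ := i₀)
  have hFb0 : ∀ n, F n (base d) ≠ 0 := fun n => (h.green_pos (hy.mem n) hb).ne'
  have hFbt : ∀ n, F n (base d) ≠ ⊤ := fun n => h.green_ne_top _ hb
  have hBsmul : ∀ (c : ℝ≥0∞) G, B (c • G) = c * B G := fun c G => by
    simp only [hB]; rw [stepInto_smul, pot_smul]; rfl
  obtain ⟨C, hC, hUC⟩ := h.renew_le
  have hUt : ∀ z ∈ posDom {i₀}, U z ≠ ⊤ := fun z hz =>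
    ne_top_of_le_ne_top ENNReal.ofReal_ne_top (hUC _ (mem_posDom_singleton.1 hz))
  have hU1 : renew μ i₀ 1 ≠ 0 := by
    have := le_renew (μ := μ) (i₀ := i₀) 1
    intro h0
    rw [h0] at this
    simp at this
  have hU1t : renew μ i₀ 1 ≠ ⊤ := ne_top_of_le_ne_top ENNReal.ofReal_ne_top (hUC 1 one_pos)
  -- limits of the two terms
  have hlim1 := h.tendsto_ratio hy (posAll_subset hx)
  have hlim2 : Tendsto (fun n => B ((F n (base d))⁻¹ • F n)) atTop (𝓝 (B ((renew μ i₀ 1)⁻¹ • U))) := by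
    refine h.tendsto_exit (fun z hz => ?_) (fun δ hδ => ?_) hx
    · simp only [Pi.smul_apply, smul_eq_mul]
      simp_rw [mul_comm _⁻¹, ← div_eq_mul_inv]
      exact h.tendsto_ratio hy hz
    · obtain ⟨C, hC, hev⟩ := h.green_dominated hy hδ
      refine ⟨C, hC, hev.mono fun n hn z hz => ?_⟩
      rw [Pi.smul_apply, smul_eq_mul, mul_comm, ← div_eq_mul_inv]
      exact ENNReal.div_le_of_le_mul (hn z hz)
  rw [hBsmul] at hlim2
  simp_rw [hBsmul] at hlim2
  have hBU : B U ≠ ⊤ := by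
    obtain ⟨δ, hδ, hδθ, hfin⟩ := h.exit_ne_top
    refine ne_top_of_le_ne_top (hfin (C / δ) (by positivity) x hx)
      (pot_PA_mono (fun z _ => stepInto_mono (fun w hw => ?_) z) x hx)
    refine (hUC _ (mem_posDom_singleton.1 hw.1)).trans (ENNReal.ofReal_le_ofReal ?_)
    rw [div_mul_eq_mul_div, le_div_iff₀ hδ, mul_assoc]
    refine mul_le_mul_of_nonneg_left ?_ (by linarith)
    have h1 := abs_apply_le_znorm w i₀
    have h2 := le_abs_self (w i₀ : ℝ)
    have h3 := Real.add_one_le_exp (δ * znorm w)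
    nlinarith
  have hl1 := (ENNReal.tendsto_toReal (ENNReal.div_ne_top (hUt x (posAll_subset hx)) hU1)).comp hlim1
  have hl2 := (ENNReal.tendsto_toReal
    (ENNReal.mul_ne_top (ENNReal.inv_ne_top.2 hU1) hBU)).comp hlim2
  have hl := hl1.sub hl2
  have e : ∀ a b c : ℝ, (a - b) / c = a / c - c⁻¹ * b := fun a b c => by ring
  rw [e, ← ENNReal.toReal_div, ← ENNReal.toReal_inv, ← ENNReal.toReal_mul]
  refine hl.congr fun n => ?_
  have hd := pot_PA_decomp (μ := μ) posAll_subset hx (h.green_ne_top (y n) (posAll_subset hx))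
  have hne := h.green_ne_top (y n) (posAll_subset (i₀ := i₀) hx)
  have hne1 : B (F n) ≠ ⊤ := ne_top_of_le_ne_top hne (hd ▸ le_self_add)
  have hne2 : pot (PA μ posAll) (dl (y n)) x ≠ ⊤ := ne_top_of_le_ne_top hne (hd ▸ le_add_self)
  have hd' := congrArg ENNReal.toReal hd
  rw [ENNReal.toReal_add hne1 hne2] at hd'
  simp only [Function.comp_apply, ENNReal.toReal_div, ENNReal.toReal_mul, ENNReal.toReal_inv]
  rw [hd', ← e]
  congr 1
  simp only [hB, hF]
  ring

end

section
variable {V : Type*} [AddCommGroup V] {μ : V → ℝ}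

theorem hasSum_sub_toReal {ι : Type*} {f : ι → ℝ} {p n : ι → ℝ≥0∞} (hp : ∑' i, p i ≠ ⊤)
    (hn : ∑' i, n i ≠ ⊤) (h : ∀ i, f i = (p i).toReal - (n i).toReal) :
    HasSum f ((∑' i, p i).toReal - (∑' i, n i).toReal) := by
  have e : f = fun i => (p i).toReal - (n i).toReal := funext h
  rw [e, ENNReal.tsum_toReal_eq (ENNReal.ne_top_of_tsum_ne_top hp),
    ENNReal.tsum_toReal_eq (ENNReal.ne_top_of_tsum_ne_top hn)]
  exact (ENNReal.summable_toReal hp).hasSum.sub (ENNReal.summable_toReal hn).hasSum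

/-- The exit functional of `g` in terms of potentials of its positive and negative parts. -/
theorem exitExp_eq {A : Set V} (hnn : ∀ z, 0 ≤ μ z) (hsum : HasSum μ 1) (g : V → ℝ)
    {p n : V → ℝ≥0∞}
    (hp : ∀ z ∈ A, p z = Ex μ fun u => if z + u ∈ A then 0 else ENNReal.ofReal (g (z + u)))
    (hn : ∀ z ∈ A, n z = Ex μ fun u => if z + u ∈ A then 0 else ENNReal.ofReal (-g (z + u)))
    (hpt : ∀ z ∈ A, pot (PA μ A) p z ≠ ⊤) (hnt : ∀ z ∈ A, pot (PA μ A) n z ≠ ⊤)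
    {x : V} (hx : x ∈ A) :
    exitExp μ A Set.univ g x = (pot (PA μ A) p x).toReal - (pot (PA μ A) n x).toReal := by
  have le_pot : ∀ (f : V → ℝ≥0∞) z, f z ≤ pot (PA μ A) f z := fun f z => by
    rw [(isKop_PA μ A).pot_eq]; exact le_self_add
  have hb : ∀ z ∈ A, ∑' y : V, (if y ∉ A ∧ y ∈ Set.univ then μ (y - z) else 0) * g y =
      (p z).toReal - (n z).toReal := by
    intro z hz
    rw [← (Equiv.addLeft z).tsum_eq]
    have h1 := ne_top_of_le_ne_top (hpt z hz) (le_pot p z)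
    have h2 := ne_top_of_le_ne_top (hnt z hz) (le_pot n z)
    rw [hp z hz] at h1 ⊢
    rw [hn z hz] at h2 ⊢
    refine (hasSum_sub_toReal h1 h2 fun u => ?_).tsum_eq
    simp only [Equiv.coe_addLeft, Set.mem_univ, and_true, add_sub_cancel_left, ENNReal.toReal_mul,
      ENNReal.toReal_ofReal (hnn u)]
    by_cases hu : z + u ∈ A
    · simp [hu]
    · rw [if_pos hu, if_neg hu, if_neg hu, ← mul_sub]
      congr 1
      simp only [ENNReal.toReal_ofReal']
      rcases le_total 0 (g (z + u)) with h0 | h0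
      · rw [max_eq_left h0, max_eq_right (by linarith), sub_zero]
      · rw [max_eq_right h0, max_eq_left (by linarith)]; ring
  refine (hasSum_sub_toReal (hpt x hx) (hnt x hx) fun k => ?_).tsum_eq
  have hle : ∀ f : V → ℝ≥0∞, pot (PA μ A) f x ≠ ⊤ → (PA μ A ^ k) f x ≠ ⊤ := fun f hf =>
    ENNReal.ne_top_of_tsum_ne_top hf k
  have h1 := hle p (hpt x hx)
  have h2 := hle n (hnt x hx)
  rw [((isKop_PA μ A).pow k).apply_eq] at h1 h2 ⊢
  rw [((isKop_PA μ A).pow k).apply_eq n]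
  refine (hasSum_sub_toReal h1 h2 fun z => ?_).tsum_eq
  rw [kern_eq hnn hsum k hx, ENNReal.toReal_mul, ENNReal.toReal_mul, ← mul_sub]
  by_cases hz : z ∈ A
  · refine congrArg _ (Eq.trans ?_ (hb z hz))
    congr!
  · simp [PA_pow_dl_zero_of_notMem hx hz]

theorem hasSum_PA_toReal {A : Set V} (hnn : ∀ z, 0 ≤ μ z) {F : V → ℝ≥0∞} {x : V} (hx : x ∈ A)
    (hF : PA μ A F x ≠ ⊤) :
    HasSum (fun y => if y ∈ A then μ (y - x) * (F y).toReal else 0) (PA μ A F x).toReal := by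
  rw [← (Equiv.addLeft x).hasSum_iff]
  rw [PA_apply hx, Ex] at hF ⊢
  have h3 := (ENNReal.summable_toReal hF).hasSum
  rw [← ENNReal.tsum_toReal_eq (ENNReal.ne_top_of_tsum_ne_top hF)] at h3
  have e : ((fun y => if y ∈ A then μ (y - x) * (F y).toReal else 0) ∘ (Equiv.addLeft x)) =
      fun u => (ENNReal.ofReal (μ u) * if x + u ∈ A then F (x + u) else 0).toReal := by
    funext u
    simp only [Function.comp_apply, Equiv.coe_addLeft, add_sub_cancel_left, ENNReal.toReal_mul,
      ENNReal.toReal_ofReal (hnn u)]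
    split_ifs <;> simp
  rw [e]
  exact h3

/-- A nonnegative function which is superharmonic and positive at one point of an irreducible
domain is positive. -/
theorem Irred.superharmonic_pos {A : Set V} (hA : Irred μ A) {F : V → ℝ≥0∞}
    (hF : ∀ x ∈ A, PA μ A F x ≤ F x) {x₁ : V} (hx₁ : x₁ ∈ A) (h1 : F x₁ ≠ 0) {x : V} (hx : x ∈ A) :
    F x ≠ 0 := by
  obtain ⟨k, c, hc0, hck, hcA, hcμ⟩ := hA x hx x₁ hx₁
  obtain ⟨ε, hε, H⟩ := path_le (A := A) hcμ
  have := H F hF 0 (by simpa using hcA)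
  rw [add_zero, add_zero, hc0, hck] at this
  refine ne_bot_of_le_ne_bot ?_ this
  exact mul_ne_zero (by simpa using hε) h1

end

section
variable {d : ℕ} {μ : (Fin d → ℤ) → ℝ} {θ : ℝ} {m : Fin d → ℝ} {i₀ : Fin d}

/-- The expected value of the renewal function at the exit from the orthant through the
coordinates other than `i₀`. -/
noncomputable def exitRenew (μ : (Fin d → ℤ) → ℝ) (i₀ : Fin d) (x : Fin d → ℤ) : ℝ≥0∞ :=
  pot (PA μ posAll) (stepInto μ (posDom {i₀} \ posAll) fun z => renew μ i₀ (z i₀)) x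

theorem Hyp.exitRenew_bound (h : Hyp μ θ m i₀) : ∃ C s δ : ℝ, 0 < C ∧ 0 < δ ∧ δ * d < s ∧
    ∀ x ∈ posAll, exitRenew μ i₀ x ≤ ENNReal.ofReal C *
      ∑ j ∈ Finset.univ.erase i₀, ENNReal.ofReal (Real.exp (-s * x j + δ * znorm x)) := by
  obtain ⟨s, δ, hδ, -, hs, H⟩ := h.exit_bound
  obtain ⟨C, hC, hUC⟩ := h.renew_le
  refine ⟨C / δ, s, δ, by positivity, hδ, hs, fun x hx => ?_⟩
  refine le_trans ?_ (mul_le_mul_right (H x hx) _)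
  rw [← smul_eq_mul, ← Pi.smul_apply, ← pot_smul, ← stepInto_smul]
  refine pot_PA_mono (fun z _ => stepInto_mono (fun w hw => ?_) z) x hx
  refine (hUC _ (mem_posDom_singleton.1 hw.1)).trans ?_
  rw [Pi.smul_apply, smul_eq_mul, ← ENNReal.ofReal_mul (by positivity)]
  refine ENNReal.ofReal_le_ofReal ?_
  rw [div_mul_eq_mul_div, le_div_iff₀ hδ, mul_assoc]
  refine mul_le_mul_of_nonneg_left ?_ (by linarith)
  have h1 := abs_apply_le_znorm w i₀
  have h2 := le_abs_self (w i₀ : ℝ)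
  have h3 := Real.add_one_le_exp (δ * znorm w)
  nlinarith

theorem Hyp.exitRenew_ne_top (h : Hyp μ θ m i₀) {x : Fin d → ℤ} (hx : x ∈ posAll) :
    exitRenew μ i₀ x ≠ ⊤ := by
  obtain ⟨C, s, δ, -, -, -, H⟩ := h.exitRenew_bound
  exact ne_top_of_le_ne_top (ENNReal.mul_ne_top ENNReal.ofReal_ne_top
    (ENNReal.sum_ne_top.2 fun _ _ => ENNReal.ofReal_ne_top)) (H x hx)

theorem Hyp.renew_ne_top (h : Hyp μ θ m i₀) {u : ℤ} (hu : 0 < u) : renew μ i₀ u ≠ ⊤ := by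
  obtain ⟨C, hC, hUC⟩ := h.renew_le
  exact ne_top_of_le_ne_top ENNReal.ofReal_ne_top (hUC u hu)

theorem Hyp.renew_eq (h : Hyp μ θ m i₀) {x : Fin d → ℤ} (hx : x ∈ posAll) :
    renew μ i₀ (x i₀) = PA μ posAll (fun z => renew μ i₀ (z i₀)) x +
      stepInto μ (posDom {i₀} \ posAll) (fun z => renew μ i₀ (z i₀)) x := by
  rw [← PA_eq_add_stepInto posAll_subset _ hx]
  exact (h.PA_renew (posAll_subset hx)).symm

theorem exitRenew_eq (x : Fin d → ℤ) :
    exitRenew μ i₀ x = stepInto μ (posDom {i₀} \ posAll) (fun z => renew μ i₀ (z i₀)) x +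
      PA μ posAll (exitRenew μ i₀) x := by
  have : exitRenew μ i₀ =
      pot (PA μ posAll) (stepInto μ (posDom {i₀} \ posAll) fun z => renew μ i₀ (z i₀)) := rfl
  conv_lhs => rw [this, (isKop_PA μ posAll).pot_eq]
  rfl

theorem Hyp.exitRenew_le (h : Hyp μ θ m i₀) {x : Fin d → ℤ} (hx : x ∈ posAll) :
    exitRenew μ i₀ x ≤ renew μ i₀ (x i₀) := by
  have hE : ∀ z ∈ posAll, PA μ posAll (fun z => renew μ i₀ (z i₀)) z +
      stepInto μ (posDom {i₀} \ posAll) (fun z => renew μ i₀ (z i₀)) z ≤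
      (fun z : Fin d → ℤ => renew μ i₀ (z i₀)) z := fun z hz => (h.renew_eq hz).ge
  exact pot_PA_le hE x hx

/-- The harmonic function of the orthant. -/
noncomputable def harmE (μ : (Fin d → ℤ) → ℝ) (i₀ : Fin d) (x : Fin d → ℤ) : ℝ≥0∞ :=
  renew μ i₀ (x i₀) - exitRenew μ i₀ x

theorem Hyp.harmE_toReal (h : Hyp μ θ m i₀) {x : Fin d → ℤ} (hx : x ∈ posAll) :
    (harmE μ i₀ x).toReal = (renew μ i₀ (x i₀)).toReal - (exitRenew μ i₀ x).toReal :=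
  ENNReal.toReal_sub_of_le (h.exitRenew_le hx) (h.renew_ne_top (hx i₀))

theorem Hyp.PA_harmE (h : Hyp μ θ m i₀) {x : Fin d → ℤ} (hx : x ∈ posAll) :
    PA μ posAll (harmE μ i₀) x = harmE μ i₀ x := by
  have hU := h.renew_eq hx
  have hB := exitRenew_eq (μ := μ) (i₀ := i₀) x
  have hBt := h.exitRenew_ne_top hx
  have hUt := h.renew_ne_top (hx i₀)
  have hsplit : PA μ posAll (fun z => renew μ i₀ (z i₀)) x =
      PA μ posAll (harmE μ i₀) x + PA μ posAll (exitRenew μ i₀) x := by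
    rw [← Pi.add_apply, ← map_add]
    refine congrFun (PA_congr fun z hz => ?_) x
    exact (tsub_add_cancel_of_le (h.exitRenew_le hz)).symm
  have hsum : renew μ i₀ (x i₀) = PA μ posAll (harmE μ i₀) x + exitRenew μ i₀ x := by
    rw [hU, hsplit, hB]; ring
  rw [harmE, hsum, ENNReal.add_sub_cancel_right hBt]

theorem Hyp.harmE_ne_zero (h : Hyp μ θ m i₀) {x : Fin d → ℤ} (hx : x ∈ posAll) :
    harmE μ i₀ x ≠ 0 := by
  obtain ⟨C, s, δ, hC, hδ, hs, H⟩ := h.exitRenew_bound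
  -- far from the other faces the exit term is negligible
  have hlim : Tendsto (fun K : ℕ => C * (d * Real.exp (-(s - δ * d) * K + δ))) atTop (𝓝 0) := by
    have h1 : Tendsto (fun K : ℕ => -(s - δ * d) * (K : ℝ) + δ) atTop atBot :=
      tendsto_atBot_add_const_right _ _
        ((tendsto_natCast_atTop_atTop (R := ℝ)).const_mul_atTop_of_neg (by linarith))
    have h2 := ((Real.tendsto_exp_atBot.comp h1).const_mul (d : ℝ)).const_mul C
    simpa using h2
  obtain ⟨K, hK, hK1⟩ := ((hlim.eventually_lt_const one_pos).and (eventually_ge_atTop 1)).exists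
  set w : Fin d → ℤ := fun j => if j = i₀ then 1 else K with hw
  have hwA : w ∈ posAll := fun j => by
    simp only [hw]
    split_ifs <;> omega
  have hwn : znorm w ≤ 1 + d * K := by
    unfold znorm
    calc ∑ j, |(w j : ℝ)| ≤ ∑ j : Fin d, ((if j = i₀ then 1 else 0) + (K : ℝ)) := by
          refine Finset.sum_le_sum fun j _ => ?_
          simp only [hw]
          split_ifs <;> simp
      _ = 1 + d * K := by
          rw [Finset.sum_add_distrib, Finset.sum_ite_eq' Finset.univ i₀ fun _ => (1 : ℝ)]
          simp
  refine h.irrA.superharmonic_pos (fun z hz => (h.PA_harmE hz).le) hwA ?_ hx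
  rw [harmE, ne_eq, tsub_eq_zero_iff_le, not_le]
  calc exitRenew μ i₀ w ≤ _ := H w hwA
    _ ≤ ENNReal.ofReal C * ∑ j ∈ Finset.univ.erase i₀,
        ENNReal.ofReal (Real.exp (-(s - δ * d) * K + δ)) := by
        refine mul_le_mul_right (Finset.sum_le_sum fun j hj => ?_) _
        refine ENNReal.ofReal_le_ofReal (Real.exp_le_exp.2 ?_)
        have : w j = K := if_neg (Finset.ne_of_mem_erase hj)
        rw [this]
        push_cast
        nlinarith
    _ ≤ ENNReal.ofReal (C * (d * Real.exp (-(s - δ * d) * K + δ))) := by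
        rw [Finset.sum_const, ENNReal.ofReal_mul hC.le, ENNReal.ofReal_mul (by positivity),
          nsmul_eq_mul, ENNReal.ofReal_natCast]
        refine mul_le_mul_right (mul_le_mul_left ?_ _) _
        exact_mod_cast (Finset.card_erase_le).trans (by simp)
    _ < 1 := by
        rw [← ENNReal.ofReal_one]
        exact (ENNReal.ofReal_lt_ofReal_iff one_pos).2 hK
    _ ≤ renew μ i₀ (w i₀) := by
        refine le_trans ?_ (le_renew _)
        simp [hw]

theorem Hyp.exitExp_eq (h : Hyp μ θ m i₀) {x : Fin d → ℤ} (hx : x ∈ posAll) :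
    (x i₀ : ℝ) - exitExp μ posAll Set.univ (fun y => (y i₀ : ℝ)) x = (harmE μ i₀ x).toReal := by
  set ψ : (Fin d → ℤ) → ℝ≥0∞ := fun z => overshoot μ i₀ (z i₀) with hψ
  set b : (Fin d → ℤ) → ℝ≥0∞ :=
    stepInto μ (posDom {i₀} \ posAll) fun z => ENNReal.ofReal (z i₀) with hb
  obtain ⟨K, hK, hψK⟩ := h.pot_overshoot_le
  have hψt : ∀ z ∈ posAll, pot (PA μ (posDom {i₀})) ψ z ≠ ⊤ := fun z hz =>
    ne_top_of_le_ne_top ENNReal.ofReal_ne_top (hψK z (posAll_subset hz))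
  have hdec : ∀ z ∈ posAll, exitRenew μ i₀ z = pot (PA μ posAll) b z +
      pot (PA μ posAll) (stepInto μ (posDom {i₀} \ posAll) (pot (PA μ (posDom {i₀})) ψ)) z := by
    intro z hz
    rw [← Pi.add_apply, ← pot_add, ← stepInto_add]
    unfold exitRenew
    have e : (fun w : Fin d → ℤ => renew μ i₀ (w i₀)) =
        (fun z => ENNReal.ofReal (z i₀)) + pot (PA μ (posDom {i₀})) ψ :=
      funext fun v => renew_apply v
    rw [e]
  have hbt : ∀ z ∈ posAll, pot (PA μ posAll) b z ≠ ⊤ := fun z hz =>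
    ne_top_of_le_ne_top (h.exitRenew_ne_top hz) (hdec z hz ▸ le_self_add)
  have hψA : ∀ z ∈ posAll, pot (PA μ posAll) ψ z ≠ ⊤ := fun z hz =>
    ne_top_of_le_ne_top (hψt z hz)
      (pot_PA_decomp (μ := μ) posAll_subset hz (hψt z hz) ▸ le_add_self)
  rw [_root_.exitExp_eq h.nn h.sum (fun y => (y i₀ : ℝ)) (p := b) (n := ψ) ?_ ?_ hbt hψA hx]
  · have h1 := hdec x hx
    have h2 := pot_PA_decomp (μ := μ) posAll_subset hx (hψt x hx)
    have h3 := renew_apply (μ := μ) (i₀ := i₀) x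
    have hx0 : (0 : ℝ) ≤ x i₀ := by exact_mod_cast (hx i₀).le
    have e1 := congrArg ENNReal.toReal h1
    have e2 := congrArg ENNReal.toReal h2
    have e3 := congrArg ENNReal.toReal h3
    have t : pot (PA μ posAll) (stepInto μ (posDom {i₀} \ posAll) (pot (PA μ (posDom {i₀})) ψ)) x
        ≠ ⊤ := ne_top_of_le_ne_top (h.exitRenew_ne_top hx) (h1 ▸ le_add_self)
    rw [ENNReal.toReal_add (hbt x hx) t] at e1
    rw [ENNReal.toReal_add t (hψA x hx)] at e2
    rw [renewCorr, ENNReal.toReal_add ENNReal.ofReal_ne_top (hψt x hx),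
      ENNReal.toReal_ofReal hx0] at e3
    rw [h.harmE_toReal hx, e1, e3, e2]
    ring
  · intro z hz
    simp only [hb, stepInto]
    congr 1
    funext u
    by_cases hu : z + u ∈ posAll
    · simp [hu]
    · rw [if_neg hu]
      by_cases hH : z + u ∈ posDom {i₀}
      · rw [if_pos ⟨hH, hu⟩]
      · rw [if_neg fun h => hH h.1, ENNReal.ofReal_of_nonpos]
        rw [mem_posDom_singleton, not_lt] at hH
        exact_mod_cast hH
  · intro z hz
    simp only [hψ, overshoot]
    congr 1
    funext u
    by_cases hu : z + u ∈ posAll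
    · rw [if_pos hu, ENNReal.ofReal_of_nonpos]
      have : (0 : ℝ) < ((z + u) i₀ : ℤ) := by exact_mod_cast hu i₀
      rw [Pi.add_apply] at this
      push_cast at this
      linarith
    · rw [if_neg hu, Pi.add_apply]
      push_cast
      rfl

/-- The ratio limit theorem for the Green function of the orthant in the centered form. -/
theorem Hyp.main (h : Hyp μ θ m i₀) :
    ∃ V : (Fin d → ℤ) → ℝ, (∀ x ∈ posAll,
        V x = (x i₀ : ℝ) - exitExp μ posAll Set.univ (fun y => (y i₀ : ℝ)) x) ∧
      (∀ x ∈ posAll, 0 < V x) ∧ HarmOn μ posAll V ∧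
      ∀ (t : ℕ → ℝ) (y : ℕ → Fin d → ℤ), Dir m i₀ t y → ∀ x ∈ posAll, ∀ x₀ ∈ posAll,
        Tendsto (fun n => green μ posAll x (y n) / green μ posAll x₀ (y n)) atTop
          (𝓝 (V x / V x₀)) := by
  have hpos : ∀ x ∈ posAll, 0 < (harmE μ i₀ x).toReal := fun x hx =>
    ENNReal.toReal_pos (h.harmE_ne_zero hx)
      (ne_top_of_le_ne_top (h.renew_ne_top (hx i₀)) tsub_le_self)
  refine ⟨fun x => (harmE μ i₀ x).toReal, fun x hx => (h.exitExp_eq hx).symm, hpos,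
    fun x hx => ?_, fun t y hy x hx x₀ hx₀ => ?_⟩
  · have hx' := h.PA_harmE hx
    have ht : PA μ posAll (harmE μ i₀) x ≠ ⊤ := by
      rw [hx']; exact ne_top_of_le_ne_top (h.renew_ne_top (hx i₀)) tsub_le_self
    have := (hasSum_PA_toReal h.nn hx ht).tsum_eq
    rw [hx'] at this
    exact this.symm
  · have hU1 : 0 < (renew μ i₀ 1).toReal := by
      refine ENNReal.toReal_pos (fun h0 => ?_) (h.renew_ne_top one_pos)
      have := le_renew (μ := μ) (i₀ := i₀) 1
      rw [h0] at this
      simp at this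
    have hlim : ∀ z ∈ posAll, Tendsto (fun n => green μ posAll z (y n) /
        (pot (PA μ (posDom {i₀})) (dl (y n)) (base d)).toReal) atTop
        (𝓝 ((harmE μ i₀ z).toReal / (renew μ i₀ 1).toReal)) := by
      intro z hz
      rw [h.harmE_toReal hz]
      refine (h.tendsto_green_orthant hy hz).congr fun n => ?_
      rw [green_eq h.nn h.sum hz]
    have hq := (hlim x hx).div (hlim x₀ hx₀) (div_pos (hpos x₀ hx₀) hU1).ne'
    rw [div_div_div_cancel_right₀ hU1.ne'] at hq
    refine hq.congr fun n => ?_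
    simp only [Pi.div_apply]
    refine div_div_div_cancel_right₀ ?_ _ _
    exact (ENNReal.toReal_pos (h.green_pos (hy.mem n) base_mem).ne'
      (h.green_ne_top _ base_mem)).ne'

end

section
variable {d : ℕ} {μ : (Fin d → ℤ) → ℝ}

theorem dotZ_sub (a : Fin d → ℝ) (x y : Fin d → ℤ) : dotZ a (x - y) = dotZ a x - dotZ a y := by
  simp [dotZ, mul_sub, Finset.sum_sub_distrib]

theorem dotZ_add_left (a b : Fin d → ℝ) (x : Fin d → ℤ) :
    dotZ (a + b) x = dotZ a x + dotZ b x := by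
  simp [dotZ, add_mul, Finset.sum_add_distrib]

theorem dotZ_smul (t : ℝ) (b : Fin d → ℝ) (x : Fin d → ℤ) : dotZ (t • b) x = t * dotZ b x := by
  simp [dotZ, mul_assoc, Finset.mul_sum]

/-- Exponential change of measure. -/
noncomputable def twist (μ : (Fin d → ℤ) → ℝ) (a : Fin d → ℝ) (z : Fin d → ℤ) : ℝ :=
  μ z * Real.exp (dotZ a z)

theorem twist_nonneg (hnn : ∀ z, 0 ≤ μ z) (a : Fin d → ℝ) (z : Fin d → ℤ) : 0 ≤ twist μ a z :=
  mul_nonneg (hnn z) (Real.exp_pos _).le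

theorem kern_twist (a : Fin d → ℝ) (A : Set (Fin d → ℤ)) (n : ℕ) (x y : Fin d → ℤ) :
    kern (twist μ a) A n x y = Real.exp (dotZ a y - dotZ a x) * kern μ A n x y := by
  induction n generalizing x with
  | zero =>
    by_cases h : x = y
    · subst h; simp [kern]
    · simp [kern, h]
  | succ n ih =>
    simp only [kern]
    rw [← tsum_mul_left]
    refine tsum_congr fun z => ?_
    rw [ih]
    split_ifs
    · rw [twist, dotZ_sub, Real.exp_sub, Real.exp_sub, Real.exp_sub]
      have := Real.exp_pos (dotZ a z)
      field_simp
    · ring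

theorem green_twist (a : Fin d → ℝ) (A : Set (Fin d → ℤ)) (x y : Fin d → ℤ) :
    green (twist μ a) A x y = Real.exp (dotZ a y - dotZ a x) * green μ A x y := by
  simp only [green, kern_twist, tsum_mul_left]

theorem exitExp_twist (a : Fin d → ℝ) (A B : Set (Fin d → ℤ)) (g : (Fin d → ℤ) → ℝ)
    (x : Fin d → ℤ) :
    exitExp μ A B (fun y => g y * Real.exp (dotZ a y)) x =
      Real.exp (dotZ a x) * exitExp (twist μ a) A B g x := by
  unfold exitExp
  rw [← tsum_mul_left]
  refine tsum_congr fun n => ?_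
  rw [← tsum_mul_left]
  refine tsum_congr fun z => ?_
  rw [kern_twist, ← tsum_mul_left, ← tsum_mul_left, ← tsum_mul_left]
  refine tsum_congr fun y => ?_
  split_ifs
  · rw [twist, dotZ_sub, Real.exp_sub, Real.exp_sub]
    have := Real.exp_pos (dotZ a z)
    have := Real.exp_pos (dotZ a x)
    field_simp
  · ring

theorem HarmOn.untwist {a : Fin d → ℝ} {A : Set (Fin d → ℤ)} {V W : (Fin d → ℤ) → ℝ}
    (h : HarmOn (twist μ a) A V) (hW : ∀ x ∈ A, W x = Real.exp (dotZ a x) * V x) :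
    HarmOn μ A W := by
  intro x hx
  rw [hW x hx, h x hx, ← tsum_mul_left]
  refine tsum_congr fun y => ?_
  split_ifs with hy
  · rw [hW y hy, twist, dotZ_sub, Real.exp_sub]
    have := Real.exp_pos (dotZ a x)
    field_simp
  · ring

theorem Irred.twist {A : Set (Fin d → ℤ)} (h : Irred μ A) (a : Fin d → ℝ) :
    Irred (twist μ a) A := by
  intro x hx x' hx'
  obtain ⟨k, c, h0, hk, hA, hc⟩ := h x hx x' hx'
  exact ⟨k, c, h0, hk, hA, fun j hj => mul_pos (hc j hj) (Real.exp_pos _)⟩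

theorem summable_of_phiE_ne_top (hnn : ∀ z, 0 ≤ μ z) {a : Fin d → ℝ} (h : phiE μ a ≠ ⊤) :
    Summable (twist μ a) := by
  refine (ENNReal.summable_toReal h).congr fun z => ?_
  exact ENNReal.toReal_ofReal (twist_nonneg hnn a z)

theorem exp_znorm_le (t : ℝ) (z : Fin d → ℤ) :
    Real.exp (t * znorm z) ≤
      ∑ ε : Fin d → Bool, Real.exp (dotZ (fun j => if ε j then t else -t) z) := by
  have : Real.exp (t * znorm z) =
      Real.exp (dotZ (fun j => if (decide (0 ≤ z j) : Bool) then t else -t) z) := by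
    congr 1
    rw [znorm, dotZ, Finset.mul_sum]
    refine Finset.sum_congr rfl fun j _ => ?_
    by_cases hj : 0 ≤ z j
    · have : (0 : ℝ) ≤ z j := by exact_mod_cast hj
      simp [hj, abs_of_nonneg this]
    · have : (z j : ℝ) < 0 := by exact_mod_cast not_le.1 hj
      simp [hj, abs_of_neg this]
  rw [this]
  exact Finset.single_le_sum
    (f := fun ε : Fin d → Bool => Real.exp (dotZ (fun j => if ε j then t else -t) z))
    (fun _ _ => (Real.exp_pos _).le) (Finset.mem_univ fun j => decide (0 ≤ z j))

theorem A2.exists_moment (hA2 : A2 μ) (hnn : ∀ z, 0 ≤ μ z) {a : Fin d → ℝ} (ha : a ∈ Dset μ) :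
    ∃ θ : ℝ, 0 < θ ∧ Summable fun z => twist μ a z * Real.exp (θ * znorm z) := by
  obtain ⟨U, hU, hDU, hfin⟩ := hA2
  obtain ⟨r, hr, hball⟩ := Metric.isOpen_iff.1 hU a (hDU ha)
  refine ⟨r / 2, by positivity, ?_⟩
  have hs : Summable fun z => ∑ ε : Fin d → Bool,
      twist μ (a + fun j => if ε j then r / 2 else -(r / 2)) z := by
    refine summable_sum fun ε _ => summable_of_phiE_ne_top hnn (hfin _ (hball ?_))
    rw [mem_ball_iff_norm, add_sub_cancel_left]
    refine lt_of_le_of_lt ((pi_norm_le_iff_of_nonneg (by positivity : 0 ≤ r / 2)).2 fun j => ?_)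
      (half_lt_self hr)
    split_ifs
    · rw [Real.norm_eq_abs, abs_of_pos (by positivity)]
    · rw [norm_neg, Real.norm_eq_abs, abs_of_pos (by positivity)]
  refine Summable.of_nonneg_of_le
    (fun z => mul_nonneg (twist_nonneg hnn a z) (Real.exp_pos _).le) (fun z => ?_) hs
  refine (mul_le_mul_of_nonneg_left (exp_znorm_le (r / 2) z) (twist_nonneg hnn a z)).trans
    (le_of_eq ?_)
  rw [Finset.mul_sum]
  refine Finset.sum_congr rfl fun ε _ => ?_
  rw [twist, twist, dotZ_add_left, Real.exp_add, mul_assoc]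

theorem abs_dotZ_le (b : Fin d → ℝ) (z : Fin d → ℤ) : |dotZ b z| ≤ (1 + ∑ j, |b j|) * znorm z := by
  unfold dotZ znorm
  refine (Finset.abs_sum_le_sum_abs _ _).trans ?_
  rw [Finset.mul_sum]
  refine Finset.sum_le_sum fun j _ => ?_
  rw [abs_mul]
  refine mul_le_mul_of_nonneg_right ?_ (abs_nonneg _)
  have := Finset.single_le_sum (f := fun j => |b j|) (fun _ _ => abs_nonneg _) (Finset.mem_univ j)
  linarith

/-- Second order upper bound for the generating function near a point with exponential moments. -/
theorem exists_phiE_le (hnn : ∀ z, 0 ≤ μ z) {a : Fin d → ℝ} {θ : ℝ} (hθ : 0 < θ)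
    (hmom : Summable fun z => twist μ a z * Real.exp (θ * znorm z)) {S : ℝ}
    (hS : HasSum (twist μ a) S) {m : Fin d → ℝ}
    (hm : ∀ j, HasSum (fun z : Fin d → ℤ => twist μ a z * (z j : ℝ)) (m j)) (b : Fin d → ℝ) :
    ∃ C t₀ : ℝ, 0 < t₀ ∧ ∀ t, 0 ≤ t → t ≤ t₀ →
      phiE μ (a + t • b) ≤ ENNReal.ofReal (S + t * dotR b m + t ^ 2 * C) := by
  set R := 1 + ∑ j, |b j|
  have hR : 0 < R := by positivity
  set M := ∑' z, twist μ a z * Real.exp (θ * znorm z)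
  refine ⟨R ^ 2 * (8 / θ ^ 2) * M, θ / (2 * R), by positivity, fun t ht ht' => ?_⟩
  rw [le_div_iff₀ (by positivity)] at ht'
  have hbm : HasSum (fun z => twist μ a z * dotZ b z) (dotR b m) := by
    have h1 := hasSum_sum (s := Finset.univ) fun j _ => (hm j).mul_left (b j)
    have e : (fun z => twist μ a z * dotZ b z) =
        fun z => ∑ j, b j * (twist μ a z * (z j : ℝ)) := by
      funext z
      rw [dotZ, Finset.mul_sum]
      exact Finset.sum_congr rfl fun j _ => by ring
    rw [e]
    exact h1
  have hF : HasSum (fun z => twist μ a z + t * (twist μ a z * dotZ b z) +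
      t ^ 2 * (R ^ 2 * (8 / θ ^ 2) * (twist μ a z * Real.exp (θ * znorm z))))
      (S + t * dotR b m + t ^ 2 * (R ^ 2 * (8 / θ ^ 2) * M)) :=
    (hS.add (hbm.mul_left t)).add ((hmom.hasSum.mul_left _).mul_left _)
  have hpt : ∀ z, μ z * Real.exp (dotZ (a + t • b) z) ≤
      twist μ a z + t * (twist μ a z * dotZ b z) +
      t ^ 2 * (R ^ 2 * (8 / θ ^ 2) * (twist μ a z * Real.exp (θ * znorm z))) := by
    intro z
    have hw := twist_nonneg hnn a z
    have hz := znorm_nonneg z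
    have hb := abs_dotZ_le b z
    rw [dotZ_add_left, dotZ_smul, Real.exp_add, ← mul_assoc]
    change twist μ a z * _ ≤ _
    have key : Real.exp (t * dotZ b z) ≤
        1 + t * dotZ b z + t ^ 2 * (R ^ 2 * (8 / θ ^ 2) * Real.exp (θ * znorm z)) := by
      refine (exp_le_quad _).trans ?_
      have h1 : |t * dotZ b z| ≤ θ / 2 * znorm z := by
        rw [abs_mul, abs_of_nonneg ht]
        calc t * |dotZ b z| ≤ t * (R * znorm z) := by gcongr
          _ ≤ _ := by nlinarith
      have h2 : (dotZ b z) ^ 2 ≤ (R * znorm z) ^ 2 := sq_le_sq' (by linarith [neg_abs_le (dotZ b z)])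
        ((le_abs_self _).trans hb)
      have h3 : znorm z ^ 2 ≤ 8 / θ ^ 2 * Real.exp (θ / 2 * znorm z) := by
        have := Real.quadratic_le_exp_of_nonneg (x := θ / 2 * znorm z) (by positivity)
        rw [div_mul_eq_mul_div, le_div_iff₀ (by positivity)]
        have : 0 ≤ θ / 2 * znorm z := by positivity
        nlinarith
      have h4 : Real.exp |t * dotZ b z| ≤ Real.exp (θ / 2 * znorm z) := Real.exp_le_exp.2 h1
      have h5 : Real.exp (θ * znorm z) = Real.exp (θ / 2 * znorm z) * Real.exp (θ / 2 * znorm z) := by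
        rw [← Real.exp_add]; ring_nf
      have h6 : (t * dotZ b z) ^ 2 * Real.exp |t * dotZ b z| ≤
          t ^ 2 * (R ^ 2 * (8 / θ ^ 2 * Real.exp (θ / 2 * znorm z))) *
            Real.exp (θ / 2 * znorm z) := by
        refine mul_le_mul ?_ h4 (Real.exp_pos _).le (by positivity)
        rw [mul_pow]
        refine mul_le_mul_of_nonneg_left (h2.trans ?_) (sq_nonneg t)
        rw [mul_pow]
        exact mul_le_mul_of_nonneg_left h3 (sq_nonneg R)
      rw [h5]
      linarith
    calc _ ≤ _ := mul_le_mul_of_nonneg_left key hw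
      _ = _ := by ring
  have hnn' : ∀ z, 0 ≤ μ z * Real.exp (dotZ (a + t • b) z) := fun z => twist_nonneg hnn _ z
  have hs := Summable.of_nonneg_of_le hnn' hpt hF.summable
  rw [phiE, ← ENNReal.ofReal_tsum_of_nonneg hnn' hs]
  refine ENNReal.ofReal_le_ofReal ?_
  rw [← hF.tsum_eq]
  exact hs.tsum_le_tsum hpt hF.summable

theorem dotR_add (a b q : Fin d → ℝ) : dotR (a + b) q = dotR a q + dotR b q := by
  simp [dotR, add_mul, Finset.sum_add_distrib]

theorem dotR_smul (t : ℝ) (b q : Fin d → ℝ) : dotR (t • b) q = t * dotR b q := by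
  simp [dotR, mul_assoc, Finset.mul_sum]

theorem dotR_comm (a b : Fin d → ℝ) : dotR a b = dotR b a := by
  simp [dotR, mul_comm]

theorem dotR_self_pos {a : Fin d → ℝ} (ha : a ≠ 0) : 0 < dotR a a := by
  obtain ⟨j, hj⟩ := Function.ne_iff.1 ha
  exact Finset.sum_pos' (fun i _ => mul_self_nonneg _) ⟨j, Finset.mem_univ j, mul_self_pos.2 hj⟩

theorem exists_smul_of_dotR {m q : Fin d → ℝ} (hm : m ≠ 0) (hq : q ≠ 0)
    (h : ∀ b, dotR b m < 0 → dotR b q ≤ 0) : ∃ c : ℝ, 0 < c ∧ q = c • m := by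
  have hmm := dotR_self_pos hm
  set c := dotR q m / dotR m m with hc
  have hcm : c * dotR m m = dotR q m := div_mul_cancel₀ _ hmm.ne'
  have hc0 : 0 ≤ c := by
    have e1 : dotR ((-1 : ℝ) • m) m = -dotR m m := by rw [dotR_smul]; ring
    have e2 : dotR ((-1 : ℝ) • m) q = -dotR q m := by rw [dotR_smul, dotR_comm m q]; ring
    have := h ((-1 : ℝ) • m) (by linarith)
    refine div_nonneg (by linarith) hmm.le
  set r := q + (-c) • m with hr
  have hrm : dotR r m = 0 := by rw [hr, dotR_add, dotR_smul]; linarith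
  have hrq : dotR r q = dotR r r := by
    have : dotR r r = dotR r q := by
      conv_lhs => rw [dotR_comm, hr, dotR_add, dotR_smul, ← hr, dotR_comm m r, hrm, dotR_comm q r]
      ring
    exact this.symm
  have hr0 : r = 0 := by
    by_contra hne
    have hrr := dotR_self_pos hne
    -- a small perturbation of `r` pointing against `m`
    obtain ⟨ε, hε, hεr⟩ : ∃ ε : ℝ, 0 < ε ∧ ε * dotR q m < dotR r r := by
      have h1 : 0 ≤ dotR q m := hcm ▸ mul_nonneg hc0 hmm.le
      refine ⟨dotR r r / (dotR q m + 1), by positivity, ?_⟩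
      rw [div_mul_eq_mul_div, div_lt_iff₀ (by positivity)]
      nlinarith
    have := h (r + (-ε) • m) (by rw [dotR_add, dotR_smul, hrm]; nlinarith)
    rw [dotR_add, dotR_smul, hrq, dotR_comm m q] at this
    linarith
  have hqc : q = c • m := by
    have : q = r + c • m := by rw [hr]; simp
    rw [this, hr0, zero_add]
  refine ⟨c, lt_of_le_of_ne hc0 fun h0 => hq ?_, hqc⟩
  rw [hqc, ← h0, zero_smul]

/-- At the maximizer of `a ↦ a · q` over `D`, the twisted measure is a probability with mean
proportional to `q`. -/
theorem twist_of_isMax (hnn : ∀ z, 0 ≤ μ z) (hsum : HasSum μ 1) (hA3 : A3 μ) {q a : Fin d → ℝ}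
    (hq : q ≠ 0) (haD : a ∈ Dset μ) (hmax : ∀ b ∈ Dset μ, dotR b q ≤ dotR a q)
    {θ : ℝ} (hθ : 0 < θ) (hmom : Summable fun z => twist μ a z * Real.exp (θ * znorm z)) :
    HasSum (twist μ a) 1 ∧ ∃ m : Fin d → ℝ,
      (∀ j, HasSum (fun z : Fin d → ℤ => twist μ a z * (z j : ℝ)) (m j)) ∧
      ∃ c : ℝ, 0 < c ∧ q = c • m := by
  have hne : phiE μ a ≠ ⊤ := ne_top_of_le_ne_top ENNReal.one_ne_top haD
  have hs := summable_of_phiE_ne_top hnn hne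
  have hm : ∀ j, HasSum (fun z : Fin d → ℤ => twist μ a z * (z j : ℝ))
      (∑' z : Fin d → ℤ, twist μ a z * (z j : ℝ)) := by
    intro j
    refine Summable.hasSum (Summable.of_norm_bounded (hmom.mul_left θ⁻¹) fun z => ?_)
    have hw := twist_nonneg hnn a z
    rw [Real.norm_eq_abs, abs_mul, abs_of_nonneg hw]
    have h1 := abs_apply_le_znorm z j
    have h2 := Real.add_one_le_exp (θ * znorm z)
    have h3 : |(z j : ℝ)| ≤ θ⁻¹ * Real.exp (θ * znorm z) := by
      rw [inv_mul_eq_div, le_div_iff₀ hθ]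
      nlinarith
    calc _ ≤ twist μ a z * (θ⁻¹ * Real.exp (θ * znorm z)) := mul_le_mul_of_nonneg_left h3 hw
      _ = _ := by ring
  set m : Fin d → ℝ := fun j => ∑' z : Fin d → ℤ, twist μ a z * (z j : ℝ)
  have hS := hs.hasSum
  set S := ∑' z, twist μ a z
  have hS1 : S ≤ 1 := by
    have : ENNReal.ofReal S ≤ 1 := by
      rw [ENNReal.ofReal_tsum_of_nonneg (twist_nonneg hnn a) hs]
      exact haD
    exact ENNReal.ofReal_le_one.1 this
  have hdir : ∀ b : Fin d → ℝ, (S < 1 ∨ dotR b m < 0) → dotR b q ≤ 0 := by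
    intro b hb
    obtain ⟨C, t₀, ht₀, H⟩ := exists_phiE_le hnn hθ hmom hS hm b
    have hev : ∀ᶠ t in 𝓝[>] (0 : ℝ), S + t * dotR b m + t ^ 2 * C ≤ 1 := by
      by_cases hS' : S < 1
      · have hc : Tendsto (fun t : ℝ => S + t * dotR b m + t ^ 2 * C) (𝓝 0) (𝓝 S) := by
          have : Continuous fun t : ℝ => S + t * dotR b m + t ^ 2 * C := by fun_prop
          simpa using this.tendsto 0
        exact ((hc.mono_left nhdsWithin_le_nhds).eventually_lt_const hS').mono fun t ht => ht.le
      · have hbm : dotR b m < 0 := hb.resolve_left hS'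
        have hc : Tendsto (fun t : ℝ => dotR b m + t * C) (𝓝 0) (𝓝 (dotR b m)) := by
          have : Continuous fun t : ℝ => dotR b m + t * C := by fun_prop
          simpa using this.tendsto 0
        filter_upwards [(hc.mono_left nhdsWithin_le_nhds).eventually_lt_const hbm,
          self_mem_nhdsWithin] with t ht ht0
        have : t * (dotR b m + t * C) ≤ 0 := mul_nonpos_of_nonneg_of_nonpos (le_of_lt ht0) ht.le
        nlinarith
    obtain ⟨t, ht1, ht2, ht3⟩ :=
      (hev.and (eventually_of_mem (Ioo_mem_nhdsGT ht₀) fun _ h => h)).exists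
    have hmem : a + t • b ∈ Dset μ :=
      (H t ht2.le ht3.le).trans (by rw [← ENNReal.ofReal_one]; exact ENNReal.ofReal_le_ofReal ht1)
    have := hmax _ hmem
    rw [dotR_add, dotR_smul] at this
    nlinarith
  have hSeq : S = 1 := by
    refine le_antisymm hS1 (not_lt.1 fun hlt => ?_)
    exact absurd (hdir q (Or.inl hlt)) (not_le.2 (dotR_self_pos hq))
  rw [hSeq] at hS
  refine ⟨hS, m, hm, exists_smul_of_dotR (fun hm0 => ?_) hq fun b hb => hdir b (Or.inr hb)⟩
  -- if the twisted mean vanishes, the twist is trivial on the support of `μ`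
  have ham : HasSum (fun z => twist μ a z * dotZ a z) 0 := by
    have h1 := hasSum_sum (s := Finset.univ) fun j _ => (hm j).mul_left (a j)
    have e : (fun z => twist μ a z * dotZ a z) =
        fun z => ∑ j, a j * (twist μ a z * (z j : ℝ)) := by
      funext z
      rw [dotZ, Finset.mul_sum]
      exact Finset.sum_congr rfl fun j _ => by ring
    rw [e]
    have e0 : ∑ j, a j * m j = 0 := by simp [hm0]
    exact e0 ▸ h1
  have hzero : HasSum (fun z => twist μ a z * (Real.exp (-dotZ a z) - 1 + dotZ a z)) 0 := by
    have h1 := (hsum.sub hS).add ham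
    have e : (fun z => twist μ a z * (Real.exp (-dotZ a z) - 1 + dotZ a z)) =
        fun z => μ z - twist μ a z + twist μ a z * dotZ a z := by
      funext z
      have : twist μ a z * Real.exp (-dotZ a z) = μ z := by
        rw [twist, mul_assoc, ← Real.exp_add]; simp
      linear_combination this
    rw [e]
    simpa using h1
  have hpos : ∀ z, 0 ≤ twist μ a z * (Real.exp (-dotZ a z) - 1 + dotZ a z) := fun z =>
    mul_nonneg (twist_nonneg hnn a z) (by linarith [Real.add_one_le_exp (-dotZ a z)])
  have h0 := (hasSum_zero_iff_of_nonneg hpos).1 hzero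
  have htw : ∀ z, twist μ a z = μ z := by
    intro z
    rcases mul_eq_zero.1 (congrFun h0 z) with hz | hz
    · rw [hz]
      exact ((mul_eq_zero.1 hz).resolve_right (Real.exp_pos _).ne').symm
    · have : dotZ a z = 0 := by
        by_contra hne
        have := Real.add_one_lt_exp (neg_ne_zero.2 hne)
        linarith
      rw [twist, this, Real.exp_zero, mul_one]
  refine hA3 (funext fun j => ?_)
  rw [← congrFun hm0 j]
  exact tsum_congr fun z => by rw [htw]

theorem posDom_univ : posDom (Set.univ : Set (Fin d)) = posAll := by
  ext x; simp [posDom, posAll]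

theorem statement5_aux (hnn : ∀ z, 0 ≤ μ z) (hsum : HasSum μ 1)
    (hA1 : A1 μ) (hA2 : A2 μ) (hA3 : A3 μ)
    {q : Fin d → ℝ} (hq1 : rnorm q = 1) (hq2 : ∀ i, 0 ≤ q i)
    {i₀ : Fin d} (hΛq : {i | q i = 0} = {i₀})
    {aq : Fin d → ℝ} (haqD : aq ∈ Dset μ) (haqMax : ∀ a ∈ Dset μ, dotR a q ≤ dotR aq q) :
    ∃ (θ c : ℝ) (m : Fin d → ℝ), 0 < c ∧ q = c • m ∧ Hyp (twist μ aq) θ m i₀ := by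
  have hq : q ≠ 0 := by
    rintro rfl
    simp [rnorm] at hq1
  obtain ⟨θ, hθ, hmom⟩ := hA2.exists_moment hnn haqD
  obtain ⟨hS, m, hm, c, hc, hqc⟩ := twist_of_isMax hnn hsum hA3 hq haqD haqMax hθ hmom
  have hq0 : ∀ j, q j = 0 ↔ j = i₀ := fun j => by
    have : j ∈ {i | q i = 0} ↔ j ∈ ({i₀} : Set (Fin d)) := by rw [hΛq]
    simpa using this
  have hqm : ∀ j, q j = c * m j := fun j => by rw [hqc]; rfl
  refine ⟨θ, c, m, hc, hqc, ⟨twist_nonneg hnn aq, hS, hθ, hmom, hm, ?_, fun j hj => ?_, ?_,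
    (hA1 _).twist aq, ?_⟩⟩
  · have := (hq0 i₀).2 rfl
    rw [hqm] at this
    exact (mul_eq_zero.1 this).resolve_left hc.ne'
  · have : 0 < q j := lt_of_le_of_ne (hq2 j) fun h => hj ((hq0 j).1 h.symm)
    rw [hqm] at this
    exact (mul_pos_iff_of_pos_left hc).1 this
  · by_contra hcon
    push Not at hcon
    have : rnorm q = 0 := Finset.sum_eq_zero fun j _ => by rw [(hq0 j).2 (hcon j), abs_zero]
    linarith
  · rw [← posDom_univ]
    exact (hA1 _).twist aq

theorem dir_of_tendsto {m q : Fin d → ℝ} {c : ℝ} (hc : 0 < c) (hqc : q = c • m) {i₀ : Fin d}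
    {xs : ℕ → Fin d → ℤ} (hxs : ∀ n, xs n ∈ posAll)
    (hinf : Tendsto (fun n => znorm (xs n)) atTop atTop)
    (hdir : Tendsto (fun n i => (xs n i : ℝ) / znorm (xs n)) atTop (𝓝 q)) :
    Dir m i₀ (fun n => c * znorm (xs n)) xs := by
  refine ⟨fun n => posAll_subset (hxs n), hinf.const_mul_atTop hc, fun ε hε => ?_⟩
  refine eventually_all.2 fun j => ?_
  have h1 := tendsto_pi_nhds.1 hdir j
  filter_upwards [h1.eventually (Metric.ball_mem_nhds _ (mul_pos hε hc)),
    hinf.eventually_gt_atTop 0] with n hn hn0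
  rw [Real.dist_eq, abs_lt] at hn
  have e : q j = c * m j := by rw [hqc]; rfl
  have h2 : (xs n j : ℝ) = (xs n j : ℝ) / znorm (xs n) * znorm (xs n) :=
    (div_mul_cancel₀ _ hn0.ne').symm
  rw [e] at hn
  rw [abs_le]
  constructor
  · nlinarith [hn.1]
  · nlinarith [hn.2]

end

theorem statement5 {d : ℕ} (μ : (Fin d → ℤ) → ℝ)
    (hnn : ∀ z, 0 ≤ μ z) (hsum : HasSum μ 1)
    (hA1 : A1 μ) (hA2 : A2 μ) (hA3 : A3 μ)
    (q : Fin d → ℝ) (hq1 : rnorm q = 1) (hq2 : ∀ i, 0 ≤ q i)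
    (i₀ : Fin d) (hΛq : {i | q i = 0} = {i₀})
    -- `a(q)` : the (unique) maximizer over `D` of `a ↦ a·q`
    (aq : Fin d → ℝ) (haqD : aq ∈ Dset μ) (haqMax : ∀ a ∈ Dset μ, dotR a q ≤ dotR aq q)
    (x₀ : Fin d → ℤ) (hx₀ : x₀ ∈ posAll) :
    -- (i)
    ((∀ x ∈ posAll, 0 < hq5 μ aq i₀ x) ∧ HarmOn μ posAll (hq5 μ aq i₀)) ∧
    -- (ii)
    (∀ xs : ℕ → (Fin d → ℤ), (∀ n, xs n ∈ posAll) →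
      Tendsto (fun n => znorm (xs n)) atTop atTop →
      Tendsto (fun n i => (xs n i : ℝ) / znorm (xs n)) atTop (𝓝 q) →
      Fundamental μ posAll x₀ xs ∧
      ∀ x ∈ posAll,
        Tendsto (fun n => green μ posAll x (xs n) / green μ posAll x₀ (xs n)) atTop
          (𝓝 (hq5 μ aq i₀ x / hq5 μ aq i₀ x₀))) := by
  obtain ⟨θ, c, m, hc, hqc, h⟩ := statement5_aux hnn hsum hA1 hA2 hA3 hq1 hq2 hΛq haqD haqMax
  obtain ⟨V, hV, hVpos, hVharm, hVlim⟩ := h.main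
  have hh : ∀ x ∈ posAll, hq5 μ aq i₀ x = Real.exp (dotZ aq x) * V x := fun x hx => by
    rw [hq5, exitExp_twist, hV x hx]
    ring
  have hlim : ∀ xs : ℕ → (Fin d → ℤ), (∀ n, xs n ∈ posAll) →
      Tendsto (fun n => znorm (xs n)) atTop atTop →
      Tendsto (fun n i => (xs n i : ℝ) / znorm (xs n)) atTop (𝓝 q) →
      ∀ x ∈ posAll,
        Tendsto (fun n => green μ posAll x (xs n) / green μ posAll x₀ (xs n)) atTop
          (𝓝 (hq5 μ aq i₀ x / hq5 μ aq i₀ x₀)) := by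
    intro xs hxs hinf hdir x hx
    have h1 := (hVlim _ xs (dir_of_tendsto hc hqc hxs hinf hdir) x hx x₀ hx₀).const_mul
      (Real.exp (dotZ aq x) / Real.exp (dotZ aq x₀))
    rw [hh x hx, hh x₀ hx₀, mul_div_mul_comm]
    refine h1.congr fun n => ?_
    rw [green_twist, green_twist, mul_div_mul_comm, ← Real.exp_sub, ← Real.exp_sub, ← mul_assoc,
      ← Real.exp_add]
    ring_nf
    simp
  refine ⟨⟨fun x hx => ?_, hVharm.untwist hh⟩, fun xs hxs hinf hdir =>
    ⟨fun x hx => ⟨_, hlim xs hxs hinf hdir x hx⟩, hlim xs hxs hinf hdir⟩⟩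
  rw [hh x hx]
  exact mul_pos (Real.exp_pos _) (hVpos x hx)
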